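/- For every integer k ≥ 1, every real number a ≥ 1/3 and every ε > 0, as X → ∞ one has Σ_{d ∈ D^-(X,1,4)} (a^{ω(d)} f̃(d))^k = (1/2^{5k}) · Σ_{d ∈ D^-(X,1,4)} (3a)^{k·ω(d)} + O( X (log X)^{(3a)^k − a^k − 1 + ε} ). -/

import Mathlib

open Finset Filter Asymptotics

open scoped Classical

noncomputable section

/-- `D` is a fundamental discriminant: either `D ≡ 1 (mod 4)` and `D` is squarefree,
or `D = 4m` with `m` squarefree and `m ≡ 2, 3 (mod 4)`. -/
def IsFundDisc (D : ℤ) : Prop :=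
  (D % 4 = 1 ∧ Squarefree D) ∨
    ∃ m : ℤ, D = 4 * m ∧ Squarefree m ∧ (m % 4 = 2 ∨ m % 4 = 3)

/-- `ω(d)`, the number of distinct primes dividing `|d|`. -/
def omegaZ (d : ℤ) : ℕ := d.natAbs.primeFactors.card

/-- The Legendre symbol `(m/p)` for odd primes `p`, and the Kronecker symbol at `p = 2`
(`0` if `m` is even, `1` if `m ≡ ±1 (mod 8)`, `-1` if `m ≡ ±3 (mod 8)`). -/
def kron (m : ℤ) (p : ℕ) : ℤ :=
  if p = 2 then
    if m % 2 = 0 then 0 else if m % 8 = 1 ∨ m % 8 = 7 then 1 else -1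
  else jacobiSym m p

/-- `α(d) = 1` if `d > 0` and `α(d) = 0` if `d < 0`. -/
def alphaFD (d : ℤ) : ℕ := if 0 < d then 1 else 0

/-- Ordered triples `(d₁, d₂, d₃)` of pairwise coprime fundamental discriminants,
each `≠ 1`, with `d₁ * d₂ * d₃ = d`. -/
def fdTriples (d : ℤ) : Finset (ℤ × ℤ × ℤ) :=
  (Finset.Icc (-(d.natAbs : ℤ)) (d.natAbs : ℤ) ×ˢ
      Finset.Icc (-(d.natAbs : ℤ)) (d.natAbs : ℤ) ×ˢ
      Finset.Icc (-(d.natAbs : ℤ)) (d.natAbs : ℤ)).filter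
    fun t =>
      IsFundDisc t.1 ∧ IsFundDisc t.2.1 ∧ IsFundDisc t.2.2 ∧
      t.1 ≠ 1 ∧ t.2.1 ≠ 1 ∧ t.2.2 ≠ 1 ∧
      IsCoprime t.1 t.2.1 ∧ IsCoprime t.1 t.2.2 ∧ IsCoprime t.2.1 t.2.2 ∧
      t.1 * t.2.1 * t.2.2 = d

/-- The summand attached to a factorization `d = d₁ d₂ d₃`:
`∏_{p ∣ d₃} (1 + (d₁d₂/p)) · ∏_{p ∣ d₂} (1 + (d₁d₃/p)) · ∏_{p ∣ d₁} (1 + (d₂d₃/p))`. -/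
def tripleTerm (t : ℤ × ℤ × ℤ) : ℤ :=
  (∏ p ∈ t.2.2.natAbs.primeFactors, (1 + kron (t.1 * t.2.1) p)) *
    (∏ p ∈ t.2.1.natAbs.primeFactors, (1 + kron (t.1 * t.2.2) p)) *
    (∏ p ∈ t.1.natAbs.primeFactors, (1 + kron (t.2.1 * t.2.2) p))

/-- `f̃(d) = 2^{-3-α(d)} Σ_{{d₁,d₂,d₃}} (…)`, the sum over *unordered* triples of
pairwise coprime fundamental discriminants `≠ 1` with product `d`.  Since the summand is
symmetric and the entries of any such triple are pairwise distinct, the unordered sum is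
one sixth of the ordered sum. -/
def ftilde (d : ℤ) : ℝ :=
  (1 / 2 ^ (3 + alphaFD d) : ℝ) * ((1 : ℝ) / 6) * ∑ t ∈ fdTriples d, (tripleTerm t : ℝ)

/-- `D⁻(X, n, m)`: fundamental discriminants `d` with `0 < -d < X` and `d ≡ n (mod m)`. -/
def Dminus (X : ℝ) (n m : ℤ) : Finset ℤ :=
  (Finset.Icc (-⌈X⌉) ⌈X⌉).filter fun d =>
    IsFundDisc d ∧ d < 0 ∧ -X < (d : ℝ) ∧ d % m = n % m

/-- `D⁺(X, n, m)`: fundamental discriminants `d` with `0 < d < X` and `d ≡ n (mod m)`. -/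
def Dplus (X : ℝ) (n m : ℤ) : Finset ℤ :=
  (Finset.Icc (-⌈X⌉) ⌈X⌉).filter fun d =>
    IsFundDisc d ∧ 0 < d ∧ (d : ℝ) < X ∧ d % m = n % m

/-! ### Unlinked sets of indices -/

/-- The indices of the `k`-fold expansion: in each coordinate a colour in `Fin 3` together with a
flag telling whether the prime is attached to a character. -/
abbrev Idx (k : ℕ) := Fin k → Fin 3 × Bool

/-- The linking parity of two one-coordinate indices. -/
def linkOne (x y : Fin 3 × Bool) : ZMod 2 := if x.1 ≠ y.1 ∧ x.2 ≠ y.2 then 1 else 0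

/-- The linking parity of two indices. -/
def linkParity {k : ℕ} (u v : Idx k) : ZMod 2 := ∑ s, linkOne (u s) (v s)

/-- A set of pairwise unlinked indices. -/
def Unlinked {k : ℕ} (U : Finset (Idx k)) : Prop := ∀ u ∈ U, ∀ v ∈ U, linkParity u v = 0

/-- The tails of the elements of `U` with first coordinate `c`. -/
def headFiber {k : ℕ} (U : Finset (Idx (k + 1))) (c : Fin 3 × Bool) : Finset (Idx k) :=
  univ.filter fun u => (Fin.cons c u : Idx (k + 1)) ∈ U

lemma mem_headFiber {k : ℕ} {U : Finset (Idx (k + 1))} {c : Fin 3 × Bool} {u : Idx k} :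
    u ∈ headFiber U c ↔ (Fin.cons c u : Idx (k + 1)) ∈ U := by simp [headFiber]

lemma linkParity_cons {k : ℕ} (c c' : Fin 3 × Bool) (u v : Idx k) :
    linkParity (Fin.cons c u : Idx (k + 1)) (Fin.cons c' v) = linkOne c c' + linkParity u v := by
  simp [linkParity, Fin.sum_univ_succ]

lemma card_eq_sum_headFiber {k : ℕ} (U : Finset (Idx (k + 1))) :
    U.card = ∑ i : Fin 3, ((headFiber U (i, true)).card + (headFiber U (i, false)).card) := by
  have h : U.card = ∑ c : Fin 3 × Bool, (headFiber U c).card := by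
    rw [Finset.card_eq_sum_card_fiberwise (f := fun u : Idx (k + 1) => u 0) (t := univ)
      (by intro x _; simp)]
    refine Finset.sum_congr rfl fun c _ => ?_
    refine Finset.card_bij' (fun u _ => Fin.tail u) (fun u _ => Fin.cons c u) ?_ ?_ ?_ ?_
    · intro u hu
      simp only [Finset.mem_filter] at hu
      rw [mem_headFiber, ← hu.2, Fin.cons_self_tail]
      exact hu.1
    · intro u hu
      simp only [Finset.mem_filter]
      exact ⟨mem_headFiber.1 hu, by simp⟩
    · intro u hu
      simp only [Finset.mem_filter] at hu
      rw [← hu.2, Fin.cons_self_tail]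
    · intro u hu
      simp
  rw [h, Fintype.sum_prod_type]
  refine Finset.sum_congr rfl fun i _ => ?_
  simp

lemma Unlinked.headFiber_link {k : ℕ} {U : Finset (Idx (k + 1))} (hU : Unlinked U)
    {c c' : Fin 3 × Bool} {x y : Idx k} (hx : x ∈ headFiber U c) (hy : y ∈ headFiber U c') :
    linkParity x y = linkOne c c' := by
  have h := hU _ (mem_headFiber.1 hx) _ (mem_headFiber.1 hy)
  rw [linkParity_cons] at h
  generalize linkParity x y = a at *
  generalize linkOne c c' = b at *
  revert a b; decide

lemma Unlinked.headFiber_union {k : ℕ} {U : Finset (Idx (k + 1))} (hU : Unlinked U) (i : Fin 3) :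
    Unlinked (headFiber U (i, true) ∪ headFiber U (i, false)) := by
  intro u hu v hv
  rw [Finset.mem_union] at hu hv
  rcases hu with hu | hu <;> rcases hv with hv | hv <;> rw [hU.headFiber_link hu hv] <;>
    simp [linkOne]

lemma Unlinked.headFiber_eq_empty {k : ℕ} {U : Finset (Idx (k + 1))} (hU : Unlinked U)
    {i j : Fin 3} (hij : i ≠ j) {x : Idx k} (h1 : x ∈ headFiber U (i, true))
    (h2 : x ∈ headFiber U (i, false)) (b : Bool) : headFiber U (j, b) = ∅ := by
  rw [Finset.eq_empty_iff_forall_notMem]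
  intro y hy
  have e1 := hU.headFiber_link h1 hy
  rw [hU.headFiber_link h2 hy] at e1
  cases b <;> simp [linkOne, hij] at e1

/-- If some tail occurs with both flags, then `U` is small. -/
lemma Unlinked.card_le_two_mul {k : ℕ} {U : Finset (Idx (k + 1))} (hU : Unlinked U)
    (ih : ∀ V : Finset (Idx k), Unlinked V → V.card ≤ 3 ^ k)
    {i : Fin 3} {x : Idx k} (h1 : x ∈ headFiber U (i, true)) (h2 : x ∈ headFiber U (i, false)) :
    U.card ≤ 2 * 3 ^ k := by
  have hlt : ∀ b, (headFiber U (i, b)).card ≤ 3 ^ k := fun b => ih _ fun u hu v hv => by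
    rw [hU.headFiber_link hu hv]; simp [linkOne]
  rw [card_eq_sum_headFiber, Finset.sum_eq_single i]
  · have := hlt true; have := hlt false; omega
  · intro j _ hj
    rw [hU.headFiber_eq_empty hj.symm h1 h2, hU.headFiber_eq_empty hj.symm h1 h2]; simp
  · simp

lemma Unlinked.card_le {k : ℕ} : ∀ {U : Finset (Idx k)}, Unlinked U → U.card ≤ 3 ^ k := by
  induction k with
  | zero =>
    intro U _
    simpa using Finset.card_le_univ U
  | succ k ih =>
    intro U hU
    by_cases h : ∃ i x, x ∈ headFiber U (i, true) ∧ x ∈ headFiber U (i, false)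
    · obtain ⟨i, x, h1, h2⟩ := h
      have := hU.card_le_two_mul (fun V hV => ih hV) h1 h2
      rw [pow_succ]; omega
    · push Not at h
      rw [card_eq_sum_headFiber]
      have : ∀ i ∈ (univ : Finset (Fin 3)),
          (headFiber U (i, true)).card + (headFiber U (i, false)).card ≤ 3 ^ k := by
        intro i _
        rw [← Finset.card_union_of_disjoint (Finset.disjoint_left.2 fun x h1 h2 => h i x h1 h2)]
        exact ih (hU.headFiber_union i)
      refine (Finset.sum_le_sum this).trans ?_
      simp [pow_succ, mul_comm]

lemma linkParity_eq_zero_of_snd_eq {k : ℕ} {u v : Idx k} (h : ∀ s, (u s).2 = (v s).2) :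
    linkParity u v = 0 := by
  simp [linkParity, linkOne, h]

/-- The types of two disjointly coloured parts of a maximal unlinked set agree. -/
lemma Unlinked.type_eq {k : ℕ} {U : Finset (Idx (k + 1))} (hU : Unlinked U) {i j : Fin 3}
    {τ σ : Fin k → Bool}
    (hτ : ∀ u, u ∈ headFiber U (i, true) ∪ headFiber U (i, false) ↔ ∀ s, (u s).2 = τ s)
    (hσ : ∀ u, u ∈ headFiber U (j, true) ∪ headFiber U (j, false) ↔ ∀ s, (u s).2 = σ s) :
    τ = σ := by
  by_contra hne
  obtain ⟨s, hs⟩ := Function.ne_iff.1 hne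
  let v : Fin 3 → Idx k := fun m t => (if t = s then m else 0, σ t)
  have hv : ∀ m, ∃ b, v m ∈ headFiber U (j, b) := by
    intro m
    have := (hσ (v m)).2 fun t => rfl
    rw [Finset.mem_union] at this
    rcases this with h | h
    exacts [⟨_, h⟩, ⟨_, h⟩]
  choose β hβ using hv
  obtain ⟨m, m', hmm, hb⟩ := Fintype.exists_ne_map_eq_of_card_lt β (by simp)
  let x : Idx k := fun t => (if t = s then m else 0, τ t)
  obtain ⟨b, hx⟩ : ∃ b, x ∈ headFiber U (i, b) := by
    have := (hτ x).2 fun t => rfl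
    rw [Finset.mem_union] at this
    rcases this with h | h
    exacts [⟨_, h⟩, ⟨_, h⟩]
  have e := (hU.headFiber_link hx (hβ m)).trans
    ((congrArg (fun b' => linkOne (i, b) (j, b')) hb).trans (hU.headFiber_link hx (hβ m')).symm)
  simp only [linkParity] at e
  rw [← Finset.add_sum_erase _ _ (Finset.mem_univ s),
    ← Finset.add_sum_erase univ (fun t => linkOne (x t) (v m' t)) (Finset.mem_univ s)] at e
  have e2 : ∑ t ∈ univ.erase s, linkOne (x t) (v m t) = ∑ t ∈ univ.erase s, linkOne (x t) (v m' t) := by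
    refine Finset.sum_congr rfl fun t ht => ?_
    simp [v, Finset.ne_of_mem_erase ht]
  rw [e2] at e
  simp [linkOne, x, v, hs, hmm] at e

/-- Unlinked sets of maximal size consist of all indices with prescribed flags. -/
lemma Unlinked.exists_type {k : ℕ} : ∀ {U : Finset (Idx k)}, Unlinked U → U.card = 3 ^ k →
    ∃ τ : Fin k → Bool, ∀ u, u ∈ U ↔ ∀ s, (u s).2 = τ s := by
  induction k with
  | zero =>
    intro U _ hc
    refine ⟨fun s => s.elim0, fun u => ⟨fun _ s => s.elim0, fun _ => ?_⟩⟩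
    obtain ⟨x, hx⟩ := Finset.card_eq_one.1 (by simpa using hc)
    rw [hx, Finset.mem_singleton]
    exact Subsingleton.elim _ _
  | succ k ih =>
    intro U hU hc
    have hdisj : ∀ i x, x ∈ headFiber U (i, true) → x ∉ headFiber U (i, false) := by
      intro i x h1 h2
      have := hU.card_le_two_mul (fun V hV => hV.card_le) h1 h2
      have h3 : 0 < 3 ^ k := by positivity
      rw [pow_succ] at hc; omega
    have hle : ∀ i, (headFiber U (i, true) ∪ headFiber U (i, false)).card ≤ 3 ^ k :=
      fun i => (hU.headFiber_union i).card_le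
    have hsum : ∑ i : Fin 3, (headFiber U (i, true) ∪ headFiber U (i, false)).card = 3 ^ (k + 1) := by
      rw [← hc, card_eq_sum_headFiber]
      refine Finset.sum_congr rfl fun i _ => ?_
      rw [Finset.card_union_of_disjoint (Finset.disjoint_left.2 fun x h1 h2 => hdisj i x h1 h2)]
    have heq : ∀ i, (headFiber U (i, true) ∪ headFiber U (i, false)).card = 3 ^ k := by
      have h0 := hle 0; have h1 := hle 1; have h2 := hle 2
      rw [Fin.sum_univ_three, pow_succ] at hsum
      intro i
      fin_cases i <;> simp <;> omega
    have hty : ∀ i, ∃ τ : Fin k → Bool, ∀ u,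
        u ∈ headFiber U (i, true) ∪ headFiber U (i, false) ↔ ∀ s, (u s).2 = τ s :=
      fun i => ih (hU.headFiber_union i) (heq i)
    choose τ hτ using hty
    have hτ0 : ∀ i, τ i = τ 0 := fun i => hU.type_eq (hτ i) (hτ 0)
    have hex : ∀ (i : Fin 3) (x : Idx k), (∀ s, (x s).2 = τ 0 s) → ∃ b, x ∈ headFiber U (i, b) := by
      intro i x hx
      have := (hτ i x).2 (by rw [hτ0]; exact hx)
      rw [Finset.mem_union] at this
      rcases this with h | h
      exacts [⟨_, h⟩, ⟨_, h⟩]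
    have hmem : ∀ (i : Fin 3) (b : Bool) (x : Idx k), x ∈ headFiber U (i, b) →
        ∀ s, (x s).2 = τ 0 s := by
      intro i b x hx
      rw [← hτ0 i]
      refine (hτ i x).1 ?_
      rw [Finset.mem_union]
      cases b
      exacts [Or.inr hx, Or.inl hx]
    have hflag : ∀ (i j : Fin 3) (b b' : Bool) (x y : Idx k), i ≠ j → x ∈ headFiber U (i, b) →
        y ∈ headFiber U (j, b') → b = b' := by
      intro i j b b' x y hij hx hy
      have h := hU.headFiber_link hx hy
      rw [linkParity_eq_zero_of_snd_eq fun s => by rw [hmem _ _ _ hx, hmem _ _ _ hy]] at h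
      by_contra hb
      simp [linkOne, hij, hb] at h
    let x0 : Idx k := fun s => (0, τ 0 s)
    obtain ⟨b0, hb0⟩ := hex 0 x0 fun s => rfl
    obtain ⟨b1, hb1⟩ := hex 1 x0 fun s => rfl
    have hall : ∀ (i : Fin 3) (b : Bool) (x : Idx k), x ∈ headFiber U (i, b) → b = b0 := by
      intro i b x hx
      by_cases hi : i = 0
      · subst hi
        rw [hflag 0 1 b b1 x x0 (by decide) hx hb1, hflag 0 1 b0 b1 x0 x0 (by decide) hb0 hb1]
      · exact hflag i 0 b b0 x x0 hi hx hb0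
    refine ⟨Fin.cons b0 (τ 0), fun u => ?_⟩
    have hu : u ∈ U ↔ Fin.tail u ∈ headFiber U (u 0) := by
      rw [mem_headFiber, Fin.cons_self_tail]
    rw [hu, Fin.forall_fin_succ]
    simp only [Fin.cons_zero, Fin.cons_succ]
    constructor
    · intro h
      exact ⟨hall (u 0).1 (u 0).2 _ h, hmem (u 0).1 (u 0).2 _ h⟩
    · rintro ⟨h1, h2⟩
      obtain ⟨b, hb⟩ := hex (u 0).1 (Fin.tail u) h2
      have := hall _ _ _ hb
      rw [this, ← h1] at hb
      exact hb

/-! ### Sums of multiplicative weights -/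

/-- The weight `κ ^ ω(m)` on squarefree integers. -/
def hw (κ : ℝ) (m : ℕ) : ℝ := if Squarefree m then κ ^ m.primeFactors.card else 0

lemma hw_nonneg {κ : ℝ} (hκ : 0 ≤ κ) (m : ℕ) : 0 ≤ hw κ m := by
  unfold hw; split_ifs <;> positivity

lemma hw_one_right (κ : ℝ) : hw κ 1 = 1 := by simp [hw]

lemma hw_of_squarefree {κ : ℝ} {m : ℕ} (hm : Squarefree m) : hw κ m = κ ^ m.primeFactors.card := by
  simp [hw, hm]

lemma hw_of_not_squarefree {κ : ℝ} {m : ℕ} (hm : ¬ Squarefree m) : hw κ m = 0 := by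
  simp [hw, hm]

lemma sum_rpow_neg_le (s : ℝ) (hs : 0 < s) (M : ℕ) :
    ∑ n ∈ Icc 1 M, (n : ℝ) ^ (-(1 + s)) ≤ 1 + 1 / s := by
  rcases Nat.eq_zero_or_pos M with rfl | hM
  · simp; positivity
  suffices h : ∑ n ∈ Icc 1 M, (n : ℝ) ^ (-(1 + s)) ≤ 1 + (1 - (M : ℝ) ^ (-s)) / s by
    refine h.trans ?_
    have : (0 : ℝ) ≤ (M : ℝ) ^ (-s) := by positivity
    gcongr
    linarith
  induction M, hM using Nat.le_induction with
  | base => simp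
  | succ n hn ih =>
    rw [Finset.sum_Icc_succ_top (by omega), add_comm]
    have hn0 : (0 : ℝ) < n := by exact_mod_cast hn
    have hkey : ((n + 1 : ℕ) : ℝ) ^ (-s) * (1 + s / (n + 1 : ℕ)) ≤ (n : ℝ) ^ (-s) := by
      have h1 : (n : ℝ) = (n + 1 : ℕ) * (1 - 1 / (n + 1 : ℕ)) := by
        push_cast; field_simp; ring
      have hp : (0 : ℝ) < 1 - 1 / (n + 1 : ℕ) := by
        have : (1 : ℝ) / (n + 1 : ℕ) < 1 := by
          rw [div_lt_one (by positivity)]; push_cast; linarith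
        linarith
      conv_rhs => rw [h1, Real.mul_rpow (by positivity) hp.le]
      gcongr
      rw [Real.rpow_def_of_pos hp]
      have h2 : Real.log (1 - 1 / (n + 1 : ℕ)) ≤ - (1 / (n + 1 : ℕ)) := by
        have := Real.log_le_sub_one_of_pos hp
        linarith
      calc 1 + s / ((n + 1 : ℕ) : ℝ) ≤ Real.exp (s / (n + 1 : ℕ)) := by
            have := Real.add_one_le_exp (s / ((n + 1 : ℕ) : ℝ)); linarith
        _ ≤ _ := by
            apply Real.exp_le_exp.2
            have := mul_le_mul_of_nonneg_left h2 hs.le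
            rw [div_eq_mul_one_div]; linarith
    have h3 : ((n + 1 : ℕ) : ℝ) ^ (-(1 + s)) = ((n + 1 : ℕ) : ℝ) ^ (-s) / (n + 1 : ℕ) := by
      rw [show -(1 + s) = -s - 1 by ring, Real.rpow_sub_one (by positivity)]
    have h4 : ((n + 1 : ℕ) : ℝ) ^ (-(1 + s)) ≤
        ((n : ℝ) ^ (-s) - ((n + 1 : ℕ) : ℝ) ^ (-s)) / s := by
      rw [h3, le_div_iff₀ hs]
      have : ((n + 1 : ℕ) : ℝ) ^ (-s) / (n + 1 : ℕ) * s
        = ((n + 1 : ℕ) : ℝ) ^ (-s) * (1 + s / (n + 1 : ℕ)) - ((n + 1 : ℕ) : ℝ) ^ (-s) := by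
        ring
      linarith
    calc _ ≤ ((n : ℝ) ^ (-s) - ((n + 1 : ℕ) : ℝ) ^ (-s)) / s + (1 + (1 - (n : ℝ) ^ (-s)) / s) :=
          add_le_add h4 ih
      _ = _ := by ring

lemma prod_prime_one_add_eq (A : Finset ℕ) (g : ℕ → ℝ) :
    ∏ p ∈ A, (1 + g p) = ∑ S ∈ A.powerset, ∏ p ∈ S, g p := by
  rw [Finset.prod_one_add]

lemma injOn_prod_primes (A : Finset ℕ) (hA : ∀ p ∈ A, p.Prime) :
    Set.InjOn (fun S : Finset ℕ => ∏ p ∈ S, p) (A.powerset : Set (Finset ℕ)) := by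
  intro S hS T hT h
  simp only [Finset.coe_powerset, Set.mem_preimage, Set.mem_powerset_iff, Finset.coe_subset] at hS hT
  have h1 := Nat.primeFactors_prod (fun p hp => hA p (hS hp))
  have h2 := Nat.primeFactors_prod (fun p hp => hA p (hT hp))
  simp only at h
  rw [← h1, ← h2, h]

lemma prod_one_add_rpow_le (A : Finset ℕ) (hA : ∀ p ∈ A, p.Prime) (s : ℝ) (hs : 0 < s) :
    ∏ p ∈ A, (1 + (p : ℝ) ^ (-(1 + s))) ≤ 1 + 1 / s := by
  refine le_trans ?_ (sum_rpow_neg_le s hs (∏ p ∈ A, p))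
  rw [prod_prime_one_add_eq]
  have h1 : ∀ S ∈ A.powerset, ∏ p ∈ S, (p : ℝ) ^ (-(1 + s))
      = ((∏ p ∈ S, p : ℕ) : ℝ) ^ (-(1 + s)) := by
    intro S _
    rw [Nat.cast_prod, Real.finsetProd_rpow _ _ (by intros; positivity)]
  rw [Finset.sum_congr rfl h1, ← Finset.sum_image (f := fun n : ℕ => (n : ℝ) ^ (-(1 + s)))
    (g := fun S : Finset ℕ => ∏ p ∈ S, p) (injOn_prod_primes A hA)]
  apply Finset.sum_le_sum_of_subset_of_nonneg
  · intro n hn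
    obtain ⟨S, hS, rfl⟩ := Finset.mem_image.1 hn
    rw [Finset.mem_powerset] at hS
    rw [Finset.mem_Icc]
    refine ⟨Nat.one_le_iff_ne_zero.2 (Finset.prod_ne_zero_iff.2 fun p hp =>
      (hA p (hS hp)).ne_zero), ?_⟩
    exact Finset.prod_le_prod_of_subset_of_one_le' hS (fun p hp _ => (hA p hp).one_le)
  · intros; positivity

lemma sum_inv_sq_le_two (A : Finset ℕ) (hA : ∀ p ∈ A, 1 ≤ p) :
    ∑ n ∈ A, ((n : ℝ) ^ 2)⁻¹ ≤ 2 := by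
  have h : ∀ M : ℕ, ∑ n ∈ Icc 1 M, ((n : ℝ) ^ 2)⁻¹ ≤ 2 := by
    intro M
    have := sum_rpow_neg_le 1 one_pos M
    refine (Finset.sum_le_sum fun n hn => ?_).trans (this.trans (by norm_num))
    rw [Real.rpow_neg (by positivity)]
    norm_num
  refine le_trans (Finset.sum_le_sum_of_subset_of_nonneg (t := Icc 1 (A.sup id)) ?_ ?_) (h _)
  · intro p hp
    exact Finset.mem_Icc.2 ⟨hA p hp, Finset.le_sup (f := id) hp⟩
  · intros; positivity

lemma exp_sum_rpow_le (A : Finset ℕ) (hA : ∀ p ∈ A, p.Prime) (s : ℝ) (hs : 0 < s) :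
    Real.exp (∑ p ∈ A, (p : ℝ) ^ (-(1 + s))) ≤ (1 + 1 / s) * Real.exp 2 := by
  have h1 : ∀ x : ℝ, 0 ≤ x → x ≤ 1 → Real.exp x ≤ (1 + x) * Real.exp (x ^ 2) := by
    intro x h0 h1
    have h2 := abs_le.1 (Real.abs_exp_sub_one_sub_id_le (by rw [abs_of_nonneg h0]; exact h1))
    have h3 := Real.add_one_le_exp (x ^ 2)
    have h4 : (1 + x) * (x ^ 2 + 1) ≤ (1 + x) * Real.exp (x ^ 2) := by gcongr
    nlinarith [pow_nonneg h0 3]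
  have h2 : ∀ p ∈ A, 0 ≤ (p : ℝ) ^ (-(1 + s)) ∧ (p : ℝ) ^ (-(1 + s)) ≤ (p : ℝ)⁻¹ := by
    intro p hp
    have hp1 : (1 : ℝ) ≤ p := by exact_mod_cast (hA p hp).one_le
    refine ⟨by positivity, ?_⟩
    rw [← Real.rpow_neg_one]
    exact Real.rpow_le_rpow_of_exponent_le hp1 (by linarith)
  rw [Real.exp_sum]
  calc _ ≤ ∏ p ∈ A, ((1 + (p : ℝ) ^ (-(1 + s))) * Real.exp (((p : ℝ) ^ 2)⁻¹)) := by
        refine Finset.prod_le_prod (fun _ _ => (Real.exp_pos _).le) fun p hp => ?_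
        have hp1 : (1 : ℝ) ≤ p := by exact_mod_cast (hA p hp).one_le
        refine (h1 _ (h2 p hp).1 ((h2 p hp).2.trans (inv_le_one_of_one_le₀ hp1))).trans ?_
        have := (h2 p hp).1
        gcongr
        rw [← inv_pow]
        exact pow_le_pow_left₀ this (h2 p hp).2 2
    _ ≤ _ := by
        rw [Finset.prod_mul_distrib, ← Real.exp_sum]
        refine mul_le_mul (prod_one_add_rpow_le A hA s hs) ?_ (by positivity) (by positivity)
        exact Real.exp_le_exp.2 (sum_inv_sq_le_two A fun p hp => (hA p hp).one_le)

lemma sum_hw_div_le (κ : ℝ) (hκ : 0 ≤ κ) :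
    ∃ C : ℝ, 1 ≤ C ∧ ∀ N : ℕ, ∑ m ∈ Icc 1 N, hw κ m / m ≤ C * (1 + Real.log N) ^ κ := by
  refine ⟨Real.exp 1 * (2 * Real.exp 2) ^ κ, ?_, fun N => ?_⟩
  · have h1 : (1 : ℝ) ≤ Real.exp 1 := Real.one_le_exp (by norm_num)
    have h2 : (1 : ℝ) ≤ 2 * Real.exp 2 := by
      have : (1 : ℝ) ≤ Real.exp 2 := Real.one_le_exp (by norm_num)
      linarith
    exact one_le_mul_of_one_le_of_one_le h1 (Real.one_le_rpow h2 hκ)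
  rcases Nat.eq_zero_or_pos N with rfl | hN
  · simp; positivity
  have hl : 0 ≤ Real.log N := Real.log_natCast_nonneg N
  set L := 1 + Real.log N with hL
  have hL1 : 1 ≤ L := by linarith
  set s := 1 / L with hs
  have hs0 : 0 < s := by positivity
  set A := (Icc 1 N).filter Nat.Prime with hA
  have hAp : ∀ p ∈ A, p.Prime := fun p hp => (Finset.mem_filter.1 hp).2
  have h1 : ∀ m ∈ Icc 1 N, hw κ m / m ≤ Real.exp 1 * (hw κ m * (m : ℝ) ^ (-(1 + s))) := by
    intro m hm
    rw [Finset.mem_Icc] at hm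
    have hm0 : (0 : ℝ) < m := by exact_mod_cast hm.1
    have : (1 : ℝ) / m ≤ Real.exp 1 * (m : ℝ) ^ (-(1 + s)) := by
      rw [show -(1 + s) = -1 + -s by ring, Real.rpow_add hm0, Real.rpow_neg_one, one_div]
      have h2 : 1 ≤ Real.exp 1 * (m : ℝ) ^ (-s) := by
        rw [Real.rpow_def_of_pos hm0, ← Real.exp_add]
        apply Real.one_le_exp
        have h3 : Real.log m ≤ Real.log N := Real.log_le_log hm0 (by exact_mod_cast hm.2)
        have h4 : Real.log m * s ≤ 1 := by
          rw [hs, mul_one_div, div_le_one (by positivity)]; linarith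
        linarith
      have h5 : (0 : ℝ) < (m : ℝ)⁻¹ := by positivity
      nlinarith
    have h6 := mul_le_mul_of_nonneg_left this (hw_nonneg hκ m)
    calc _ = hw κ m * (1 / m) := by ring
      _ ≤ _ := h6
      _ = _ := by ring
  refine (Finset.sum_le_sum h1).trans ?_
  rw [← Finset.mul_sum, mul_assoc]
  gcongr
  have h2 : ∑ m ∈ Icc 1 N, hw κ m * (m : ℝ) ^ (-(1 + s))
      ≤ ∏ p ∈ A, (1 + κ * (p : ℝ) ^ (-(1 + s))) := by
    rw [prod_prime_one_add_eq]
    have e1 : ∀ S ∈ A.powerset, ∏ p ∈ S, (κ * (p : ℝ) ^ (-(1 + s)))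
        = hw κ (∏ p ∈ S, p) * ((∏ p ∈ S, p : ℕ) : ℝ) ^ (-(1 + s)) := by
      intro S hS
      rw [Finset.mem_powerset] at hS
      have hSp : ∀ p ∈ S, p.Prime := fun p hp => hAp p (hS hp)
      have hsq : Squarefree (∏ p ∈ S, p) :=
        Finset.squarefree_prod_of_pairwise_isCoprime
          (fun p hp q hq hpq => Nat.coprime_iff_isRelPrime.1
            ((Nat.coprime_primes (hSp p hp) (hSp q hq)).2 hpq))
          (fun p hp => (hSp p hp).prime.squarefree)
      rw [hw_of_squarefree hsq, Nat.primeFactors_prod hSp, Finset.prod_mul_distrib,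
        Finset.prod_const, Nat.cast_prod, Real.finsetProd_rpow _ _ (by intros; positivity)]
    rw [Finset.sum_congr rfl e1, ← Finset.sum_image (f := fun n : ℕ => hw κ n * (n : ℝ) ^ (-(1 + s)))
      (g := fun S : Finset ℕ => ∏ p ∈ S, p) (injOn_prod_primes A hAp)]
    rw [← Finset.sum_filter_add_sum_filter_not _ Squarefree]
    have e2 : ∑ m ∈ Icc 1 N with ¬ Squarefree m, hw κ m * (m : ℝ) ^ (-(1 + s)) = 0 := by
      refine Finset.sum_eq_zero fun m hm => ?_
      rw [hw_of_not_squarefree (Finset.mem_filter.1 hm).2, zero_mul]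
    rw [e2, add_zero]
    apply Finset.sum_le_sum_of_subset_of_nonneg
    · intro m hm
      rw [Finset.mem_filter, Finset.mem_Icc] at hm
      rw [Finset.mem_image]
      refine ⟨m.primeFactors, ?_, Nat.prod_primeFactors_of_squarefree hm.2⟩
      rw [Finset.mem_powerset]
      intro p hp
      rw [hA, Finset.mem_filter, Finset.mem_Icc]
      have := Nat.prime_of_mem_primeFactors hp
      exact ⟨⟨this.one_le, (Nat.le_of_mem_primeFactors hp).trans hm.1.2⟩, this⟩
    · intro m _ _
      exact mul_nonneg (hw_nonneg hκ m) (by positivity)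
  refine h2.trans ?_
  calc ∏ p ∈ A, (1 + κ * (p : ℝ) ^ (-(1 + s)))
      ≤ ∏ p ∈ A, Real.exp (κ * (p : ℝ) ^ (-(1 + s))) := by
        refine Finset.prod_le_prod (fun _ _ => by positivity) fun p _ => ?_
        have := Real.add_one_le_exp (κ * (p : ℝ) ^ (-(1 + s))); linarith
    _ = (Real.exp (∑ p ∈ A, (p : ℝ) ^ (-(1 + s)))) ^ κ := by
        rw [← Real.exp_sum, ← Finset.mul_sum, ← Real.exp_mul, mul_comm]
    _ ≤ ((1 + 1 / s) * Real.exp 2) ^ κ :=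
        Real.rpow_le_rpow (Real.exp_pos _).le (exp_sum_rpow_le A hAp s hs0) hκ
    _ ≤ (2 * Real.exp 2 * L) ^ κ := by
        apply Real.rpow_le_rpow (by positivity) _ hκ
        have : 1 + 1 / s ≤ 2 * L := by rw [hs, one_div_one_div]; linarith
        nlinarith [Real.exp_pos 2]
    _ = _ := by rw [Real.mul_rpow (by positivity) (by positivity)]

/-! ### Sums over tuples with bounded product -/

lemma sum_piFinset_isolate {ι : Type*} [Fintype ι] [DecidableEq ι] (t : ι → Finset ℕ) (v : ι)
    (F : (ι → ℕ) → ℝ) :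
    ∑ D ∈ Fintype.piFinset t, F D =
      ∑ D' ∈ Fintype.piFinset (Function.update t v {1}), ∑ m ∈ t v,
        F (Function.update D' v m) := by
  rw [← Finset.sum_product']
  refine Finset.sum_bij' (fun D _ => (Function.update D v 1, D v))
    (fun x _ => Function.update x.1 v x.2) ?_ ?_ ?_ ?_ ?_
  · intro D hD
    rw [Fintype.mem_piFinset] at hD
    rw [Finset.mem_product, Fintype.mem_piFinset]
    refine ⟨fun u => ?_, hD v⟩
    by_cases huv : u = v
    · subst huv; simp
    · simp [huv, hD u]
  · rintro ⟨D', m⟩ hx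
    rw [Finset.mem_product, Fintype.mem_piFinset] at hx
    rw [Fintype.mem_piFinset]
    intro u
    by_cases huv : u = v
    · subst huv; simpa using hx.2
    · have := hx.1 u
      simpa [huv] using this
  · intro D _
    simp
  · rintro ⟨D', m⟩ hx
    rw [Finset.mem_product, Fintype.mem_piFinset] at hx
    have := hx.1 v
    simp only [Function.update_self, Finset.mem_singleton] at this
    simp only [Function.update_idem, Function.update_self, Prod.mk.injEq, and_true]
    rw [← this, Function.update_eq_self]
  · intro D _
    simp

lemma prod_update_eq {ι M : Type*} [Fintype ι] [DecidableEq ι] [CommMonoid M] (g : ι → ℕ → M)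
    (D' : ι → ℕ) (v : ι) (m : ℕ) :
    ∏ u, g u (Function.update D' v m u) = g v m * ∏ u ∈ univ.erase v, g u (D' u) := by
  rw [← Finset.mul_prod_erase univ _ (Finset.mem_univ v), Function.update_self]
  congr 1
  refine Finset.prod_congr rfl fun u hu => ?_
  rw [Function.update_of_ne (Finset.ne_of_mem_erase hu)]

lemma sum_piFinset_erase {ι : Type*} [Fintype ι] [DecidableEq ι] (t : ι → Finset ℕ) (v : ι)
    (g : ι → ℕ → ℝ) :
    ∑ D' ∈ Fintype.piFinset (Function.update t v {1}), ∏ u ∈ univ.erase v, g u (D' u)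
      = ∏ u ∈ univ.erase v, ∑ m ∈ t u, g u m := by
  have h := Finset.prod_univ_sum (Function.update t v {1})
    (fun u m => if u = v then (1 : ℝ) else g u m)
  rw [← Finset.mul_prod_erase univ _ (Finset.mem_univ v)] at h
  simp only [Function.update_self, Finset.sum_singleton, if_true, one_mul] at h
  have h1 : ∏ u ∈ univ.erase v, ∑ m ∈ t u, g u m = ∏ x ∈ univ.erase v,
      ∑ x_1 ∈ Function.update t v {1} x, (if x = v then (1 : ℝ) else g x x_1) := by
    refine Finset.prod_congr rfl fun u hu => ?_
    have := Finset.ne_of_mem_erase hu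
    simp [this]
  rw [h1, h]
  refine Finset.sum_congr rfl fun D _ => ?_
  rw [← Finset.mul_prod_erase univ (fun i => if i = v then (1 : ℝ) else g i (D i))
    (Finset.mem_univ v), if_pos rfl, one_mul]
  refine Finset.prod_congr rfl fun u hu => ?_
  rw [if_neg (Finset.ne_of_mem_erase hu)]

/-- A nonnegative weight supported on squarefree integers which grows at most by the factor `C`
when a new prime is inserted. -/
structure IsWeight (C : ℝ) (h : ℕ → ℝ) : Prop where
  nonneg : ∀ m, 0 ≤ h m
  sqf : ∀ m, ¬ Squarefree m → h m = 0
  mul_le : ∀ p m, p.Prime → h (p * m) ≤ C * h m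

lemma isWeight_hw {κ C : ℝ} (hκ : 0 ≤ κ) (hC : κ ≤ C) : IsWeight C (hw κ) where
  nonneg := hw_nonneg hκ
  sqf m hm := hw_of_not_squarefree hm
  mul_le p m hp := by
    by_cases h : Squarefree (p * m)
    · have h1 := Nat.squarefree_mul_iff.1 h
      rw [hw_of_squarefree h, hw_of_squarefree h1.2.2, h1.1.primeFactors_mul,
        Finset.card_union_of_disjoint h1.1.disjoint_primeFactors, pow_add, hp.primeFactors,
        Finset.card_singleton, pow_one]
      gcongr
    · rw [hw_of_not_squarefree h]
      exact mul_nonneg (hκ.trans hC) (hw_nonneg hκ m)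

/-- A weight may be truncated to a divisor-closed set. -/
lemma IsWeight.ite {C : ℝ} {h : ℕ → ℝ} (hh : IsWeight C h) (hC : 0 ≤ C) {P : ℕ → Prop}
    (hP : ∀ p m : ℕ, p.Prime → P (p * m) → m ≠ 0 → P m) :
    IsWeight C (fun m => if P m then h m else 0) where
  nonneg m := by split_ifs; exacts [hh.nonneg m, le_rfl]
  sqf m hm := by simp [hh.sqf m hm]
  mul_le p m hp := by
    rcases eq_or_ne m 0 with rfl | hm
    · have : h 0 = 0 := hh.sqf 0 not_squarefree_zero
      simp [this]
    by_cases h1 : P (p * m)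
    · simp only [h1, hP p m hp h1 hm, if_true]; exact hh.mul_le p m hp
    · simp only [h1, if_false]
      have := hh.nonneg m
      split_ifs <;> positivity

lemma log_le_sum_log_primeFactors {m : ℕ} (hm : Squarefree m) :
    Real.log m = ∑ p ∈ m.primeFactors, Real.log p := by
  conv_lhs => rw [← Nat.prod_primeFactors_of_squarefree hm]
  rw [Nat.cast_prod, Real.log_prod]
  intro p hp
  exact_mod_cast (Nat.prime_of_mem_primeFactors hp).ne_zero

lemma sum_log_primes_le (Y : ℕ) :
    ∑ p ∈ (Icc 1 Y).filter Nat.Prime, Real.log p ≤ Real.log 4 * Y := by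
  refine le_trans (le_of_eq ?_) (Chebyshev.theta_le_log4_mul_x (x := Y) (by positivity))
  rw [Chebyshev.theta_eq_sum_Icc, Nat.floor_natCast]
  refine Finset.sum_congr ?_ fun _ _ => rfl
  ext p
  simp only [Finset.mem_filter, Finset.mem_Icc]
  constructor
  · rintro ⟨⟨_, h⟩, hp⟩; exact ⟨⟨by omega, h⟩, hp⟩
  · rintro ⟨⟨_, h⟩, hp⟩; exact ⟨⟨hp.one_le, h⟩, hp⟩

lemma sum_le_sum_of_injOn {α β : Type*} {s : Finset α} {t : Finset β} {f : α → ℝ} {g : β → ℝ}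
    (e : α → β) (he : ∀ x ∈ s, e x ∈ t) (hinj : Set.InjOn e s) (hfg : ∀ x ∈ s, f x ≤ g (e x))
    (hg : ∀ y ∈ t, 0 ≤ g y) : ∑ x ∈ s, f x ≤ ∑ y ∈ t, g y := by
  refine (Finset.sum_le_sum hfg).trans ?_
  rw [← Finset.sum_image hinj]
  refine Finset.sum_le_sum_of_subset_of_nonneg ?_ fun y hy _ => hg y hy
  intro y hy
  obtain ⟨x, hx, rfl⟩ := Finset.mem_image.1 hy
  exact he x hx

lemma IsWeight.sum_mul_log_le {C : ℝ} (hC : 0 ≤ C) {h : ℕ → ℝ} (hh : IsWeight C h) (Y N : ℕ)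
    (hYN : Y ≤ N) :
    ∑ m ∈ Icc 1 Y, h m * Real.log m ≤ C * Real.log 4 * Y * ∑ m ∈ Icc 1 N, h m / m := by
  have hlog4 : 0 ≤ Real.log 4 := Real.log_nonneg (by norm_num)
  calc ∑ m ∈ Icc 1 Y, h m * Real.log m
      ≤ ∑ m ∈ Icc 1 Y, ∑ p ∈ m.primeFactors, C * h (m / p) * Real.log p := by
        refine Finset.sum_le_sum fun m _ => ?_
        by_cases hm : Squarefree m
        · rw [log_le_sum_log_primeFactors hm, Finset.mul_sum]
          refine Finset.sum_le_sum fun p hp => ?_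
          have h1 := hh.mul_le p (m / p) (Nat.prime_of_mem_primeFactors hp)
          rw [Nat.mul_div_cancel' (Nat.dvd_of_mem_primeFactors hp)] at h1
          exact mul_le_mul_of_nonneg_right h1 (Real.log_natCast_nonneg p)
        · rw [hh.sqf m hm, zero_mul]
          exact Finset.sum_nonneg fun p _ => mul_nonneg (mul_nonneg hC (hh.nonneg _))
            (Real.log_natCast_nonneg p)
    _ ≤ ∑ n ∈ Icc 1 Y, ∑ p ∈ (Icc 1 (Y / n)).filter Nat.Prime, C * h n * Real.log p := by
        rw [Finset.sum_sigma', Finset.sum_sigma']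
        refine sum_le_sum_of_injOn (fun x : (_ : ℕ) × ℕ => (⟨x.1 / x.2, x.2⟩ : (_ : ℕ) × ℕ))
          ?_ ?_ ?_ ?_
        · rintro ⟨m, p⟩ hx
          simp only [Finset.mem_sigma, Finset.mem_Icc, Finset.mem_filter] at hx ⊢
          have hp := Nat.prime_of_mem_primeFactors hx.2
          obtain ⟨q, rfl⟩ := Nat.dvd_of_mem_primeFactors hx.2
          rw [Nat.mul_div_cancel_left _ hp.pos]
          have hq : 1 ≤ q := Nat.one_le_iff_ne_zero.2 (by rintro rfl; simp at hx)
          refine ⟨⟨hq, le_trans (Nat.le_mul_of_pos_left q hp.pos) hx.1.2⟩,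
            ⟨hp.one_le, (Nat.le_div_iff_mul_le hq).2 hx.1.2⟩, hp⟩
        · rintro ⟨m, p⟩ hx ⟨m', p'⟩ hx' h
          simp only [Finset.coe_sigma, Set.mem_sigma_iff, Finset.mem_coe] at hx hx'
          simp only [Sigma.mk.injEq, heq_eq_eq] at h ⊢
          obtain ⟨h1, rfl⟩ := h
          refine ⟨?_, rfl⟩
          rw [← Nat.div_mul_cancel (Nat.dvd_of_mem_primeFactors hx.2), h1,
            Nat.div_mul_cancel (Nat.dvd_of_mem_primeFactors hx'.2)]
        · rintro ⟨m, p⟩ _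
          exact le_rfl
        · rintro ⟨n, p⟩ _
          exact mul_nonneg (mul_nonneg hC (hh.nonneg _)) (Real.log_natCast_nonneg p)
    _ ≤ ∑ n ∈ Icc 1 Y, C * h n * (Real.log 4 * (Y / n)) := by
        refine Finset.sum_le_sum fun n hn => ?_
        rw [← Finset.mul_sum]
        refine mul_le_mul_of_nonneg_left ?_ (mul_nonneg hC (hh.nonneg n))
        refine (sum_log_primes_le _).trans ?_
        exact mul_le_mul_of_nonneg_left Nat.cast_div_le hlog4
    _ = C * Real.log 4 * Y * ∑ m ∈ Icc 1 Y, h m / m := by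
        rw [Finset.mul_sum]
        refine Finset.sum_congr rfl fun n _ => ?_
        ring
    _ ≤ _ := by
        gcongr with n hn
        intro n _ _
        exact div_nonneg (hh.nonneg n) (by positivity)

lemma prod_mem_Icc_pos {ι : Type*} [Fintype ι] {D : ι → ℕ} {N : ℕ} {S : Finset ι}
    (hD : ∀ u ∈ S, D u ∈ Icc 1 N) : 1 ≤ ∏ u ∈ S, D u :=
  Nat.one_le_iff_ne_zero.2 <| Finset.prod_ne_zero_iff.2 fun u hu => by
    have := Finset.mem_Icc.1 (hD u hu); omega

/-- The number of tuples with product at most `N`, weighted by prime-like weights, saves a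
logarithm over the trivial bound. -/
lemma sum_tuple_le {ι : Type*} [Fintype ι] [DecidableEq ι] {C : ℝ} (hC : 0 ≤ C) (h : ι → ℕ → ℝ)
    (hh : ∀ u, IsWeight C (h u)) (N : ℕ) (hN : 1 ≤ N) :
    ∑ D ∈ Fintype.piFinset (fun _ : ι => Icc 1 N),
      (if ∏ u, D u ≤ N then ∏ u, h u (D u) else 0) ≤
    (1 + Fintype.card ι * (C * Real.log 4)) * (N / (1 + Real.log N)) *
      ∏ u, ∑ m ∈ Icc 1 N, h u m / m := by
  set P := ∏ u, ∑ m ∈ Icc 1 N, h u m / m with hP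
  set B := Fintype.piFinset (fun _ : ι => Icc 1 N) with hB
  have hl : 0 ≤ Real.log N := Real.log_natCast_nonneg N
  have hlog4 : 0 ≤ Real.log 4 := Real.log_nonneg (by norm_num)
  have hnn : ∀ u m, (0 : ℝ) ≤ h u m / m := fun u m => div_nonneg ((hh u).nonneg m) (by positivity)
  have hBmem : ∀ D ∈ B, ∀ u, D u ∈ Icc 1 N := fun D hD u => Fintype.mem_piFinset.1 hD u
  have hPeq : P = ∑ D ∈ B, ∏ u, (h u (D u) / D u) := by
    rw [hP, Finset.prod_univ_sum]
  -- the contribution of `log D_v`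
  have key : ∀ v : ι, ∑ D ∈ B, (if ∏ u, D u ≤ N then ∏ u, h u (D u) else 0) * Real.log (D v)
      ≤ C * Real.log 4 * N * P := by
    intro v
    rw [hB, sum_piFinset_isolate _ v, hP, ← Finset.mul_prod_erase univ _ (Finset.mem_univ v),
      ← sum_piFinset_erase (fun _ => Icc 1 N) v (fun u m => h u m / m), Finset.mul_sum,
      Finset.mul_sum]
    refine Finset.sum_le_sum fun D' hD' => ?_
    have hD'1 : ∀ u ∈ univ.erase v, D' u ∈ Icc 1 N := by
      intro u hu
      have := Fintype.mem_piFinset.1 hD' u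
      rwa [Function.update_of_ne (Finset.ne_of_mem_erase hu)] at this
    set M := ∏ u ∈ univ.erase v, D' u with hM
    have hM1 : 1 ≤ M := prod_mem_Icc_pos hD'1
    have hH : 0 ≤ ∏ u ∈ univ.erase v, h u (D' u) :=
      Finset.prod_nonneg fun u _ => (hh u).nonneg _
    have e1 : ∀ m ∈ Icc 1 N, (if ∏ u, Function.update D' v m u ≤ N
          then ∏ u, h u (Function.update D' v m u) else 0) * Real.log (Function.update D' v m v)
        = if m ∈ Icc 1 (N / M) then (∏ u ∈ univ.erase v, h u (D' u)) * (h v m * Real.log m)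
          else 0 := by
      intro m hm
      rw [prod_update_eq (fun _ x => x), prod_update_eq, Function.update_self, ← hM]
      have : m * M ≤ N ↔ m ∈ Icc 1 (N / M) := by
        rw [Finset.mem_Icc, Nat.le_div_iff_mul_le hM1]
        exact ⟨fun h => ⟨(Finset.mem_Icc.1 hm).1, h⟩, fun h => h.2⟩
      simp only [this]
      split_ifs
      · ring
      · simp
    rw [Finset.sum_congr rfl e1, ← Finset.sum_filter, Finset.filter_mem_eq_inter,
      Finset.inter_eq_right.2 (Finset.Icc_subset_Icc_right (Nat.div_le_self N M)), ← Finset.mul_sum]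
    have h1 := (hh v).sum_mul_log_le hC (N / M) N (Nat.div_le_self N M)
    have h2 : ((N / M : ℕ) : ℝ) ≤ N / M := Nat.cast_div_le
    have h3 : 0 ≤ ∑ m ∈ Icc 1 N, h v m / m := Finset.sum_nonneg fun m _ => hnn v m
    have h4 : (∏ u ∈ univ.erase v, h u (D' u) / (D' u : ℝ))
        = (∏ u ∈ univ.erase v, h u (D' u)) / M := by
      rw [Finset.prod_div_distrib, hM, Nat.cast_prod]
    rw [h4]
    calc _ ≤ (∏ u ∈ univ.erase v, h u (D' u)) *
          (C * Real.log 4 * ((N : ℝ) / M) * ∑ m ∈ Icc 1 N, h v m / m) := by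
          refine mul_le_mul_of_nonneg_left (h1.trans ?_) hH
          gcongr
      _ = _ := by ring
  have hpos : 0 < 1 + Real.log N := by linarith
  rw [mul_div_assoc', div_mul_eq_mul_div, le_div_iff₀ hpos, Finset.sum_mul]
  calc ∑ D ∈ B, (if ∏ u, D u ≤ N then ∏ u, h u (D u) else 0) * (1 + Real.log N)
      ≤ ∑ D ∈ B, (N * ∏ u, (h u (D u) / D u) +
          ∑ v, (if ∏ u, D u ≤ N then ∏ u, h u (D u) else 0) * Real.log (D v)) := by
        refine Finset.sum_le_sum fun D hD => ?_
        have hH : 0 ≤ ∏ u, h u (D u) := Finset.prod_nonneg fun u _ => (hh u).nonneg _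
        have hM1 : 1 ≤ ∏ u, D u := prod_mem_Icc_pos (S := univ) fun u _ => hBmem D hD u
        split_ifs with hle
        · rw [← Finset.mul_sum, ← Real.log_prod (fun u _ => by
            have := (Finset.mem_Icc.1 (hBmem D hD u)).1; positivity), Finset.prod_div_distrib]
          rw [← Nat.cast_prod]
          set M := ∏ u, D u
          have hM0 : (0 : ℝ) < M := by exact_mod_cast hM1
          have hx : 1 + Real.log (N / M) ≤ N / M := by
            have : (0 : ℝ) < (N : ℝ) / M := by
              have : (0 : ℝ) < N := by exact_mod_cast hN
              positivity
            linarith [Real.log_le_sub_one_of_pos this]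
          rw [Real.log_div (by positivity) (by positivity)] at hx
          have := mul_le_mul_of_nonneg_left hx hH
          calc _ = (∏ u, h u (D u)) * (1 + (Real.log N - Real.log M)) +
                (∏ u, h u (D u)) * Real.log M := by ring
            _ ≤ (∏ u, h u (D u)) * (N / M) + (∏ u, h u (D u)) * Real.log M := by linarith
            _ = _ := by ring
        · simp only [zero_mul, Finset.sum_const_zero, add_zero]
          exact mul_nonneg (by positivity) (Finset.prod_nonneg fun u _ => hnn u _)
    _ ≤ N * P + Fintype.card ι * (C * Real.log 4 * N * P) := by
        rw [Finset.sum_add_distrib, ← Finset.mul_sum, ← hPeq, Finset.sum_comm]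
        gcongr
        refine (Finset.sum_le_sum fun v _ => key v).trans ?_
        simp
    _ = _ := by ring

lemma div_one_add_log_le (Y : ℕ) (hY : 1 ≤ Y) (δ : ℝ) (hδ : 0 < δ) (hδ1 : δ ≤ 1) :
    (Y : ℝ) / (1 + Real.log Y) ≤ 2 / δ * ∑ m ∈ Icc 1 Y, hw δ m := by
  have hl : 0 ≤ Real.log Y := Real.log_natCast_nonneg Y
  have h1 := Chebyshev.psi_ge Y
  have h2 := Chebyshev.psi_le_primeCounting_mul_log Y
  have hY1 : (1 : ℝ) ≤ Y := by exact_mod_cast hY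
  have h3 : Real.log (Y + 1) ≤ 1 + Real.log Y := by
    have : Real.log (Y + 1) ≤ Real.log (Real.exp 1 * Y) := by
      apply Real.log_le_log (by positivity)
      have := Real.add_one_le_exp (1 : ℝ)
      nlinarith
    rw [Real.log_mul (by positivity) (by positivity), Real.log_exp] at this
    exact this
  have h4 : (1 : ℝ) / 2 ≤ Real.log 2 := by have := Real.log_two_gt_d9; linarith
  have h5 : (Y : ℝ) * (1 / 2) ≤ (1 + Nat.primeCounting Y) * (1 + Real.log Y) := by
    have : (0 : ℝ) ≤ Nat.primeCounting Y := by positivity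
    nlinarith
  have h6 : δ * (1 + Nat.primeCounting Y) ≤ ∑ m ∈ Icc 1 Y, hw δ m := by
    have hsub : insert 1 ((Icc 1 Y).filter Nat.Prime) ⊆ Icc 1 Y := by
      intro m hm
      rw [Finset.mem_insert] at hm
      rcases hm with rfl | hm
      · exact Finset.mem_Icc.2 ⟨le_rfl, hY⟩
      · exact (Finset.mem_filter.1 hm).1
    refine le_trans ?_ (Finset.sum_le_sum_of_subset_of_nonneg hsub
      fun m _ _ => hw_nonneg hδ.le m)
    rw [Finset.sum_insert (by simp [Nat.not_prime_one]), hw_one_right]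
    have e : ∀ p ∈ (Icc 1 Y).filter Nat.Prime, hw δ p = δ := by
      intro p hp
      have hp := (Finset.mem_filter.1 hp).2
      rw [hw_of_squarefree hp.prime.squarefree, hp.primeFactors]; simp
    rw [Finset.sum_congr rfl e, Finset.sum_const]
    have hc : ((Icc 1 Y).filter Nat.Prime).card = Nat.primeCounting Y := by
      rw [Nat.primeCounting, Nat.primeCounting', Nat.count_eq_card_filter_range]
      congr 1
      ext p
      simp only [Finset.mem_filter, Finset.mem_Icc, Finset.mem_range]
      constructor
      · rintro ⟨⟨_, h⟩, hp⟩; exact ⟨by omega, hp⟩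
      · rintro ⟨h, hp⟩; exact ⟨⟨hp.one_le, by omega⟩, hp⟩
    rw [hc, nsmul_eq_mul]
    nlinarith
  rw [div_le_iff₀ (by linarith), div_mul_eq_mul_div, div_mul_eq_mul_div, le_div_iff₀ hδ]
  nlinarith

/-- The version of `sum_tuple_le` with one coordinate already summed. -/
lemma sum_tuple_erase_le {ι : Type*} [Fintype ι] [DecidableEq ι] (δ : ℝ) (hδ : 0 < δ)
    (hδ1 : δ ≤ 1) (C : ℝ) (hC : 1 ≤ C) : ∃ K : ℝ, 0 < K ∧ ∀ (h : ι → ℕ → ℝ) (v : ι)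
    (_ : ∀ u, IsWeight C (h u)) (N : ℕ) (_ : 1 ≤ N),
    ∑ D ∈ Fintype.piFinset (Function.update (fun _ : ι => Icc 1 N) v {1}),
      (if ∏ u ∈ univ.erase v, D u ≤ N then (∏ u ∈ univ.erase v, h u (D u)) *
        (((N / ∏ u ∈ univ.erase v, D u : ℕ) : ℝ) /
          (1 + Real.log (N / ∏ u ∈ univ.erase v, D u : ℕ))) else 0) ≤
    K * (N / (1 + Real.log N)) * (1 + Real.log N) ^ δ *
      ∏ u ∈ univ.erase v, ∑ m ∈ Icc 1 N, h u m / m := by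
  obtain ⟨K, hK1, hK⟩ := sum_hw_div_le δ hδ.le
  have hlog4 : 0 ≤ Real.log 4 := Real.log_nonneg (by norm_num)
  have hC0 : 0 ≤ C := by linarith
  refine ⟨2 / δ * ((1 + Fintype.card ι * (C * Real.log 4)) * K), by positivity,
    fun h v hh N hN => ?_⟩
  have hl : 0 ≤ Real.log N := Real.log_natCast_nonneg N
  set h' : ι → ℕ → ℝ := Function.update h v (hw δ) with hh'
  have hne : ∀ u ∈ univ.erase v, h' u = h u := fun u hu => by
    rw [hh', Function.update_of_ne (Finset.ne_of_mem_erase hu)]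
  have hv : h' v = hw δ := by rw [hh', Function.update_self]
  have hh'w : ∀ u, IsWeight C (h' u) := by
    intro u
    by_cases huv : u = v
    · subst huv; rw [hv]; exact isWeight_hw hδ.le (hδ1.trans hC)
    · rw [hne u (Finset.mem_erase.2 ⟨huv, Finset.mem_univ u⟩)]; exact hh u
  have h1 := sum_tuple_le hC0 h' hh'w N hN
  rw [sum_piFinset_isolate _ v, ← Finset.mul_prod_erase univ _ (Finset.mem_univ v), hv,
    Finset.prod_congr rfl (fun u hu => by rw [hne u hu] :
      ∀ u ∈ univ.erase v, ∑ m ∈ Icc 1 N, h' u m / m = ∑ m ∈ Icc 1 N, h u m / m)] at h1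
  have h2 : ∑ D ∈ Fintype.piFinset (Function.update (fun _ : ι => Icc 1 N) v {1}),
      (if ∏ u ∈ univ.erase v, D u ≤ N then (∏ u ∈ univ.erase v, h u (D u)) *
        (((N / ∏ u ∈ univ.erase v, D u : ℕ) : ℝ) /
          (1 + Real.log (N / ∏ u ∈ univ.erase v, D u : ℕ))) else 0) ≤
      2 / δ * ∑ D ∈ Fintype.piFinset (Function.update (fun _ : ι => Icc 1 N) v {1}),
        ∑ m ∈ Icc 1 N, (if ∏ u, Function.update D v m u ≤ N
          then ∏ u, h' u (Function.update D v m u) else 0) := by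
    rw [Finset.mul_sum]
    refine Finset.sum_le_sum fun D' hD' => ?_
    have hD'1 : ∀ u ∈ univ.erase v, D' u ∈ Icc 1 N := by
      intro u hu
      have := Fintype.mem_piFinset.1 hD' u
      rwa [Function.update_of_ne (Finset.ne_of_mem_erase hu)] at this
    set M := ∏ u ∈ univ.erase v, D' u with hM
    have hM1 : 1 ≤ M := prod_mem_Icc_pos hD'1
    have hH : 0 ≤ ∏ u ∈ univ.erase v, h u (D' u) :=
      Finset.prod_nonneg fun u _ => (hh u).nonneg _
    have e1 : ∀ m ∈ Icc 1 N, (if ∏ u, Function.update D' v m u ≤ N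
          then ∏ u, h' u (Function.update D' v m u) else 0)
        = if m ∈ Icc 1 (N / M) then (∏ u ∈ univ.erase v, h u (D' u)) * hw δ m
          else 0 := by
      intro m hm
      rw [prod_update_eq (fun _ x => x), prod_update_eq, ← hM, hv]
      have : m * M ≤ N ↔ m ∈ Icc 1 (N / M) := by
        rw [Finset.mem_Icc, Nat.le_div_iff_mul_le hM1]
        exact ⟨fun h => ⟨(Finset.mem_Icc.1 hm).1, h⟩, fun h => h.2⟩
      simp only [this]
      rw [Finset.prod_congr rfl (fun u hu => by rw [hne u hu] :
        ∀ u ∈ univ.erase v, h' u (D' u) = h u (D' u)), mul_comm]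
    rw [Finset.sum_congr rfl e1, ← Finset.sum_filter, Finset.filter_mem_eq_inter,
      Finset.inter_eq_right.2 (Finset.Icc_subset_Icc_right (Nat.div_le_self N M)), ← Finset.mul_sum]
    split_ifs with hle
    · have h3 := div_one_add_log_le (N / M) (Nat.div_pos hle hM1) δ hδ hδ1
      calc _ ≤ _ := mul_le_mul_of_nonneg_left h3 hH
        _ = _ := by ring
    · have : 0 ≤ ∑ m ∈ Icc 1 (N / M), hw δ m := Finset.sum_nonneg fun m _ => hw_nonneg hδ.le m
      positivity
  refine h2.trans ((mul_le_mul_of_nonneg_left h1 (by positivity)).trans ?_)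
  have h5 : 0 ≤ ∏ u ∈ univ.erase v, ∑ m ∈ Icc 1 N, h u m / m :=
    Finset.prod_nonneg fun u _ => Finset.sum_nonneg fun m _ =>
      div_nonneg ((hh u).nonneg m) (by positivity)
  calc _ ≤ 2 / δ * ((1 + Fintype.card ι * (C * Real.log 4)) * (N / (1 + Real.log N)) *
      ((K * (1 + Real.log N) ^ δ) * ∏ u ∈ univ.erase v, ∑ m ∈ Icc 1 N, h u m / m)) := by
        gcongr
        exact hK N
    _ = _ := by ring

/-! ### Character sums over squarefree integers -/

/-- A real completely multiplicative function bounded by one whose partial sums are bounded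
by `q`. -/
structure IsChar (q : ℝ) (χ : ℕ → ℝ) : Prop where
  map_mul : ∀ a b, χ (a * b) = χ a * χ b
  abs_le : ∀ a, |χ a| ≤ 1
  sum_le : ∀ x : ℕ, |∑ a ∈ Icc 1 x, χ a| ≤ q

lemma IsChar.nonneg {q : ℝ} {χ : ℕ → ℝ} (h : IsChar q χ) : 0 ≤ q :=
  (abs_nonneg _).trans (h.sum_le 0)

lemma sum_Icc_dvd {p : ℕ} (hp : 0 < p) (x : ℕ) (f : ℕ → ℝ) :
    ∑ a ∈ Icc 1 x, (if p ∣ a then f a else 0) = ∑ b ∈ Icc 1 (x / p), f (p * b) := by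
  rw [← Finset.sum_filter]
  refine Finset.sum_bij' (fun a _ => a / p) (fun b _ => p * b) ?_ ?_ ?_ ?_ ?_
  · intro a ha
    rw [Finset.mem_filter, Finset.mem_Icc] at ha
    obtain ⟨b, rfl⟩ := ha.2
    rw [Nat.mul_div_cancel_left _ hp, Finset.mem_Icc, Nat.le_div_iff_mul_le hp, mul_comm]
    exact ⟨Nat.pos_of_mul_pos_left ha.1.1 , ha.1.2⟩
  · intro b hb
    rw [Finset.mem_Icc, Nat.le_div_iff_mul_le hp, mul_comm] at hb
    rw [Finset.mem_filter, Finset.mem_Icc]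
    exact ⟨⟨Nat.mul_pos hp hb.1, hb.2⟩, Dvd.intro _ rfl⟩
  · intro a ha
    exact Nat.mul_div_cancel' (Finset.mem_filter.1 ha).2
  · intro b _
    exact Nat.mul_div_cancel_left _ hp
  · intro a ha
    rw [Nat.mul_div_cancel' (Finset.mem_filter.1 ha).2]

lemma IsChar.not_dvd {q : ℝ} {χ : ℕ → ℝ} (h : IsChar q χ) {p : ℕ} (hp : p.Prime) :
    IsChar (2 * q) (fun a => if p ∣ a then 0 else χ a) where
  map_mul a b := by
    simp only [hp.dvd_mul, h.map_mul]
    by_cases ha : p ∣ a <;> by_cases hb : p ∣ b <;> simp [ha, hb]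
  abs_le a := by
    split_ifs
    · simp
    · exact h.abs_le a
  sum_le x := by
    have e : ∀ a ∈ Icc 1 x, (if p ∣ a then 0 else χ a) = χ a - (if p ∣ a then χ a else 0) := by
      intro a _; split_ifs <;> simp
    rw [Finset.sum_congr rfl e, Finset.sum_sub_distrib, sum_Icc_dvd hp.pos]
    simp only [h.map_mul]
    rw [← Finset.mul_sum]
    refine (abs_sub _ _).trans ?_
    rw [abs_mul]
    have h1 := h.sum_le x
    have h2 := h.sum_le (x / p)
    have h3 := h.abs_le p
    nlinarith [abs_nonneg (χ p), abs_nonneg (∑ b ∈ Icc 1 (x / p), χ b)]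

lemma IsChar.sieve {q : ℝ} {χ : ℕ → ℝ} (h : IsChar q χ) (S : Finset ℕ)
    (hS : ∀ p ∈ S, p.Prime) :
    IsChar (2 ^ S.card * q) (fun a => if ∀ p ∈ S, ¬ p ∣ a then χ a else 0) := by
  induction S using Finset.induction_on with
  | empty => simpa using h
  | insert p S hp ih =>
    have := (ih fun r hr => hS r (Finset.mem_insert_of_mem hr)).not_dvd
      (hS p (Finset.mem_insert_self p S))
    rw [Finset.card_insert_of_notMem hp, pow_succ']
    convert this using 1
    · ring
    · ext a
      by_cases h1 : p ∣ a <;> simp [h1]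

lemma IsChar.coprime {q : ℝ} {χ : ℕ → ℝ} (h : IsChar q χ) {n : ℕ} (hn : n ≠ 0) :
    IsChar (2 ^ n.primeFactors.card * q) (fun a => if a.Coprime n then χ a else 0) := by
  convert h.sieve n.primeFactors (fun p hp => Nat.prime_of_mem_primeFactors hp) using 4 with a
  constructor
  · intro hc p hp hpa
    exact (Nat.prime_of_mem_primeFactors hp).one_lt.ne'
      (Nat.eq_one_of_dvd_coprimes hc hpa (Nat.dvd_of_mem_primeFactors hp))
  · intro hc
    exact Nat.coprime_of_dvd fun p hp hpa hpn => hc p (Nat.mem_primeFactors.2 ⟨hp, hpn, hn⟩) hpa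

lemma sum_moebius_sq_dvd {a : ℕ} (ha : 0 < a) {x : ℕ} (hax : a ≤ x) :
    ∑ d ∈ Icc 1 x, (if d ^ 2 ∣ a then (ArithmeticFunction.moebius d : ℝ) else 0) = hw 1 a := by
  obtain ⟨c, b, hc, hb, hab, hsq⟩ := Nat.sq_mul_squarefree_of_pos ha
  have hdvd : ∀ d : ℕ, d ^ 2 ∣ a ↔ d ∣ b := by
    intro d
    rw [← hab]
    constructor
    · intro h
      have hd : d ≠ 0 := by rintro rfl; simp at h; omega
      rw [← Nat.factorization_le_iff_dvd hd (by omega)]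
      intro p
      by_cases hp : p.Prime
      · have h1 := (Nat.factorization_le_iff_dvd (by positivity) (by positivity)).2 h p
        rw [Nat.factorization_mul (by positivity) (by omega), Nat.factorization_pow,
          Nat.factorization_pow] at h1
        simp only [Finsupp.smul_apply, Finsupp.add_apply, smul_eq_mul] at h1
        have h2 := hsq.natFactorization_le_one p
        omega
      · simp [Nat.factorization_eq_zero_of_not_prime _ hp]
    · intro h
      exact (pow_dvd_pow_of_dvd h 2).trans (Dvd.intro _ rfl)
  have hbx : b ≤ x := by
    have : b ∣ a := by rw [← hab, pow_two, mul_assoc]; exact Dvd.intro _ rfl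
    exact (Nat.le_of_dvd ha this).trans hax
  have h1 : ∑ d ∈ Icc 1 x, (if d ^ 2 ∣ a then (ArithmeticFunction.moebius d : ℝ) else 0)
      = ∑ d ∈ b.divisors, (ArithmeticFunction.moebius d : ℝ) := by
    rw [← Finset.sum_filter]
    refine Finset.sum_congr ?_ fun _ _ => rfl
    ext d
    rw [Finset.mem_filter, Finset.mem_Icc, hdvd, Nat.mem_divisors]
    constructor
    · rintro ⟨_, h⟩; exact ⟨h, by omega⟩
    · rintro ⟨h, _⟩
      have h3 := Nat.le_of_dvd hb h
      exact ⟨⟨Nat.pos_of_dvd_of_pos h hb, by omega⟩, h⟩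
  rw [h1]
  have h2 : ∑ d ∈ b.divisors, (ArithmeticFunction.moebius d : ℤ) = if b = 1 then 1 else 0 := by
    have := congrArg (fun f : ArithmeticFunction ℤ => f b) ArithmeticFunction.coe_zeta_mul_moebius
    simp only [ArithmeticFunction.coe_zeta_mul_apply, ArithmeticFunction.one_apply] at this
    exact this
  have h3 : ∑ d ∈ b.divisors, (ArithmeticFunction.moebius d : ℝ) = if b = 1 then 1 else 0 := by
    exact_mod_cast h2
  rw [h3]
  by_cases hb1 : b = 1
  · subst hb1
    have : Squarefree a := by rw [← hab]; simpa using hsq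
    simp [hw, this]
  · rw [if_neg hb1, hw_of_not_squarefree]
    intro hs
    apply hb1
    have := hs b (by rw [← hab, pow_two]; exact Dvd.intro _ rfl)
    exact Nat.isUnit_iff.1 this

lemma sum_Icc_inv_le (x : ℕ) : ∑ d ∈ Icc 1 x, (1 : ℝ) / d ≤ 1 + Real.log x := by
  have := harmonic_le_one_add_log x
  rw [harmonic_eq_sum_Icc] at this
  push_cast at this
  simpa [one_div] using this

/-- The bound for squarefree sums of characters. -/
lemma IsChar.sum_sqf_le {q : ℝ} {χ : ℕ → ℝ} (h : IsChar q χ) (x : ℕ) :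
    |∑ a ∈ Icc 1 x, χ a * hw 1 a| ≤ √(q * x) * (1 + Real.log x) := by
  have e : ∀ a ∈ Icc 1 x, χ a * hw 1 a = ∑ d ∈ Icc 1 x,
      (if d ^ 2 ∣ a then (ArithmeticFunction.moebius d : ℝ) * χ a else 0) := by
    intro a ha
    rw [Finset.mem_Icc] at ha
    rw [← sum_moebius_sq_dvd ha.1 ha.2, Finset.mul_sum]
    refine Finset.sum_congr rfl fun d _ => ?_
    split_ifs <;> ring
  rw [Finset.sum_congr rfl e, Finset.sum_comm]
  have hq := h.nonneg
  calc _ ≤ ∑ d ∈ Icc 1 x, √(q * x) * ((1 : ℝ) / d) := by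
        refine (Finset.abs_sum_le_sum_abs _ _).trans (Finset.sum_le_sum fun d hd => ?_)
        have hd1 : 1 ≤ d := (Finset.mem_Icc.1 hd).1
        have hd0 : (0 : ℝ) < d := by exact_mod_cast hd1
        rw [sum_Icc_dvd (by positivity)]
        simp only [h.map_mul]
        rw [← Finset.mul_sum, ← Finset.mul_sum, abs_mul, abs_mul]
        have h1 : |(ArithmeticFunction.moebius d : ℝ)| ≤ 1 := by
          have := ArithmeticFunction.abs_moebius_le_one (n := d)
          exact_mod_cast this
        have h2 := h.abs_le (d ^ 2)
        have h3 := h.sum_le (x / d ^ 2)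
        have h4 : |∑ a ∈ Icc 1 (x / d ^ 2), χ a| ≤ (x : ℝ) / d ^ 2 := by
          refine (Finset.abs_sum_le_sum_abs _ _).trans
            ((Finset.sum_le_sum fun a _ => h.abs_le a).trans ?_)
          simp only [Finset.sum_const, Nat.card_Icc, Nat.add_sub_cancel, nsmul_eq_mul, mul_one]
          exact Nat.cast_div_le.trans (by push_cast; exact le_rfl)
        set B := |∑ a ∈ Icc 1 (x / d ^ 2), χ a|
        have hB : 0 ≤ B := abs_nonneg _
        have h5 : B ≤ √(q * x) * (1 / d) := by
          have : B ^ 2 ≤ q * x * (1 / d) ^ 2 := by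
            calc B ^ 2 = B * B := by ring
              _ ≤ q * (x / d ^ 2) := mul_le_mul h3 h4 hB hq
              _ = _ := by ring
          calc B = √(B ^ 2) := (Real.sqrt_sq hB).symm
            _ ≤ √(q * x * (1 / d) ^ 2) := Real.sqrt_le_sqrt this
            _ = _ := by rw [Real.sqrt_mul (by positivity), Real.sqrt_sq (by positivity)]
        calc _ ≤ 1 * (1 * B) := by gcongr
          _ ≤ _ := by linarith
    _ ≤ _ := by
        rw [← Finset.mul_sum]
        gcongr
        exact sum_Icc_inv_le x

/-- Partial summation against the logarithm. -/
lemma sum_mul_log_sub (f : ℕ → ℝ) (Y : ℕ) :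
    ∑ m ∈ Icc 1 Y, f m * (Real.log Y - Real.log m) =
      ∑ j ∈ Icc 1 (Y - 1), (∑ m ∈ Icc 1 j, f m) * (Real.log (j + 1 : ℕ) - Real.log j) := by
  induction Y with
  | zero => simp
  | succ n ih =>
    rw [Finset.sum_Icc_succ_top (by omega), sub_self, mul_zero, add_zero, Nat.add_sub_cancel]
    rcases Nat.eq_zero_or_pos n with rfl | hn
    · simp
    obtain ⟨k, rfl⟩ : ∃ k, n = k + 1 := ⟨n - 1, by omega⟩
    rw [Nat.add_sub_cancel] at ih
    rw [Finset.sum_Icc_succ_top (b := k) (by omega)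
      (fun j : ℕ => (∑ m ∈ Icc 1 j, f m) * (Real.log (j + 1 : ℕ) - Real.log j)), ← ih,
      Finset.sum_mul, ← Finset.sum_add_distrib]
    refine Finset.sum_congr rfl fun m _ => ?_
    ring

lemma abs_sum_mul_log_le (f : ℕ → ℝ) (Y : ℕ) (B : ℝ)
    (hB : ∀ j ≤ Y, |∑ m ∈ Icc 1 j, f m| ≤ B) :
    |∑ m ∈ Icc 1 Y, f m * Real.log m| ≤ 2 * B * Real.log Y := by
  have h1 : ∑ m ∈ Icc 1 Y, f m * Real.log m = (∑ m ∈ Icc 1 Y, f m) * Real.log Y -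
      ∑ m ∈ Icc 1 Y, f m * (Real.log Y - Real.log m) := by
    rw [Finset.sum_mul, ← Finset.sum_sub_distrib]
    refine Finset.sum_congr rfl fun m _ => ?_
    ring
  have hl := Real.log_natCast_nonneg Y
  have hB0 : 0 ≤ B := (abs_nonneg _).trans (hB 0 (Nat.zero_le _))
  have h2 : |∑ m ∈ Icc 1 Y, f m * (Real.log Y - Real.log m)| ≤ B * Real.log Y := by
    rw [sum_mul_log_sub]
    have h3 : ∑ j ∈ Icc 1 (Y - 1), (Real.log (j + 1 : ℕ) - Real.log j) ≤ Real.log Y := by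
      have := sum_mul_log_sub (fun m => if m = 1 then 1 else 0) Y
      rcases Nat.eq_zero_or_pos Y with rfl | hY
      · simp
      have e : ∀ j ∈ Icc 1 (Y - 1), (∑ m ∈ Icc 1 j, (if m = 1 then (1 : ℝ) else 0)) = 1 := by
        intro j hj
        rw [Finset.sum_ite_eq', if_pos (Finset.mem_Icc.2 ⟨le_rfl, (Finset.mem_Icc.1 hj).1⟩)]
      have e' : ∑ j ∈ Icc 1 (Y - 1), (∑ m ∈ Icc 1 j, (if m = 1 then (1 : ℝ) else 0)) *
          (Real.log (j + 1 : ℕ) - Real.log j) =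
          ∑ j ∈ Icc 1 (Y - 1), (Real.log (j + 1 : ℕ) - Real.log j) :=
        Finset.sum_congr rfl fun j hj => by rw [e j hj, one_mul]
      rw [← e', ← this]
      simp only [ite_mul, one_mul, zero_mul, Finset.sum_ite_eq']
      split_ifs <;> simp [hl]
    refine (Finset.abs_sum_le_sum_abs _ _).trans ?_
    calc _ ≤ ∑ j ∈ Icc 1 (Y - 1), B * (Real.log (j + 1 : ℕ) - Real.log j) := by
          refine Finset.sum_le_sum fun j hj => ?_
          rw [Finset.mem_Icc] at hj
          have h4 : Real.log j ≤ Real.log (j + 1 : ℕ) :=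
            Real.log_le_log (by exact_mod_cast hj.1) (by push_cast; linarith)
          rw [abs_mul, abs_of_nonneg (sub_nonneg.2 h4)]
          exact mul_le_mul_of_nonneg_right (hB j (by omega)) (sub_nonneg.2 h4)
      _ ≤ _ := by rw [← Finset.mul_sum]; gcongr
  rw [h1]
  refine (abs_sub _ _).trans ?_
  rw [abs_mul, abs_of_nonneg hl]
  have := mul_le_mul_of_nonneg_right (hB Y le_rfl) hl
  linarith

/-! ### Savings for weighted character sums -/

lemma abs_hw (κ : ℝ) (m : ℕ) : |hw κ m| = hw |κ| m := by
  unfold hw; split_ifs <;> simp [abs_pow]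

lemma sum_hw_div_le_pow (κ : ℝ) (hκ : 0 ≤ κ) :
    ∃ K : ℕ, 1 ≤ K ∧ ∀ N : ℕ, ∑ m ∈ Icc 1 N, hw κ m / m ≤ K * (1 + Real.log N) ^ K := by
  obtain ⟨C, hC1, hC⟩ := sum_hw_div_le κ hκ
  refine ⟨⌈C⌉₊ + ⌈κ⌉₊, ?_, fun N => (hC N).trans ?_⟩
  · have : 0 < ⌈C⌉₊ := Nat.ceil_pos.2 (by linarith)
    omega
  · have h1 : (1 : ℝ) ≤ 1 + Real.log N := by linarith [Real.log_natCast_nonneg N]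
    have h2 : (1 + Real.log N) ^ κ ≤ (1 + Real.log N) ^ (⌈C⌉₊ + ⌈κ⌉₊) := by
      rw [← Real.rpow_natCast]
      apply Real.rpow_le_rpow_of_exponent_le h1
      push_cast
      have := Nat.le_ceil κ
      have : (0 : ℝ) ≤ ⌈C⌉₊ := by positivity
      linarith
    have h3 : C ≤ ((⌈C⌉₊ + ⌈κ⌉₊ : ℕ) : ℝ) := by
      push_cast
      have := Nat.le_ceil C
      have : (0 : ℝ) ≤ ⌈κ⌉₊ := by positivity
      linarith
    gcongr

lemma sum_divisorsAntidiagonal_Icc (Y : ℕ) (F : ℕ → ℕ → ℝ) :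
    ∑ m ∈ Icc 1 Y, ∑ x ∈ m.divisorsAntidiagonal, F x.1 x.2 =
      ∑ a ∈ Icc 1 Y, ∑ b ∈ Icc 1 (Y / a), F a b := by
  rw [Finset.sum_sigma', Finset.sum_sigma']
  refine Finset.sum_bij' (fun x _ => (⟨x.2.1, x.2.2⟩ : (_ : ℕ) × ℕ))
    (fun x _ => (⟨x.1 * x.2, (x.1, x.2)⟩ : (_ : ℕ) × (ℕ × ℕ))) ?_ ?_ ?_ ?_ ?_
  · rintro ⟨m, a, b⟩ hx
    simp only [Finset.mem_sigma, Finset.mem_Icc, Nat.mem_divisorsAntidiagonal] at hx ⊢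
    obtain ⟨⟨h1, h2⟩, rfl, h3⟩ := hx
    have ha : 0 < a := Nat.pos_of_ne_zero (by rintro rfl; simp at h3)
    have hb : 0 < b := Nat.pos_of_ne_zero (by rintro rfl; simp at h3)
    rw [Nat.le_div_iff_mul_le ha, mul_comm]
    exact ⟨⟨ha, (Nat.le_mul_of_pos_right a hb).trans h2⟩, hb, h2⟩
  · rintro ⟨a, b⟩ hx
    simp only [Finset.mem_sigma, Finset.mem_Icc, Nat.mem_divisorsAntidiagonal] at hx ⊢
    rw [Nat.le_div_iff_mul_le hx.1.1, mul_comm] at hx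
    have := Nat.mul_pos hx.1.1 hx.2.1
    exact ⟨⟨this, hx.2.2⟩, by simp, this.ne'⟩
  · rintro ⟨m, a, b⟩ hx
    simp only [Finset.mem_sigma, Finset.mem_Icc, Nat.mem_divisorsAntidiagonal] at hx
    obtain ⟨_, rfl, _⟩ := hx
    rfl
  · rintro ⟨a, b⟩ _
    rfl
  · rintro ⟨m, a, b⟩ _
    rfl

lemma sum_Icc_div_comm (Y : ℕ) (F : ℕ → ℕ → ℝ) :
    ∑ a ∈ Icc 1 Y, ∑ b ∈ Icc 1 (Y / a), F a b = ∑ b ∈ Icc 1 Y, ∑ a ∈ Icc 1 (Y / b), F a b := by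
  refine Finset.sum_comm' fun a b => ?_
  simp only [Finset.mem_Icc]
  constructor
  · rintro ⟨⟨h1, h2⟩, h3, h4⟩
    rw [Nat.le_div_iff_mul_le h1] at h4
    rw [Nat.le_div_iff_mul_le h3, mul_comm]
    exact ⟨⟨h1, h4⟩, h3, (Nat.le_mul_of_pos_right b h1).trans h4⟩
  · rintro ⟨⟨h1, h2⟩, h3, h4⟩
    rw [Nat.le_div_iff_mul_le h3] at h2
    rw [Nat.le_div_iff_mul_le h1, mul_comm]
    exact ⟨⟨h1, (Nat.le_mul_of_pos_right a h3).trans h2⟩, h3, h2⟩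

/-- The squarefree convolution of `α` with `κ ^ ω`. -/
def sqfConv (α : ℕ → ℝ) (κ : ℝ) (m : ℕ) : ℝ :=
  ∑ x ∈ m.divisorsAntidiagonal,
    if x.1.Coprime x.2 then α x.1 * hw 1 x.1 * hw κ x.2 else 0

lemma squarefree_prod_primes {S : Finset ℕ} (hS : ∀ p ∈ S, p.Prime) : Squarefree (∏ p ∈ S, p) :=
  Finset.squarefree_prod_of_pairwise_isCoprime
    (fun p hp q hq hpq => Nat.coprime_iff_isRelPrime.1
      ((Nat.coprime_primes (hS p hp) (hS q hq)).2 hpq))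
    (fun p hp => (hS p hp).prime.squarefree)

lemma sqfConv_of_squarefree (α : ℕ → ℝ) (κ : ℝ) {m : ℕ} (hm : Squarefree m) :
    sqfConv α κ m = ∑ S ∈ m.primeFactors.powerset,
      α (∏ p ∈ S, p) * κ ^ (m.primeFactors.card - S.card) := by
  have hP : ∀ S ⊆ m.primeFactors, ∀ p ∈ S, p.Prime := fun S hS p hp =>
    Nat.prime_of_mem_primeFactors (hS hp)
  have hprod : ∀ S ⊆ m.primeFactors, (∏ p ∈ S, p) * ∏ p ∈ m.primeFactors \ S, p = m := by
    intro S hS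
    rw [mul_comm, Finset.prod_sdiff hS, Nat.prod_primeFactors_of_squarefree hm]
  unfold sqfConv
  symm
  refine Finset.sum_bij' (fun S _ => (∏ p ∈ S, p, ∏ p ∈ m.primeFactors \ S, p))
    (fun x _ => x.1.primeFactors) ?_ ?_ ?_ ?_ ?_
  · intro S hS
    rw [Finset.mem_powerset] at hS
    rw [Nat.mem_divisorsAntidiagonal]
    exact ⟨hprod S hS, hm.ne_zero⟩
  · rintro ⟨a, b⟩ hx
    rw [Nat.mem_divisorsAntidiagonal] at hx
    rw [Finset.mem_powerset]
    exact Nat.primeFactors_mono (Dvd.intro _ hx.1) hx.2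
  · intro S hS
    rw [Finset.mem_powerset] at hS
    exact Nat.primeFactors_prod (hP S hS)
  · rintro ⟨a, b⟩ hx
    rw [Nat.mem_divisorsAntidiagonal] at hx
    have hx1 : a * b = m := hx.1
    have ha : ∏ p ∈ a.primeFactors, p = a :=
      Nat.prod_primeFactors_of_squarefree (hm.squarefree_of_dvd (Dvd.intro _ hx1))
    have hsub : a.primeFactors ⊆ m.primeFactors := Nat.primeFactors_mono (Dvd.intro _ hx1) hx.2
    have h1 := hprod _ hsub
    rw [ha, ← hx1] at h1
    have ha0 : 0 < a := Nat.pos_of_ne_zero (by rintro rfl; simp at hx1; exact hx.2 hx1.symm)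
    have h2 := Nat.eq_of_mul_eq_mul_left ha0 h1
    rw [hx1] at h2
    simp only [ha, h2]
  · intro S hS
    rw [Finset.mem_powerset] at hS
    have h1 := hP S hS
    have h2 := hP (m.primeFactors \ S) Finset.sdiff_subset
    have hc : Nat.Coprime (∏ p ∈ S, p) (∏ p ∈ m.primeFactors \ S, p) := by
      apply Nat.coprime_of_squarefree_mul
      rw [hprod S hS]; exact hm
    dsimp only
    rw [if_pos hc, hw_of_squarefree (squarefree_prod_primes h1), hw_of_squarefree (squarefree_prod_primes h2),
      Nat.primeFactors_prod h2, Finset.card_sdiff_of_subset hS]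
    simp

lemma sqfConv_of_not_squarefree (α : ℕ → ℝ) (κ : ℝ) {m : ℕ} (hm : ¬ Squarefree m) :
    sqfConv α κ m = 0 := by
  refine Finset.sum_eq_zero ?_
  rintro ⟨a, b⟩ hx
  rw [Nat.mem_divisorsAntidiagonal] at hx
  have hx1 : a * b = m := hx.1
  split_ifs with hc
  · by_cases ha : Squarefree a
    · by_cases hb : Squarefree b
      · exact absurd (hx1 ▸ Nat.squarefree_mul_iff.2 ⟨hc, ha, hb⟩) hm
      · simp [hw_of_not_squarefree hb]
    · simp [hw_of_not_squarefree ha]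
  · rfl

lemma sqfConv_one (κ : ℝ) (m : ℕ) : sqfConv (fun _ => 1) κ m = hw (κ + 1) m := by
  by_cases hm : Squarefree m
  · rw [sqfConv_of_squarefree _ _ hm, hw_of_squarefree hm, add_comm κ 1,
      ← Finset.sum_pow_mul_eq_add_pow]
    simp
  · rw [sqfConv_of_not_squarefree _ _ hm, hw_of_not_squarefree hm]

lemma sqfConv_log (c : ℝ) (m : ℕ) :
    c * sqfConv (fun a => Real.log a) (c - 1) m = hw c m * Real.log m := by
  by_cases hm : Squarefree m
  · rw [sqfConv_of_squarefree _ _ hm, hw_of_squarefree hm, log_le_sum_log_primeFactors hm]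
    set P := m.primeFactors with hP
    have hPp : ∀ p ∈ P, p.Prime := fun p hp => Nat.prime_of_mem_primeFactors hp
    have e1 : ∀ S ∈ P.powerset, Real.log (∏ p ∈ S, p : ℕ) * (c - 1) ^ (P.card - S.card)
        = ∑ p ∈ P, if p ∈ S then Real.log p * (c - 1) ^ (P.card - S.card) else 0 := by
      intro S hS
      rw [Finset.mem_powerset] at hS
      rw [Nat.cast_prod, Real.log_prod (fun p hp => by
        exact_mod_cast (hPp p (hS hp)).ne_zero), Finset.sum_mul, ← Finset.sum_filter,
        Finset.filter_mem_eq_inter, Finset.inter_eq_right.2 hS]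
    rw [Finset.sum_congr rfl e1, Finset.sum_comm, Finset.mul_sum, Finset.mul_sum]
    refine Finset.sum_congr rfl fun p hp => ?_
    have e2 : ∑ S ∈ P.powerset, (if p ∈ S then Real.log p * (c - 1) ^ (P.card - S.card) else 0)
        = ∑ S ∈ (P.erase p).powerset, Real.log p * (1 ^ S.card *
            (c - 1) ^ ((P.erase p).card - S.card)) := by
      rw [← Finset.sum_filter]
      refine Finset.sum_bij' (fun S _ => S.erase p) (fun S _ => insert p S) ?_ ?_ ?_ ?_ ?_
      · intro S hS
        rw [Finset.mem_filter, Finset.mem_powerset] at hS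
        rw [Finset.mem_powerset]
        exact Finset.erase_subset_erase p hS.1
      · intro S hS
        rw [Finset.mem_powerset] at hS
        rw [Finset.mem_filter, Finset.mem_powerset]
        exact ⟨Finset.insert_subset hp (hS.trans (Finset.erase_subset _ _)),
          Finset.mem_insert_self _ _⟩
      · intro S hS
        exact Finset.insert_erase (Finset.mem_filter.1 hS).2
      · intro S hS
        rw [Finset.mem_powerset] at hS
        exact Finset.erase_insert fun h => (Finset.mem_erase.1 (hS h)).1 rfl
      · intro S hS
        rw [Finset.mem_filter] at hS
        rw [one_pow, one_mul, Finset.card_erase_of_mem hp, Finset.card_erase_of_mem hS.2]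
        have := Finset.card_pos.2 ⟨p, hS.2⟩
        congr 2
        have := Finset.card_pos.2 ⟨p, hp⟩
        omega
    rw [e2, ← Finset.mul_sum, Finset.sum_pow_mul_eq_add_pow, Finset.card_erase_of_mem hp]
    have h1 := Finset.card_pos.2 ⟨p, hp⟩
    obtain ⟨n, hn⟩ : ∃ n, P.card = n + 1 := ⟨P.card - 1, by omega⟩
    rw [hn, Nat.add_sub_cancel, pow_succ]
    ring
  · rw [sqfConv_of_not_squarefree _ _ hm, hw_of_not_squarefree hm]
    simp

/-- A bound for `∑ χ(m) f(m)` which is uniform in the character, with a free parameter `T`. -/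
def CharBound (f : ℕ → ℝ) (K : ℕ) : Prop :=
  ∀ (q : ℝ) (χ : ℕ → ℝ), IsChar q χ → ∀ T Y : ℕ, 1 ≤ T →
    |∑ m ∈ Icc 1 Y, χ m * f m| ≤
      K * Y * ((1 + Real.log T) ^ K + √(q / T) * (1 + Real.log Y) ^ K)

lemma charBound_hw_of_abs_le_one {κ : ℝ} (hκ : |κ| ≤ 1) : CharBound (hw κ) 1 := by
  intro q χ hχ T Y hT
  have h1 : |∑ m ∈ Icc 1 Y, χ m * hw κ m| ≤ Y := by
    refine (Finset.abs_sum_le_sum_abs _ _).trans ?_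
    calc _ ≤ ∑ m ∈ Icc 1 Y, (1 : ℝ) := by
          refine Finset.sum_le_sum fun m _ => ?_
          rw [abs_mul, abs_hw]
          have h2 : hw |κ| m ≤ 1 := by
            unfold hw; split_ifs
            · exact pow_le_one₀ (abs_nonneg _) hκ
            · norm_num
          exact mul_le_one₀ (hχ.abs_le m) (hw_nonneg (abs_nonneg _) m) h2
      _ = Y := by simp
  refine h1.trans ?_
  have h2 := Real.log_natCast_nonneg T
  have h3 := Real.log_natCast_nonneg Y
  have h4 : 0 ≤ √(q / T) * (1 + Real.log Y) := by positivity
  have h5 : (0 : ℝ) ≤ Y := by positivity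
  simp only [Nat.cast_one, one_mul, pow_one]
  nlinarith

/-- The hyperbola method for squarefree convolutions. -/
lemma charBound_sqfConv {α : ℕ → ℝ} (hα : ∀ a : ℕ, 1 ≤ a → 0 ≤ α a ∧ α a ≤ 1 + Real.log a)
    (hαs : ∀ (q : ℝ) (χ : ℕ → ℝ), IsChar q χ → ∀ x : ℕ,
      |∑ a ∈ Icc 1 x, χ a * (α a * hw 1 a)| ≤ 2 * √(q * x) * (1 + Real.log x) ^ 2)
    {κ : ℝ} {K : ℕ} (hκ : CharBound (hw κ) K) : ∃ K', CharBound (sqfConv α κ) K' := by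
  obtain ⟨K2, hK21, hK2⟩ := sum_hw_div_le_pow 2 (by norm_num)
  obtain ⟨K3, hK31, hK3⟩ := sum_hw_div_le_pow (2 * |κ|) (by positivity)
  refine ⟨K + K * K2 + K2 + 4 * K3 + K3 + 2, fun q χ hχ T Y hT => ?_⟩
  set K' := K + K * K2 + K2 + 4 * K3 + K3 + 2 with hK'
  have hq := hχ.nonneg
  have hLT : 1 ≤ 1 + Real.log T := by linarith [Real.log_natCast_nonneg T]
  have hLY : 1 ≤ 1 + Real.log Y := by linarith [Real.log_natCast_nonneg Y]
  have hT0 : (0 : ℝ) < T := by exact_mod_cast hT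
  set s := √(q / T) with hs
  have hs0 : 0 ≤ s := Real.sqrt_nonneg _
  set G : ℕ → ℕ → ℝ := fun a b => if a.Coprime b then χ a * χ b * (α a * hw 1 a * hw κ b) else 0
    with hG
  have e1 : ∑ m ∈ Icc 1 Y, χ m * sqfConv α κ m = ∑ a ∈ Icc 1 Y, ∑ b ∈ Icc 1 (Y / a), G a b := by
    rw [← sum_divisorsAntidiagonal_Icc]
    refine Finset.sum_congr rfl fun m _ => ?_
    rw [sqfConv, Finset.mul_sum]
    refine Finset.sum_congr rfl fun x hx => ?_
    rw [← (Nat.mem_divisorsAntidiagonal.1 hx).1, hχ.map_mul, hG]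
    simp only
    split_ifs <;> simp
  have e2 : ∑ a ∈ Icc 1 Y, ∑ b ∈ Icc 1 (Y / a), G a b =
      ∑ a ∈ Icc 1 Y, (if a ≤ T then ∑ b ∈ Icc 1 (Y / a), G a b else 0) +
      ∑ b ∈ Icc 1 Y, ∑ a ∈ Icc 1 (Y / b), (if a ≤ T then 0 else G a b) := by
    rw [← sum_Icc_div_comm Y (fun a b => if a ≤ T then 0 else G a b), ← Finset.sum_add_distrib]
    refine Finset.sum_congr rfl fun a _ => ?_
    split_ifs <;> simp
  have hsqrt : ∀ w : ℕ, √((2 : ℝ) ^ w) ≤ 2 ^ w := fun w => by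
    rw [Real.sqrt_le_left (by positivity)]
    have : (1 : ℝ) ≤ 2 ^ w := one_le_pow₀ (by norm_num)
    nlinarith
  -- small `a`
  have h1 : |∑ a ∈ Icc 1 Y, (if a ≤ T then ∑ b ∈ Icc 1 (Y / a), G a b else 0)| ≤
      K * Y * (1 + Real.log T) ^ (K + 2) +
        K * Y * (s * (1 + Real.log Y) ^ (K + 1)) * (K2 * (1 + Real.log Y) ^ K2) := by
    have hterm : ∀ a ∈ Icc 1 Y, |if a ≤ T then ∑ b ∈ Icc 1 (Y / a), G a b else 0| ≤
        (if a ≤ T then K * Y * (1 + Real.log T) ^ (K + 1) * ((1 : ℝ) / a) else 0) +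
          K * Y * (s * (1 + Real.log Y) ^ (K + 1)) * (hw 2 a / a) := by
      intro a ha
      rw [Finset.mem_Icc] at ha
      have ha0 : (0 : ℝ) < a := by exact_mod_cast ha.1
      have hrest : 0 ≤ K * Y * (s * (1 + Real.log Y) ^ (K + 1)) * (hw 2 a / a) :=
        mul_nonneg (by positivity) (div_nonneg (hw_nonneg (by norm_num) a) ha0.le)
      split_ifs with haT
      swap
      · simpa using hrest
      have e3 : ∑ b ∈ Icc 1 (Y / a), G a b = (χ a * (α a * hw 1 a)) *
          ∑ b ∈ Icc 1 (Y / a), (if b.Coprime a then χ b else 0) * hw κ b := by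
        rw [Finset.mul_sum]
        refine Finset.sum_congr rfl fun b _ => ?_
        simp only [hG, Nat.coprime_comm (m := a)]
        split_ifs <;> ring
      rw [e3, abs_mul]
      have hb := hκ _ _ (hχ.coprime (n := a) (by omega)) T (Y / a) hT
      have hα1 := hα a ha.1
      have hlogaT : Real.log a ≤ Real.log T := Real.log_le_log ha0 (by exact_mod_cast haT)
      have hlogaY : Real.log a ≤ Real.log Y := Real.log_le_log ha0 (by exact_mod_cast ha.2)
      by_cases hsq : Squarefree a
      swap
      · rw [hw_of_not_squarefree hsq]; simp; positivity
      have hA : |χ a * (α a * hw 1 a)| ≤ 1 + Real.log a := by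
        rw [hw_of_squarefree hsq, one_pow, mul_one, abs_mul, abs_of_nonneg hα1.1]
        calc _ ≤ 1 * (1 + Real.log a) := by
              apply mul_le_mul (hχ.abs_le a) hα1.2 hα1.1 (by norm_num)
          _ = _ := one_mul _
      have hsq2 : √(2 ^ a.primeFactors.card * q / T) ≤ 2 ^ a.primeFactors.card * s := by
        rw [mul_div_assoc, Real.sqrt_mul (by positivity)]
        gcongr
        exact hsqrt _
      have hYa : ((Y / a : ℕ) : ℝ) ≤ Y / a := Nat.cast_div_le
      have hlogYa : Real.log (Y / a : ℕ) ≤ Real.log Y := by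
        rcases Nat.eq_zero_or_pos (Y / a) with h0 | h0
        · rw [h0]; simp; linarith
        · exact Real.log_le_log (by exact_mod_cast h0) (by exact_mod_cast Nat.div_le_self Y a)
      have hl0 := Real.log_natCast_nonneg (Y / a)
      have hl1 := Real.log_natCast_nonneg a
      calc _ ≤ (1 + Real.log a) * (K * (Y / a) * ((1 + Real.log T) ^ K +
              2 ^ a.primeFactors.card * s * (1 + Real.log Y) ^ K)) := by
            refine mul_le_mul hA (hb.trans ?_) (abs_nonneg _) (by linarith)
            gcongr
        _ = K * Y * ((1 + Real.log T) ^ K * (1 + Real.log a)) * (1 / a) +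
              K * Y * (s * ((1 + Real.log Y) ^ K * (1 + Real.log a))) *
                (2 ^ a.primeFactors.card / a) := by ring
        _ ≤ _ := by
            rw [hw_of_squarefree hsq, pow_succ, pow_succ]
            gcongr
    refine (Finset.abs_sum_le_sum_abs _ _).trans ((Finset.sum_le_sum hterm).trans ?_)
    rw [Finset.sum_add_distrib, ← Finset.mul_sum, ← Finset.sum_filter, ← Finset.mul_sum]
    have h2 : ∑ a ∈ Icc 1 Y with a ≤ T, (1 : ℝ) / a ≤ 1 + Real.log T := by
      refine le_trans (Finset.sum_le_sum_of_subset_of_nonneg ?_ ?_) (sum_Icc_inv_le T)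
      · intro a ha
        simp only [Finset.mem_filter, Finset.mem_Icc] at ha ⊢
        omega
      · intros; positivity
    have h3 := hK2 Y
    calc _ ≤ K * Y * (1 + Real.log T) ^ (K + 1) * (1 + Real.log T) +
          K * Y * (s * (1 + Real.log Y) ^ (K + 1)) * (K2 * (1 + Real.log Y) ^ K2) := by gcongr
      _ = _ := by rw [pow_succ (n := K + 1)]; ring
  -- large `a`
  have h2 : |∑ b ∈ Icc 1 Y, ∑ a ∈ Icc 1 (Y / b), (if a ≤ T then 0 else G a b)| ≤
      4 * Y * (s * (1 + Real.log Y) ^ 2) * (K3 * (1 + Real.log Y) ^ K3) := by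
    have hterm : ∀ b ∈ Icc 1 Y, |∑ a ∈ Icc 1 (Y / b), (if a ≤ T then 0 else G a b)| ≤
        4 * Y * (s * (1 + Real.log Y) ^ 2) * (hw (2 * |κ|) b / b) := by
      intro b hb
      rw [Finset.mem_Icc] at hb
      have hb0 : (0 : ℝ) < b := by exact_mod_cast hb.1
      have hrest : 0 ≤ 4 * Y * (s * (1 + Real.log Y) ^ 2) * (hw (2 * |κ|) b / b) :=
        mul_nonneg (by positivity) (div_nonneg (hw_nonneg (by positivity) b) hb0.le)
      by_cases hbig : T < Y / b
      swap
      · rw [Finset.sum_eq_zero]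
        · simpa using hrest
        · intro a ha
          rw [if_pos (by have := (Finset.mem_Icc.1 ha).2; omega)]
      have hc := hχ.coprime (n := b) (by omega)
      set χ' : ℕ → ℝ := fun a => if a.Coprime b then χ a else 0 with hχ'
      have e3 : ∑ a ∈ Icc 1 (Y / b), (if a ≤ T then 0 else G a b) = (χ b * hw κ b) *
          (∑ a ∈ Icc 1 (Y / b), χ' a * (α a * hw 1 a) - ∑ a ∈ Icc 1 T, χ' a * (α a * hw 1 a)) := by
        have : ∑ a ∈ Icc 1 T, χ' a * (α a * hw 1 a) =
            ∑ a ∈ Icc 1 (Y / b), if a ≤ T then χ' a * (α a * hw 1 a) else 0 := by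
          rw [← Finset.sum_filter]
          refine Finset.sum_congr ?_ fun _ _ => rfl
          ext a
          simp only [Finset.mem_filter, Finset.mem_Icc]
          omega
        rw [this, ← Finset.sum_sub_distrib, Finset.mul_sum]
        refine Finset.sum_congr rfl fun a _ => ?_
        simp only [hG, hχ']
        split_ifs <;> ring
      rw [e3, abs_mul]
      by_cases hsq : Squarefree b
      swap
      · rw [hw_of_not_squarefree hsq]; simpa using hrest
      have hYb : ((Y / b : ℕ) : ℝ) ≤ Y / b := Nat.cast_div_le
      have hx0 : (0 : ℝ) < (Y / b : ℕ) := by exact_mod_cast (by omega : 0 < Y / b)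
      have hlogYb : Real.log (Y / b : ℕ) ≤ Real.log Y :=
        Real.log_le_log hx0 (by exact_mod_cast Nat.div_le_self Y b)
      have hTx : (T : ℝ) ≤ (Y / b : ℕ) := by exact_mod_cast hbig.le
      have hlogT : Real.log T ≤ Real.log Y := (Real.log_le_log hT0 hTx).trans hlogYb
      have hroot : √(2 ^ b.primeFactors.card * q * (Y / b : ℕ)) ≤
          2 ^ b.primeFactors.card * s * (Y / b) := by
        have h3 : q * (Y / b : ℕ) ≤ q / T * ((Y / b : ℕ) : ℝ) ^ 2 := by
          rw [div_mul_eq_mul_div, le_div_iff₀ hT0]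
          calc q * ((Y / b : ℕ) : ℝ) * T ≤ q * ((Y / b : ℕ) : ℝ) * (Y / b : ℕ) := by gcongr
            _ = _ := by ring
        rw [mul_assoc, Real.sqrt_mul (by positivity)]
        rw [mul_assoc]
        refine mul_le_mul (hsqrt _) ?_ (Real.sqrt_nonneg _) (by positivity)
        refine (Real.sqrt_le_sqrt h3).trans ?_
        rw [Real.sqrt_mul (by positivity), Real.sqrt_sq hx0.le]
        gcongr
      have b1 : |∑ a ∈ Icc 1 (Y / b), χ' a * (α a * hw 1 a)| ≤
          2 * (2 ^ b.primeFactors.card * s * (Y / b)) * (1 + Real.log Y) ^ 2 := by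
        refine (hαs _ _ hc _).trans ?_
        have := Real.log_natCast_nonneg (Y / b)
        gcongr
      have b2 : |∑ a ∈ Icc 1 T, χ' a * (α a * hw 1 a)| ≤
          2 * (2 ^ b.primeFactors.card * s * (Y / b)) * (1 + Real.log Y) ^ 2 := by
        refine (hαs _ _ hc _).trans ?_
        have h5 : √(2 ^ b.primeFactors.card * q * T) ≤ √(2 ^ b.primeFactors.card * q * (Y / b : ℕ)) :=
          by apply Real.sqrt_le_sqrt; gcongr
        have h6 := h5.trans hroot
        gcongr
      have b3 : |χ b * hw κ b| ≤ |κ| ^ b.primeFactors.card := by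
        rw [abs_mul, abs_hw, hw_of_squarefree hsq]
        calc _ ≤ 1 * |κ| ^ b.primeFactors.card := by gcongr; exact hχ.abs_le b
          _ = _ := one_mul _
      rw [hw_of_squarefree (κ := 2 * |κ|) hsq, mul_pow]
      calc _ ≤ |κ| ^ b.primeFactors.card * (2 * (2 ^ b.primeFactors.card * s * (Y / b)) *
            (1 + Real.log Y) ^ 2 + 2 * (2 ^ b.primeFactors.card * s * (Y / b)) *
            (1 + Real.log Y) ^ 2) :=
            mul_le_mul b3 ((abs_sub _ _).trans (add_le_add b1 b2)) (abs_nonneg _) (by positivity)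
        _ = _ := by ring
    refine (Finset.abs_sum_le_sum_abs _ _).trans ((Finset.sum_le_sum hterm).trans ?_)
    rw [← Finset.mul_sum]
    have := hK3 Y
    gcongr
  rw [e1, e2]
  refine (abs_add_le _ _).trans ((add_le_add h1 h2).trans ?_)
  have p1 : (1 + Real.log T) ^ (K + 2) ≤ (1 + Real.log T) ^ K' :=
    pow_le_pow_right₀ hLT (by omega)
  have p2 : (1 + Real.log Y) ^ (K + 1 + K2) ≤ (1 + Real.log Y) ^ K' :=
    pow_le_pow_right₀ hLY (by nlinarith [Nat.zero_le (K * K2)])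
  have p3 : (1 + Real.log Y) ^ (2 + K3) ≤ (1 + Real.log Y) ^ K' :=
    pow_le_pow_right₀ hLY (by nlinarith [Nat.zero_le (K * K2)])
  have c1 : (K : ℝ) ≤ K' := by
    exact_mod_cast (by nlinarith [Nat.zero_le (K * K2)] : K ≤ K')
  have c2 : (K : ℝ) * K2 + 4 * K3 ≤ K' := by
    exact_mod_cast (by omega : K * K2 + 4 * K3 ≤ K')
  calc _ = K * Y * (1 + Real.log T) ^ (K + 2) + (K * K2) * Y * (s * (1 + Real.log Y) ^ (K + 1 + K2))
        + (4 * K3) * Y * (s * (1 + Real.log Y) ^ (2 + K3)) := by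
        rw [pow_add _ (K + 1) K2, pow_add _ 2 K3]; ring
    _ ≤ K' * Y * (1 + Real.log T) ^ K' + (K * K2) * Y * (s * (1 + Real.log Y) ^ K')
        + (4 * K3) * Y * (s * (1 + Real.log Y) ^ K') := by gcongr
    _ = K' * Y * (1 + Real.log T) ^ K' + (K * K2 + 4 * K3) * Y * (s * (1 + Real.log Y) ^ K') := by
        ring
    _ ≤ K' * Y * (1 + Real.log T) ^ K' + K' * Y * (s * (1 + Real.log Y) ^ K') := by gcongr
    _ = _ := by ring

lemma CharBound.mono {f : ℕ → ℝ} {K K' : ℕ} (h : CharBound f K) (hK : K ≤ K') : CharBound f K' := by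
  intro q χ hχ T Y hT
  refine (h q χ hχ T Y hT).trans ?_
  have h1 : 1 ≤ 1 + Real.log T := by linarith [Real.log_natCast_nonneg T]
  have h2 : 1 ≤ 1 + Real.log Y := by linarith [Real.log_natCast_nonneg Y]
  gcongr

lemma charBound_hw {κ : ℝ} (hκ : -1 ≤ κ) : ∃ K, CharBound (hw κ) K := by
  obtain ⟨n, hn⟩ := exists_nat_ge (κ - 1)
  induction n generalizing κ with
  | zero =>
    refine ⟨1, charBound_hw_of_abs_le_one (abs_le.2 ⟨hκ, ?_⟩)⟩
    push_cast at hn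
    linarith
  | succ n ih =>
    by_cases h1 : κ ≤ 1
    · exact ⟨1, charBound_hw_of_abs_le_one (abs_le.2 ⟨hκ, h1⟩)⟩
    push_cast at hn
    obtain ⟨K, hK⟩ := ih (κ := κ - 1) (by linarith) (by linarith)
    have e : hw κ = sqfConv (fun _ => 1) (κ - 1) := by
      funext m
      rw [sqfConv_one, sub_add_cancel]
    rw [e]
    refine charBound_sqfConv (fun a _ => ⟨zero_le_one, ?_⟩) (fun q χ hχ x => ?_) hK
    · linarith [Real.log_natCast_nonneg a]
    · simp only [one_mul]
      refine (hχ.sum_sqf_le x).trans ?_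
      have h2 := Real.log_natCast_nonneg x
      have h3 := Real.sqrt_nonneg (q * x)
      rw [mul_comm 2, mul_assoc]
      gcongr
      nlinarith

lemma charBound_hw_mul_log {c : ℝ} (hc : 0 ≤ c) :
    ∃ K, CharBound (fun m => hw c m * Real.log m) K := by
  obtain ⟨K, hK⟩ := charBound_hw (κ := c - 1) (by linarith)
  have hα : ∀ a : ℕ, 1 ≤ a → 0 ≤ Real.log a ∧ Real.log a ≤ 1 + Real.log a := fun a _ =>
    ⟨Real.log_natCast_nonneg a, by linarith⟩
  obtain ⟨K', hK'⟩ := charBound_sqfConv (α := fun a => Real.log a) hα (fun q χ hχ x => by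
    have h1 := abs_sum_mul_log_le (fun a => χ a * hw 1 a) x (√(q * x) * (1 + Real.log x))
      (fun j hj => by
        refine (hχ.sum_sqf_le j).trans ?_
        have hq := hχ.nonneg
        rcases Nat.eq_zero_or_pos j with rfl | hj0
        · simp
          have := Real.log_natCast_nonneg x
          positivity
        have : Real.log j ≤ Real.log x :=
          Real.log_le_log (by exact_mod_cast hj0) (by exact_mod_cast hj)
        have := Real.log_natCast_nonneg j
        gcongr)
    have h2 := Real.log_natCast_nonneg x
    have h3 := Real.sqrt_nonneg (q * x)
    have e : ∑ a ∈ Icc 1 x, χ a * (Real.log a * hw 1 a) =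
        ∑ a ∈ Icc 1 x, χ a * hw 1 a * Real.log a :=
      Finset.sum_congr rfl fun a _ => by ring
    rw [e]
    refine h1.trans ?_
    rw [← mul_assoc, mul_assoc (2 * √(q * x))]
    gcongr
    nlinarith) hK
  refine ⟨⌈c⌉₊ * K' + K', fun q χ hχ T Y hT => ?_⟩
  have h1 : 1 ≤ 1 + Real.log T := by linarith [Real.log_natCast_nonneg T]
  have h2 : 1 ≤ 1 + Real.log Y := by linarith [Real.log_natCast_nonneg Y]
  have e : ∑ m ∈ Icc 1 Y, χ m * (hw c m * Real.log m) =
      c * ∑ m ∈ Icc 1 Y, χ m * sqfConv (fun a => Real.log a) (c - 1) m := by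
    rw [Finset.mul_sum]
    refine Finset.sum_congr rfl fun m _ => ?_
    rw [← sqfConv_log]
    ring
  rw [e, abs_mul, abs_of_nonneg hc]
  have h3 : c * K' ≤ ((⌈c⌉₊ * K' + K' : ℕ) : ℝ) := by
    push_cast
    have := Nat.le_ceil c
    have h4 : (0 : ℝ) ≤ K' := by positivity
    nlinarith
  calc _ ≤ c * (K' * Y * ((1 + Real.log T) ^ K' + √(q / T) * (1 + Real.log Y) ^ K')) := by
        gcongr
        exact hK' q χ hχ T Y hT
    _ = c * K' * Y * ((1 + Real.log T) ^ K' + √(q / T) * (1 + Real.log Y) ^ K') := by ring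
    _ ≤ _ := by
        gcongr
        · omega
        · omega

/-- A Siegel–Walfisz type bound: sums of `χ(m) c ^ ω(m)` save a full logarithm, up to powers of
`log T`, provided that `T` is large compared with the bound `q` for the sums of `χ`. -/
lemma charSum_hw_le {c : ℝ} (hc : 0 ≤ c) :
    ∃ K : ℕ, ∀ (q : ℝ) (χ : ℕ → ℝ), IsChar q χ → ∀ T Y : ℕ, 1 ≤ T →
      |∑ m ∈ Icc 1 Y, χ m * hw c m| ≤
        K * (Y / (1 + Real.log Y)) * ((1 + Real.log T) ^ K + √(q / T) * (1 + Real.log Y) ^ K) := by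
  obtain ⟨K1, hK1⟩ := charBound_hw (κ := c) (by linarith)
  obtain ⟨K2, hK2⟩ := charBound_hw_mul_log hc
  obtain ⟨K, hK⟩ : ∃ K, K = K1 + K2 := ⟨_, rfl⟩
  replace hK1 := hK1.mono (by omega : K1 ≤ K)
  replace hK2 := hK2.mono (by omega : K2 ≤ K)
  refine ⟨3 * K, fun q χ hχ T Y hT => ?_⟩
  have h1 : 1 ≤ 1 + Real.log T := by linarith [Real.log_natCast_nonneg T]
  have h2 : 1 ≤ 1 + Real.log Y := by linarith [Real.log_natCast_nonneg Y]
  set s := √(q / T) with hs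
  have hs0 : 0 ≤ s := Real.sqrt_nonneg _
  set S : ℕ → ℝ := fun j => ∑ m ∈ Icc 1 j, χ m * hw c m with hS
  set E := (1 + Real.log T) ^ K + s * (1 + Real.log Y) ^ K with hE
  have hE0 : 0 ≤ E := by positivity
  have hSj : ∀ j ≤ Y, |S j| ≤ K * j * E := by
    intro j hj
    rcases Nat.eq_zero_or_pos j with rfl | hj0
    · simp [hS]
    have : Real.log j ≤ Real.log Y :=
      Real.log_le_log (by exact_mod_cast hj0) (by exact_mod_cast hj)
    have := Real.log_natCast_nonneg j
    refine (hK1 q χ hχ T j hT).trans ?_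
    rw [hE, ← hs]
    gcongr
  have hid : S Y * (1 + Real.log Y) = S Y + ∑ m ∈ Icc 1 Y, χ m * (hw c m * Real.log m) +
      ∑ j ∈ Icc 1 (Y - 1), S j * (Real.log (j + 1 : ℕ) - Real.log j) := by
    rw [← sum_mul_log_sub, hS]
    simp only [mul_add, mul_one, mul_sub, Finset.sum_sub_distrib, ← Finset.sum_mul]
    have : ∑ m ∈ Icc 1 Y, χ m * (hw c m * Real.log m) =
        ∑ m ∈ Icc 1 Y, χ m * hw c m * Real.log m :=
      Finset.sum_congr rfl fun a _ => by ring
    rw [this]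
    ring
  have hrest : |∑ j ∈ Icc 1 (Y - 1), S j * (Real.log (j + 1 : ℕ) - Real.log j)| ≤ K * Y * E := by
    refine (Finset.abs_sum_le_sum_abs _ _).trans ?_
    calc _ ≤ ∑ j ∈ Icc 1 (Y - 1), K * E := by
          refine Finset.sum_le_sum fun j hj => ?_
          rw [Finset.mem_Icc] at hj
          have hj0 : (0 : ℝ) < j := by exact_mod_cast hj.1
          have hd0 : 0 ≤ Real.log (j + 1 : ℕ) - Real.log j :=
            sub_nonneg.2 (Real.log_le_log hj0 (by push_cast; linarith))
          have hd1 : Real.log (j + 1 : ℕ) - Real.log j ≤ 1 / j := by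
            rw [← Real.log_div (by positivity) hj0.ne']
            refine (Real.log_le_sub_one_of_pos (by positivity)).trans ?_
            push_cast
            rw [add_div, div_self hj0.ne']
            linarith
          rw [abs_mul, abs_of_nonneg hd0]
          calc _ ≤ K * j * E * (1 / j) := by
                gcongr
                exact hSj j (by omega)
            _ = K * E := by field_simp
      _ = ((Y - 1 : ℕ) : ℝ) * (K * E) := by simp
      _ ≤ Y * (K * E) := by
          gcongr
          omega
      _ = _ := by ring
  have hmain : |S Y| * (1 + Real.log Y) ≤ 3 * (K * Y * E) := by
    rw [← abs_of_pos (by linarith : 0 < 1 + Real.log Y), ← abs_mul, hid]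
    refine (abs_add_le _ _).trans ((add_le_add ((abs_add_le _ _).trans
      (add_le_add (hSj Y le_rfl) (hK2 q χ hχ T Y hT))) hrest).trans ?_)
    apply le_of_eq
    rw [hE]
    ring
  rw [← le_div_iff₀ (by linarith)] at hmain
  refine hmain.trans ?_
  have hE' : E ≤ (1 + Real.log T) ^ (3 * K) + s * (1 + Real.log Y) ^ (3 * K) := by
    rw [hE]
    gcongr <;> first | exact h1 | exact h2 | omega
  calc _ = (3 * K : ℕ) * (Y / (1 + Real.log Y)) * E := by push_cast; ring
    _ ≤ _ := by gcongr

/-! ### Characters -/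

lemma abs_sum_range_le_of_periodic {q : ℕ} (hq : 0 < q) {f : ℕ → ℝ} (habs : ∀ a, |f a| ≤ 1)
    (hper : ∀ a, f (a + q) = f a) (hsum : ∑ a ∈ Finset.range q, f a = 0) (x : ℕ) :
    |∑ a ∈ Finset.range x, f a| ≤ q := by
  induction x using Nat.strong_induction_on with
  | _ x ih =>
    by_cases hx : x ≤ q
    · refine (Finset.abs_sum_le_sum_abs _ _).trans ((Finset.sum_le_sum fun a _ => habs a).trans ?_)
      simpa using hx
    · obtain ⟨y, rfl⟩ : ∃ y, x = q + y := ⟨x - q, by omega⟩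
      rw [Finset.sum_range_add, hsum, zero_add]
      simp only [add_comm q, hper]
      exact ih y (by omega)

lemma isChar_of_periodic {q : ℕ} (hq : 0 < q) {χ : ℕ → ℝ} (hmul : ∀ a b, χ (a * b) = χ a * χ b)
    (habs : ∀ a, |χ a| ≤ 1) (hper : ∀ a, χ (a + q) = χ a) {b : ℕ} (hb : b.Coprime q)
    (hχb : χ b = -1) : IsChar q χ := by
  refine ⟨hmul, habs, fun x => ?_⟩
  have : NeZero q := ⟨hq.ne'⟩
  have hmod : ∀ a, χ (a % q) = χ a := fun a => by
    have h1 : ∀ k r, χ (r + q * k) = χ r := fun k r => by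
      induction k with
      | zero => simp
      | succ k ih => rw [Nat.mul_succ, ← add_assoc, hper, ih]
    conv_rhs => rw [← Nat.mod_add_div a q, h1]
  have h0 : ∑ a ∈ Finset.range q, χ a = 0 := by
    have e1 : ∑ a ∈ Finset.range q, χ a = ∑ z : ZMod q, χ z.val := by
      symm
      refine Finset.sum_bij' (fun z _ => z.val) (fun a _ => (a : ZMod q)) ?_ ?_ ?_ ?_ ?_
      · intro z _; exact Finset.mem_range.2 (ZMod.val_lt z)
      · intro a _; exact Finset.mem_univ _
      · intro z _; exact ZMod.natCast_zmod_val z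
      · intro a ha; exact ZMod.val_cast_of_lt (Finset.mem_range.1 ha)
      · intro z _; rfl
    have e2 : ∑ z : ZMod q, χ z.val = ∑ z : ZMod q, χ b * χ z.val := by
      rw [← Equiv.sum_comp (Units.mulLeft (ZMod.unitOfCoprime b hb))]
      refine Finset.sum_congr rfl fun z _ => ?_
      rw [← hmul, ← hmod (b * z.val), Units.mulLeft_apply, ZMod.coe_unitOfCoprime, ZMod.val_mul,
        ZMod.val_natCast, Nat.mod_mul_mod]
    rw [e1]
    rw [← Finset.mul_sum, hχb] at e2
    linarith
  have h1 : ∑ a ∈ Icc 1 x, χ a = ∑ a ∈ Finset.range x, χ (a + 1) := by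
    rw [Finset.range_eq_Ico, Finset.sum_Ico_add' χ 0 x 1]
    rfl
  rw [h1]
  refine abs_sum_range_le_of_periodic hq (fun a => habs _) (fun a => ?_) ?_ x
  · rw [add_right_comm, hper]
  · have h2 := Finset.sum_range_succ χ q
    rw [Finset.sum_range_succ' χ q, ← zero_add q, hper 0, zero_add] at h2
    linarith

/-- The real Jacobi symbol `(a / n)` of natural numbers. -/
def jr (a n : ℕ) : ℝ := (jacobiSym a n : ℤ)

/-- The real-valued character modulo `4`. -/
def chi4 (a : ℕ) : ℝ := (ZMod.χ₄ a : ℤ)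

lemma jr_mul_left (a b n : ℕ) : jr (a * b) n = jr a n * jr b n := by
  unfold jr; push_cast; rw [jacobiSym.mul_left]; push_cast; rfl

lemma jr_mul_right (a : ℕ) {m n : ℕ} (hm : m ≠ 0) (hn : n ≠ 0) :
    jr a (m * n) = jr a m * jr a n := by
  have : NeZero m := ⟨hm⟩
  have : NeZero n := ⟨hn⟩
  unfold jr; rw [jacobiSym.mul_right]; push_cast; rfl

lemma jr_trichotomy (a n : ℕ) : jr a n = 0 ∨ jr a n = 1 ∨ jr a n = -1 := by
  unfold jr
  rcases jacobiSym.trichotomy a n with h | h | h <;> simp [h]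

lemma abs_jr_le (a n : ℕ) : |jr a n| ≤ 1 := by
  rcases jr_trichotomy a n with h | h | h <;> simp [h]

lemma jr_one_left (n : ℕ) : jr 1 n = 1 := by
  simp [jr, jacobiSym.one_left]

lemma jr_one_right (a : ℕ) : jr a 1 = 1 := by
  simp [jr, jacobiSym.one_right]

lemma jr_eq_zero_iff {a n : ℕ} (hn : n ≠ 0) : jr a n = 0 ↔ ¬ a.Coprime n := by
  have : NeZero n := ⟨hn⟩
  unfold jr
  rw [Int.cast_eq_zero, jacobiSym.eq_zero_iff_not_coprime, Int.gcd_natCast_natCast]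

lemma jr_sq {a n : ℕ} (hn : n ≠ 0) (h : a.Coprime n) : jr a n ^ 2 = 1 := by
  have h1 := (jr_eq_zero_iff (a := a) hn).not.2 (not_not.2 h)
  rcases jr_trichotomy a n with h | h | h
  · exact absurd h h1
  · rw [h]; norm_num
  · rw [h]; norm_num

lemma jr_reciprocity {a n : ℕ} (ha : Odd a) (hn : Odd n) :
    jr a n = (-1) ^ (a / 2 * (n / 2)) * jr n a := by
  unfold jr
  rw [jacobiSym.quadratic_reciprocity ha hn]
  push_cast
  rfl

lemma jr_add_mul (a n k : ℕ) : jr (a + n * k) n = jr a n := by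
  unfold jr
  rw [jacobiSym.mod_left, jacobiSym.mod_left (a : ℤ)]
  push_cast
  rw [Int.add_mul_emod_self_left]

lemma chi4_mul (a b : ℕ) : chi4 (a * b) = chi4 a * chi4 b := by
  unfold chi4; push_cast; rw [map_mul]; push_cast; rfl

lemma chi4_eq (a : ℕ) : chi4 a = if a % 2 = 0 then 0 else if a % 4 = 1 then 1 else -1 := by
  unfold chi4
  rw [ZMod.χ₄_nat_eq_if_mod_four]
  split_ifs <;> simp

lemma abs_chi4_le (a : ℕ) : |chi4 a| ≤ 1 := by
  rw [chi4_eq]; split_ifs <;> simp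

lemma chi4_add_four (a : ℕ) : chi4 (a + 4) = chi4 a := by
  simp only [chi4_eq]
  have h1 : (a + 4) % 2 = a % 2 := by omega
  have h2 : (a + 4) % 4 = a % 4 := by omega
  rw [h1, h2]

lemma isChar_chi4 : IsChar 4 chi4 := by
  have := isChar_of_periodic (q := 4) (by norm_num) (χ := chi4) chi4_mul abs_chi4_le
    chi4_add_four (b := 3) (by norm_num) (by rw [chi4_eq]; norm_num)
  simpa using this

/-- A multiplicative twist modulo `4`. -/
structure IsTwist (ψ : ℕ → ℝ) : Prop where
  map_mul : ∀ a b, ψ (a * b) = ψ a * ψ b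
  abs_le : ∀ a, |ψ a| ≤ 1
  add_four : ∀ a, ψ (a + 4) = ψ a
  map_one : ψ 1 = 1

lemma IsTwist.eq_of_mod {ψ : ℕ → ℝ} (h : IsTwist ψ) (a : ℕ) : ψ a = ψ (a % 4) := by
  have h1 : ∀ k r, ψ (r + 4 * k) = ψ r := fun k r => by
    induction k with
    | zero => simp
    | succ k ih => rw [Nat.mul_succ, ← add_assoc, h.add_four, ih]
  conv_lhs => rw [← Nat.mod_add_div a 4, h1]

lemma isTwist_one : IsTwist fun _ => 1 := ⟨by simp, by simp, by simp, rfl⟩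

lemma isTwist_chi4 : IsTwist chi4 :=
  ⟨chi4_mul, abs_chi4_le, chi4_add_four, by rw [chi4_eq]; norm_num⟩

lemma isTwist_chi4_sq : IsTwist fun a => chi4 a ^ 2 := by
  refine ⟨fun a b => by rw [chi4_mul, mul_pow], fun a => ?_, fun a => by rw [chi4_add_four], ?_⟩
  · rw [abs_pow]; exact pow_le_one₀ (abs_nonneg _) (abs_chi4_le a)
  · rw [chi4_eq]; norm_num

lemma exists_jr_eq_neg_one {p m : ℕ} (hp : p.Prime) (hn : Odd (p * m)) (hpm : ¬ p ∣ m) :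
    ∃ b, b % 4 = 1 ∧ b.Coprime (p * m) ∧ jr b (p * m) = -1 := by
  have hpo : Odd p := (Nat.odd_mul.1 hn).1
  have hmo : Odd m := (Nat.odd_mul.1 hn).2
  have hp2 : p ≠ 2 := by rintro rfl; revert hpo; decide
  have : Fact p.Prime := ⟨hp⟩
  obtain ⟨r, hr⟩ := FiniteField.exists_nonsquare (F := ZMod p) (by rwa [ZMod.ringChar_zmod_n])
  have hc : p.Coprime (4 * m) := by
    refine Nat.Coprime.mul_right ?_ ((Nat.Prime.coprime_iff_not_dvd hp).2 hpm)
    exact Nat.Coprime.pow_right 2 (Nat.coprime_two_right.2 hpo)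
  obtain ⟨b, hb1, hb2⟩ := Nat.chineseRemainder hc r.val 1
  have hm0 : m ≠ 0 := by rintro rfl; simp at hmo
  have hbm : b ≡ 1 [MOD m] := hb2.of_mul_left 4
  have hb4 : b ≡ 1 [MOD 4] := hb2.of_mul_right m
  have h1 : jr b p = -1 := by
    unfold jr
    rw [← jacobiSym.legendreSym.to_jacobiSym, (legendreSym.eq_neg_one_iff p).2]
    · norm_num
    · have : ((b : ℤ) : ZMod p) = r := by
        rw [Int.cast_natCast, (ZMod.natCast_eq_natCast_iff _ _ _).2 hb1, ZMod.natCast_zmod_val]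
      rwa [this]
  have h2 : jr b m = 1 := by
    have e : jacobiSym (b : ℤ) m = 1 := by
      rw [jacobiSym.mod_left, (Int.natCast_mod b m).symm, hbm, Int.natCast_mod,
        ← jacobiSym.mod_left]
      simp [jacobiSym.one_left]
    rw [jr, e]; simp
  have h3 : jr b (p * m) = -1 := by
    rw [jr_mul_right b hp.ne_zero hm0, h1, h2]; norm_num
  refine ⟨b, hb4, ?_, h3⟩
  by_contra hcop
  rw [← jr_eq_zero_iff (mul_ne_zero hp.ne_zero hm0), h3] at hcop
  norm_num at hcop

lemma isChar_jr_mul {ψ : ℕ → ℝ} (hψ : IsTwist ψ) {p m : ℕ} (hp : p.Prime) (hn : Odd (p * m))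
    (hpm : ¬ p ∣ m) : IsChar (4 * (p * m : ℕ)) (fun a => jr a (p * m) * ψ a) := by
  obtain ⟨b, hb4, hbc, hb⟩ := exists_jr_eq_neg_one hp hn hpm
  have := isChar_of_periodic (q := 4 * (p * m)) (χ := fun a => jr a (p * m) * ψ a) ?_ ?_ ?_ ?_
    (b := b) ?_ ?_
  · simpa only [Nat.cast_mul, Nat.cast_ofNat] using this
  · have := hn.pos
    omega
  · intro a c
    rw [jr_mul_left, hψ.map_mul]; ring
  · intro a
    rw [abs_mul]
    exact mul_le_one₀ (abs_jr_le _ _) (abs_nonneg _) (hψ.abs_le a)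
  · intro a
    have h1 : jr (a + 4 * (p * m)) (p * m) = jr a (p * m) := by
      rw [mul_comm 4, jr_add_mul]
    have h2 : ψ (a + 4 * (p * m)) = ψ a := by
      rw [hψ.eq_of_mod, hψ.eq_of_mod a, Nat.add_mul_mod_self_left]
    rw [h1, h2]
  · refine Nat.Coprime.mul_right ?_ hbc
    have : Odd b := Nat.odd_iff.2 (by omega)
    exact Nat.Coprime.pow_right 2 (Nat.coprime_two_right.2 this)
  · rw [hb, hψ.eq_of_mod, hb4, hψ.map_one]; norm_num

/-! ### Divisor moments and a bilinear estimate on boxes -/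

lemma one_le_card_divisors {n : ℕ} (hn : n ≠ 0) : (1 : ℝ) ≤ n.divisors.card := by
  exact_mod_cast Finset.card_pos.2 (Nat.nonempty_divisors.2 hn)

lemma card_divisors_mul_le (a b : ℕ) :
    ((a * b).divisors.card : ℝ) ≤ a.divisors.card * b.divisors.card := by
  rw [Nat.divisors_mul]
  exact_mod_cast Finset.card_mul_le

lemma card_divisors_le_of_dvd {a b : ℕ} (hb : b ≠ 0) (h : a ∣ b) :
    (a.divisors.card : ℝ) ≤ b.divisors.card := by
  exact_mod_cast Finset.card_le_card (Nat.divisors_subset_of_dvd hb h)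

lemma sum_card_divisors_pow_succ_le (K x : ℕ) (w : ℕ → ℝ) (hw : ∀ n, 0 ≤ w n) :
    ∑ n ∈ Icc 1 x, w n * (n.divisors.card : ℝ) ^ (K + 1) ≤
      ∑ d ∈ Icc 1 x, ∑ e ∈ Icc 1 (x / d), w (d * e) *
        ((d.divisors.card : ℝ) ^ K * (e.divisors.card : ℝ) ^ K) := by
  rw [← sum_divisorsAntidiagonal_Icc x
    (fun d e => w (d * e) * ((d.divisors.card : ℝ) ^ K * (e.divisors.card : ℝ) ^ K))]
  refine Finset.sum_le_sum fun n _ => ?_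
  have e1 : w n * (n.divisors.card : ℝ) ^ (K + 1) =
      ∑ y ∈ n.divisorsAntidiagonal, w n * (n.divisors.card : ℝ) ^ K := by
    rw [Finset.sum_const, nsmul_eq_mul, ← Nat.map_div_right_divisors, Finset.card_map]
    ring
  rw [e1]
  refine Finset.sum_le_sum fun y hy => ?_
  rw [(Nat.mem_divisorsAntidiagonal.1 hy).1, ← mul_pow]
  refine mul_le_mul_of_nonneg_left (pow_le_pow_left₀ (by positivity) ?_ K) (hw n)
  rw [← (Nat.mem_divisorsAntidiagonal.1 hy).1]
  exact card_divisors_mul_le _ _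

lemma one_add_log_mono {a b : ℕ} (h : a ≤ b) : 1 + Real.log a ≤ 1 + Real.log b := by
  rcases Nat.eq_zero_or_pos a with rfl | ha
  · simpa using Real.log_natCast_nonneg b
  · have := Real.log_le_log (by exact_mod_cast ha : (0 : ℝ) < a)
      (by exact_mod_cast h : (a : ℝ) ≤ b)
    linarith

lemma one_le_one_add_log (a : ℕ) : 1 ≤ 1 + Real.log a := by
  linarith [Real.log_natCast_nonneg a]

lemma sum_card_divisors_pow_div_le (K x : ℕ) :
    ∑ n ∈ Icc 1 x, (n.divisors.card : ℝ) ^ K / n ≤ (1 + Real.log x) ^ 2 ^ K := by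
  induction K generalizing x with
  | zero => simpa using sum_Icc_inv_le x
  | succ K ih =>
    have h1 := sum_card_divisors_pow_succ_le K x (fun n => (n : ℝ)⁻¹) (fun n => by positivity)
    have hL := one_le_one_add_log x
    calc _ = ∑ n ∈ Icc 1 x, (n : ℝ)⁻¹ * (n.divisors.card : ℝ) ^ (K + 1) :=
          Finset.sum_congr rfl fun n _ => by ring
      _ ≤ _ := h1
      _ = ∑ d ∈ Icc 1 x, (d.divisors.card : ℝ) ^ K / d *
            ∑ e ∈ Icc 1 (x / d), (e.divisors.card : ℝ) ^ K / e := by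
          refine Finset.sum_congr rfl fun d _ => ?_
          rw [Finset.mul_sum]
          refine Finset.sum_congr rfl fun e _ => ?_
          push_cast
          rw [mul_inv]
          ring
      _ ≤ ∑ d ∈ Icc 1 x, (d.divisors.card : ℝ) ^ K / d * (1 + Real.log x) ^ 2 ^ K := by
          refine Finset.sum_le_sum fun d _ => ?_
          refine mul_le_mul_of_nonneg_left ((ih (x / d)).trans ?_) (by positivity)
          exact pow_le_pow_left₀ (by linarith [one_le_one_add_log (x / d)])
            (one_add_log_mono (Nat.div_le_self x d)) _
      _ ≤ (1 + Real.log x) ^ 2 ^ K * (1 + Real.log x) ^ 2 ^ K := by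
          rw [← Finset.sum_mul]
          gcongr
          exact ih x
      _ = _ := by rw [← pow_add, pow_succ 2 K, mul_two]

lemma sum_card_divisors_pow_le (K x : ℕ) :
    ∑ n ∈ Icc 1 x, (n.divisors.card : ℝ) ^ K ≤ x * (1 + Real.log x) ^ 2 ^ K := by
  induction K generalizing x with
  | zero =>
    have := one_le_one_add_log x
    simp only [pow_zero, pow_one, Finset.sum_const, Nat.card_Icc, nsmul_eq_mul, mul_one,
      Nat.add_sub_cancel]
    exact le_mul_of_one_le_right (by positivity) this
  | succ K ih =>
    have h1 := sum_card_divisors_pow_succ_le K x (fun n => 1) (fun n => by positivity)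
    have hL := one_le_one_add_log x
    simp only [one_mul] at h1
    calc _ ≤ _ := h1
      _ = ∑ d ∈ Icc 1 x, (d.divisors.card : ℝ) ^ K *
            ∑ e ∈ Icc 1 (x / d), (e.divisors.card : ℝ) ^ K := by
          simp only [Finset.mul_sum]
      _ ≤ ∑ d ∈ Icc 1 x, (d.divisors.card : ℝ) ^ K / d * (x * (1 + Real.log x) ^ 2 ^ K) := by
          refine Finset.sum_le_sum fun d _ => ?_
          have h2 : ((x / d : ℕ) : ℝ) ≤ x / d := Nat.cast_div_le
          have h3 := one_le_one_add_log (x / d)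
          have h4 := one_add_log_mono (Nat.div_le_self x d)
          calc _ ≤ (d.divisors.card : ℝ) ^ K * (x / d * (1 + Real.log x) ^ 2 ^ K) := by
                refine mul_le_mul_of_nonneg_left ((ih (x / d)).trans ?_) (by positivity)
                gcongr
            _ = _ := by ring
      _ ≤ (1 + Real.log x) ^ 2 ^ K * (x * (1 + Real.log x) ^ 2 ^ K) := by
          rw [← Finset.sum_mul]
          gcongr
          exact sum_card_divisors_pow_div_le K x
      _ = _ := by rw [pow_succ 2 K, mul_two, pow_add]; ring

lemma exists_hw_le_card_divisors_pow (c : ℝ) :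
    ∃ K : ℕ, ∀ n : ℕ, 1 ≤ n → hw c n ≤ (n.divisors.card : ℝ) ^ K := by
  obtain ⟨K, hK⟩ := pow_unbounded_of_one_lt |c| (one_lt_two : (1 : ℝ) < 2)
  refine ⟨K, fun n hn => ?_⟩
  have h1 := one_le_card_divisors (by omega : n ≠ 0)
  by_cases hsq : Squarefree n
  · have h2 : (2 : ℝ) ^ n.primeFactors.card ≤ n.divisors.card := by
      rw [Nat.card_divisors (by omega)]
      have : 2 ^ n.primeFactors.card ≤ ∏ p ∈ n.primeFactors, (n.factorization p + 1) := by
        refine Finset.pow_card_le_prod _ _ _ fun p hp => ?_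
        have := (Nat.prime_of_mem_primeFactors hp).factorization_pos_of_dvd (by omega)
          (Nat.dvd_of_mem_primeFactors hp)
        omega
      exact_mod_cast this
    rw [hw_of_squarefree hsq]
    calc c ^ n.primeFactors.card ≤ |c| ^ n.primeFactors.card := by
          rw [← abs_pow]; exact le_abs_self _
      _ ≤ (2 ^ K) ^ n.primeFactors.card := by gcongr
      _ = (2 ^ n.primeFactors.card) ^ K := by rw [← pow_mul, ← pow_mul, mul_comm]
      _ ≤ _ := by gcongr
  · rw [hw_of_not_squarefree hsq]; positivity

lemma exists_sq_eq_sum {N K : ℕ} {f : ℕ → ℝ}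
    (hf : ∀ n ∈ Icc 1 N, |f n| ≤ (n.divisors.card : ℝ) ^ K) :
    ∃ g : ℕ → ℝ, (∀ l, 1 ≤ l → |g l| ≤ (l.divisors.card : ℝ) ^ (2 * K + 1)) ∧
      ∀ χ : ℕ → ℝ, (∀ a b, χ (a * b) = χ a * χ b) →
        (∑ n ∈ Icc 1 N, f n * χ n) ^ 2 = ∑ l ∈ Icc 1 (N ^ 2), g l * χ l := by
  refine ⟨fun l => ∑ x ∈ Icc 1 N ×ˢ Icc 1 N with x.1 * x.2 = l, f x.1 * f x.2, ?_, ?_⟩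
  · intro l hl
    refine (Finset.abs_sum_le_sum_abs _ _).trans ?_
    calc _ ≤ ∑ x ∈ Icc 1 N ×ˢ Icc 1 N with x.1 * x.2 = l, (l.divisors.card : ℝ) ^ (2 * K) := by
          refine Finset.sum_le_sum fun x hx => ?_
          rw [Finset.mem_filter, Finset.mem_product] at hx
          rw [abs_mul, two_mul, pow_add]
          have h1 := card_divisors_le_of_dvd (by omega) (Dvd.intro _ hx.2)
          have h2 := card_divisors_le_of_dvd (by omega) (Dvd.intro_left _ hx.2)
          exact mul_le_mul ((hf _ hx.1.1).trans (by gcongr)) ((hf _ hx.1.2).trans (by gcongr))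
            (abs_nonneg _) (by positivity)
      _ ≤ l.divisors.card * (l.divisors.card : ℝ) ^ (2 * K) := by
          rw [Finset.sum_const, nsmul_eq_mul]
          gcongr
          refine Finset.card_le_card_of_injOn (fun x => x.1) ?_ ?_
          · intro x hx
            rw [Finset.mem_coe, Finset.mem_filter] at hx
            exact Nat.mem_divisors.2 ⟨Dvd.intro _ hx.2, by omega⟩
          · rintro ⟨x, y⟩ hx ⟨x', y'⟩ hx' h
            rw [Finset.mem_coe, Finset.mem_filter, Finset.mem_product] at hx hx'
            have h3 : x = x' := h
            subst h3
            have h4 : x * y = x * y' := hx.2.trans hx'.2.symm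
            rw [Nat.eq_of_mul_eq_mul_left (Finset.mem_Icc.1 hx.1.1).1 h4]
      _ = _ := by ring
  · intro χ hχ
    rw [sq, Finset.sum_mul_sum, ← Finset.sum_product']
    rw [← Finset.sum_fiberwise_of_maps_to (t := Icc 1 (N ^ 2)) (g := fun x => x.1 * x.2)]
    · refine Finset.sum_congr rfl fun l _ => ?_
      rw [Finset.sum_mul]
      refine Finset.sum_congr rfl fun x hx => ?_
      rw [← (Finset.mem_filter.1 hx).2, hχ]
      ring
    · intro x hx
      rw [Finset.mem_product, Finset.mem_Icc, Finset.mem_Icc] at hx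
      rw [Finset.mem_Icc, sq]
      exact ⟨Nat.mul_pos hx.1.1 hx.2.1, Nat.mul_le_mul hx.1.2 hx.2.2⟩

lemma abs_sum_jr_mul_le {m n : ℕ} (hm : Squarefree m) (hn : Squarefree n) (hmo : Odd m)
    (hno : Odd n) (hmn : m ≠ n) (x : ℕ) :
    |∑ l ∈ Icc 1 x, jr l (m * n)| ≤ 4 * (m * n : ℕ) := by
  wlog h : ∃ p, p.Prime ∧ p ∣ m ∧ ¬ p ∣ n generalizing m n
  · rw [mul_comm m n]
    refine this hn hm hno hmo hmn.symm ?_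
    by_contra h'
    push Not at h h'
    apply hmn
    rw [← Nat.prod_primeFactors_of_squarefree hm, ← Nat.prod_primeFactors_of_squarefree hn]
    congr 1
    ext p
    simp only [Nat.mem_primeFactors]
    exact ⟨fun ⟨h1, h2, h3⟩ => ⟨h1, h p h1 h2, hn.ne_zero⟩,
      fun ⟨h1, h2, h3⟩ => ⟨h1, h' p h1 h2, hm.ne_zero⟩⟩
  obtain ⟨p, hp, ⟨m', rfl⟩, hpn⟩ := h
  have h1 : ¬ p ∣ m' := fun h => by
    have := hm.squarefree_of_dvd (mul_dvd_mul_left p h)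
    exact hp.prime.not_isUnit (this p dvd_rfl)
  have h2 : ¬ p ∣ m' * n := fun h => (hp.dvd_mul.1 h).elim h1 hpn
  rw [mul_assoc]
  have h3 := (isChar_jr_mul isTwist_one hp (m := m' * n)
    (by rw [← mul_assoc]; exact hmo.mul hno) h2).sum_le x
  simpa only [mul_one] using h3

/-- Bilinear sums of Jacobi symbols over a box. -/
lemma bilinear_box (c : ℝ) : ∃ E : ℕ, 1 ≤ E ∧ ∀ (M N : ℕ) (B : Finset ℕ) (a b : ℕ → ℝ),
    1 ≤ M → M ≤ 6 * N → (∀ m ∈ B, m ≤ M ∧ Odd m ∧ Squarefree m) →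
    (∀ m, |a m| ≤ hw c m) → (∀ n, |b n| ≤ hw c n) →
      (∑ m ∈ B, a m * ∑ n ∈ Icc 1 N, b n * jr n m) ^ 8 ≤
        E * (1 + Real.log N) ^ E * (M ^ 7 * N ^ 8) := by
  obtain ⟨K, hK⟩ := exists_hw_le_card_divisors_pow c
  obtain ⟨e1, he1⟩ : ∃ e, e = 2 ^ (2 * K) := ⟨_, rfl⟩
  obtain ⟨e2, he2⟩ : ∃ e, e = 2 ^ (2 * (2 * (2 * K + 1) + 1)) := ⟨_, rfl⟩
  refine ⟨865 * 3 ^ (4 * e1) * 4 ^ e2 + (4 * e1 + e2), ?_, ?_⟩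
  · have : 1 ≤ 3 ^ (4 * e1) * 4 ^ e2 := Nat.one_le_iff_ne_zero.2 (by positivity)
    nlinarith
  intro M N B a b hM hMN hB ha hb
  have hN : 1 ≤ N := by omega
  have hN0 : (0 : ℝ) < N := by exact_mod_cast hN
  have hM0 : (0 : ℝ) < M := by exact_mod_cast hM
  set ℓ := 1 + Real.log N with hℓ
  have hℓ1 : 1 ≤ ℓ := one_le_one_add_log N
  obtain ⟨g, hg, hgs⟩ := exists_sq_eq_sum (N := N) (K := K) (f := b)
    (fun n hn => (hb n).trans (hK n (Finset.mem_Icc.1 hn).1))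
  obtain ⟨g', hg', hgs'⟩ := exists_sq_eq_sum (N := N ^ 2) (K := 2 * K + 1) (f := g)
    (fun n hn => hg n (Finset.mem_Icc.1 hn).1)
  set s : ℕ → ℝ := fun m => ∑ n ∈ Icc 1 N, b n * jr n m with hs
  have hs4 : ∀ m, s m ^ 4 = ∑ l ∈ Icc 1 (N ^ 4), g' l * jr l m := fun m => by
    have h1 := hgs (fun n => jr n m) (fun x y => jr_mul_left x y m)
    have h2 := hgs' (fun n => jr n m) (fun x y => jr_mul_left x y m)
    rw [← h1, ← pow_mul, ← pow_mul] at h2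
    exact h2
  have hcard : (B.card : ℝ) ≤ M := by
    have : B ⊆ Icc 1 M := fun m hm => Finset.mem_Icc.2
      ⟨Nat.pos_of_ne_zero (hB m hm).2.2.ne_zero, (hB m hm).1⟩
    have := Finset.card_le_card this
    rw [Nat.card_Icc] at this
    exact_mod_cast this
  -- the three applications of Cauchy–Schwarz
  have c1 : (∑ m ∈ B, a m * s m) ^ 2 ≤ (∑ m ∈ B, a m ^ 2) * ∑ m ∈ B, s m ^ 2 :=
    Finset.sum_mul_sq_le_sq_mul_sq _ _ _
  have c2 : (∑ m ∈ B, s m ^ 2) ^ 2 ≤ B.card * ∑ m ∈ B, s m ^ 4 := by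
    have := Finset.sum_mul_sq_le_sq_mul_sq B (fun _ => 1) (fun m => s m ^ 2)
    simp only [one_mul, one_pow, Finset.sum_const, nsmul_eq_mul, mul_one, ← pow_mul] at this
    simpa using this
  have c3 : (∑ m ∈ B, s m ^ 4) ^ 2 ≤
      (∑ l ∈ Icc 1 (N ^ 4), g' l ^ 2) * ∑ l ∈ Icc 1 (N ^ 4), (∑ m ∈ B, jr l m) ^ 2 := by
    have : ∑ m ∈ B, s m ^ 4 = ∑ l ∈ Icc 1 (N ^ 4), g' l * ∑ m ∈ B, jr l m := by
      simp only [hs4, Finset.mul_sum]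
      rw [Finset.sum_comm]
    rw [this]
    exact Finset.sum_mul_sq_le_sq_mul_sq _ _ _
  have b1 : ∑ m ∈ B, a m ^ 2 ≤ M * (3 * ℓ) ^ e1 := by
    calc _ ≤ ∑ m ∈ B, (m.divisors.card : ℝ) ^ (2 * K) := by
          refine Finset.sum_le_sum fun m hm => ?_
          rw [mul_comm 2 K, pow_mul, sq_le_sq, abs_of_nonneg (a := _ ^ K) (by positivity)]
          exact (ha m).trans (hK m (Nat.pos_of_ne_zero (hB m hm).2.2.ne_zero))
      _ ≤ ∑ m ∈ Icc 1 M, (m.divisors.card : ℝ) ^ (2 * K) := by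
          refine Finset.sum_le_sum_of_subset_of_nonneg (fun m hm => Finset.mem_Icc.2
            ⟨Nat.pos_of_ne_zero (hB m hm).2.2.ne_zero, (hB m hm).1⟩) (fun _ _ _ => by positivity)
      _ ≤ M * (1 + Real.log M) ^ e1 := by rw [he1]; exact sum_card_divisors_pow_le _ _
      _ ≤ _ := by
          have h1 := one_le_one_add_log M
          have h2 : Real.log M ≤ Real.log 6 + Real.log N := by
            rw [← Real.log_mul (by norm_num) hN0.ne']
            exact Real.log_le_log hM0 (by exact_mod_cast hMN)
          have h3 : Real.log 6 ≤ 2 := by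
            rw [Real.log_le_iff_le_exp (by norm_num)]
            have := Real.exp_one_gt_d9
            have h4 : Real.exp 2 = Real.exp 1 ^ 2 := by rw [← Real.exp_nat_mul]; norm_num
            rw [h4]
            nlinarith
          gcongr
          linarith
  have b2 : ∑ l ∈ Icc 1 (N ^ 4), g' l ^ 2 ≤ N ^ 4 * (4 * ℓ) ^ e2 := by
    calc _ ≤ ∑ l ∈ Icc 1 (N ^ 4), (l.divisors.card : ℝ) ^ (2 * (2 * (2 * K + 1) + 1)) := by
          refine Finset.sum_le_sum fun l hl => ?_
          rw [mul_comm 2 (2 * (2 * K + 1) + 1), pow_mul, sq_le_sq,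
            abs_of_nonneg (a := _ ^ (2 * (2 * K + 1) + 1)) (by positivity)]
          exact hg' l (Finset.mem_Icc.1 hl).1
      _ ≤ (N ^ 4 : ℕ) * (1 + Real.log (N ^ 4 : ℕ)) ^ e2 := by
          rw [he2]; exact sum_card_divisors_pow_le _ _
      _ ≤ _ := by
          have h1 := one_le_one_add_log (N ^ 4)
          push_cast at h1 ⊢
          rw [Real.log_pow] at h1 ⊢
          push_cast at h1 ⊢
          gcongr
          linarith
  have b3 : ∑ l ∈ Icc 1 (N ^ 4), (∑ m ∈ B, jr l m) ^ 2 ≤ 865 * (M * N ^ 4) := by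
    have e3 : ∑ l ∈ Icc 1 (N ^ 4), (∑ m ∈ B, jr l m) ^ 2 =
        ∑ m ∈ B, ∑ m' ∈ B, ∑ l ∈ Icc 1 (N ^ 4), jr l (m * m') := by
      simp only [sq, Finset.sum_mul_sum]
      rw [Finset.sum_comm]
      refine Finset.sum_congr rfl fun m hm => ?_
      rw [Finset.sum_comm]
      refine Finset.sum_congr rfl fun m' hm' => Finset.sum_congr rfl fun l _ => ?_
      rw [jr_mul_right l (hB m hm).2.2.ne_zero (hB m' hm').2.2.ne_zero]
    have e4 : ∀ m ∈ B, ∀ m' ∈ B, ∑ l ∈ Icc 1 (N ^ 4), jr l (m * m') ≤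
        (if m = m' then (N : ℝ) ^ 4 else 0) + 4 * M ^ 2 := by
      intro m hm m' hm'
      split_ifs with h
      · have h5 : ∑ l ∈ Icc 1 (N ^ 4), jr l (m * m') ≤ (N : ℝ) ^ 4 := by
          calc _ ≤ ∑ l ∈ Icc 1 (N ^ 4), (1 : ℝ) :=
                Finset.sum_le_sum fun l _ => (le_abs_self _).trans (abs_jr_le _ _)
            _ = _ := by simp
        have : (0 : ℝ) ≤ 4 * M ^ 2 := by positivity
        linarith
      · rw [zero_add]
        refine (le_abs_self _).trans ((abs_sum_jr_mul_le (hB m hm).2.2 (hB m' hm').2.2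
          (hB m hm).2.1 (hB m' hm').2.1 h _).trans ?_)
        have : m * m' ≤ M * M := Nat.mul_le_mul (hB m hm).1 (hB m' hm').1
        have : ((m * m' : ℕ) : ℝ) ≤ M * M := by exact_mod_cast this
        nlinarith
    rw [e3]
    calc _ ≤ ∑ m ∈ B, ∑ m' ∈ B, ((if m = m' then (N : ℝ) ^ 4 else 0) + 4 * M ^ 2) :=
          Finset.sum_le_sum fun m hm => Finset.sum_le_sum fun m' hm' => e4 m hm m' hm'
      _ = B.card * (N : ℝ) ^ 4 + B.card * (B.card * (4 * M ^ 2)) := by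
          simp only [Finset.sum_add_distrib, Finset.sum_const, nsmul_eq_mul, Finset.sum_ite_eq]
          rw [Finset.sum_congr rfl fun m hm => if_pos hm]
          simp
      _ ≤ M * (N : ℝ) ^ 4 + M * (M * (4 * M ^ 2)) := by gcongr
      _ = M * (N : ℝ) ^ 4 + 4 * M * (M : ℝ) ^ 3 := by ring
      _ ≤ M * (N : ℝ) ^ 4 + 4 * M * (6 * N) ^ 3 := by
          gcongr
          exact_mod_cast hMN
      _ = M * (N : ℝ) ^ 4 + 864 * (M * (N ^ 3 * 1)) := by ring
      _ ≤ M * (N : ℝ) ^ 4 + 864 * (M * (N ^ 3 * N)) := by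
          gcongr
          exact_mod_cast hN
      _ = _ := by ring
  set A := ∑ m ∈ B, a m ^ 2
  set S2 := ∑ m ∈ B, s m ^ 2
  set S4 := ∑ m ∈ B, s m ^ 4
  have hA : 0 ≤ A := Finset.sum_nonneg fun _ _ => sq_nonneg _
  have hS2 : 0 ≤ S2 := Finset.sum_nonneg fun _ _ => sq_nonneg _
  have hS4 : 0 ≤ S4 := Finset.sum_nonneg fun m _ => by positivity
  calc (∑ m ∈ B, a m * s m) ^ 8 = ((∑ m ∈ B, a m * s m) ^ 2) ^ 4 := by ring
    _ ≤ (A * S2) ^ 4 := by gcongr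
    _ = A ^ 4 * (S2 ^ 2) ^ 2 := by ring
    _ ≤ A ^ 4 * (M * S4) ^ 2 := by
        gcongr
        exact c2.trans (by gcongr)
    _ = A ^ 4 * (M ^ 2 * S4 ^ 2) := by ring
    _ ≤ (M * (3 * ℓ) ^ e1) ^ 4 * (M ^ 2 * ((N ^ 4 * (4 * ℓ) ^ e2) * (865 * (M * N ^ 4)))) := by
        gcongr
        exact c3.trans (by gcongr)
    _ = (865 * 3 ^ (4 * e1) * 4 ^ e2) * ℓ ^ (4 * e1 + e2) * (M ^ 7 * N ^ 8) := by
        rw [mul_pow 3 ℓ e1, mul_pow 4 ℓ e2, pow_add, pow_mul' ℓ 4 e1, pow_mul' (3 : ℝ) 4 e1]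
        ring
    _ ≤ _ := by
        have h1 : (865 * 3 ^ (4 * e1) * 4 ^ e2 : ℝ) ≤
            ((865 * 3 ^ (4 * e1) * 4 ^ e2 + (4 * e1 + e2) : ℕ) : ℝ) := by
          push_cast
          have : (0 : ℝ) ≤ 4 * e1 + e2 := by positivity
          linarith
        have h2 : ℓ ^ (4 * e1 + e2) ≤ ℓ ^ (865 * 3 ^ (4 * e1) * 4 ^ e2 + (4 * e1 + e2)) :=
          pow_le_pow_right₀ hℓ1 (Nat.le_add_left _ _)
        gcongr

lemma squarefree_of_abs_le_hw {c x : ℝ} {m : ℕ} (h : |x| ≤ hw c m) (hx : x ≠ 0) :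
    Squarefree m := by
  by_contra hm
  rw [hw_of_not_squarefree hm] at h
  exact hx (abs_nonpos_iff.1 h)

lemma Icc_eq_union_Ioc {a b : ℕ} (h : a ≤ b) : Icc 1 b = Icc 1 a ∪ Ioc a b := by
  ext n; simp only [Finset.mem_union, Finset.mem_Icc, Finset.mem_Ioc]; omega

lemma disjoint_Icc_Ioc (a b : ℕ) : Disjoint (Icc 1 a) (Ioc a b) := by
  rw [Finset.disjoint_left]
  intro n; simp only [Finset.mem_Icc, Finset.mem_Ioc]; omega

set_option maxHeartbeats 1000000 in
/-- Bilinear sums over the part `m² ≤ Y` of the hyperbolic region `m n ≤ Y`. -/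
lemma bilinear_half (c : ℝ) : ∃ E : ℕ, 1 ≤ E ∧ ∀ (w : ℝ) (a b : ℕ → ℝ) (Y : ℕ), 1 ≤ w →
    (∀ m, |a m| ≤ hw c m) → (∀ n, |b n| ≤ hw c n) → (∀ m, a m ≠ 0 → Odd m ∧ w ^ 32 ≤ m) →
      |∑ m ∈ Icc 1 Y with m * m ≤ Y, a m * ∑ n ∈ Icc 1 (Y / m), b n * jr n m| ≤
        E * (Y * (1 + Real.log Y) ^ E / w) := by
  obtain ⟨E, hE1, hE⟩ := bilinear_box c
  obtain ⟨K, hK⟩ := exists_hw_le_card_divisors_pow c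
  obtain ⟨e, he⟩ : ∃ e, e = 2 ^ (2 * K) := ⟨_, rfl⟩
  refine ⟨3 * E + 3 + (2 * e + 1), by omega, fun w a b Y hw1 ha hb has => ?_⟩
  rcases Nat.eq_zero_or_pos Y with rfl | hY
  · simp
  have hw0 : 0 < w := by linarith
  have hY0 : (0 : ℝ) < Y := by exact_mod_cast hY
  set ℓ := 1 + Real.log Y with hℓ
  have hℓ1 : 1 ≤ ℓ := one_le_one_add_log Y
  set L := w ^ 2 with hL
  have hL1 : 1 ≤ L := one_le_pow₀ hw1
  have hL0 : 0 < L := by linarith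
  have hexp : Real.exp (1 / L) ≤ 1 + 2 / L := by
    have h1 : |1 / L| ≤ 1 := by
      rw [abs_of_pos (by positivity), div_le_one hL0]; exact hL1
    have h2 := Real.abs_exp_sub_one_le h1
    rw [abs_of_pos (by positivity : 0 < 1 / L)] at h2
    have h3 := (le_abs_self _).trans h2
    have : 2 * (1 / L) = 2 / L := by ring
    linarith
  have hexp3 : Real.exp (1 / L) ≤ 3 := by
    have : 2 / L ≤ 2 := div_le_self (by norm_num) hL1
    linarith
  set i : ℕ → ℕ := fun m => ⌊L * Real.log m⌋₊ with hi
  set N : ℕ → ℕ := fun j => ⌊Y / Real.exp (j / L)⌋₊ with hN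
  have f1 : ∀ m : ℕ, 1 ≤ m → Real.exp (i m / L) ≤ m := by
    intro m hm
    have hm0 : (0 : ℝ) < m := by exact_mod_cast hm
    rw [← Real.le_log_iff_exp_le hm0, div_le_iff₀ hL0, mul_comm]
    exact Nat.floor_le (mul_nonneg hL0.le (Real.log_natCast_nonneg m))
  have f2 : ∀ m : ℕ, 1 ≤ m → (m : ℝ) ≤ Real.exp (i m / L) * Real.exp (1 / L) := by
    intro m hm
    have hm0 : (0 : ℝ) < m := by exact_mod_cast hm
    rw [← Real.exp_add, ← Real.log_le_iff_le_exp hm0, ← add_div, le_div_iff₀ hL0, mul_comm]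
    exact (Nat.lt_floor_add_one _).le
  have f3 : ∀ m : ℕ, 1 ≤ m → Y / m ≤ N (i m) := by
    intro m hm
    refine Nat.le_floor (Nat.cast_div_le.trans ?_)
    have := f1 m hm
    gcongr
  have f4 : ∀ j, (N j : ℝ) ≤ Y / Real.exp (j / L) := fun j => Nat.floor_le (by positivity)
  have f5 : ∀ m : ℕ, 1 ≤ m → (N (i m) : ℝ) ≤ Y / m * Real.exp (1 / L) := by
    intro m hm
    have hm0 : (0 : ℝ) < m := by exact_mod_cast hm
    refine (f4 _).trans ?_
    rw [div_mul_eq_mul_div, div_le_div_iff₀ (Real.exp_pos _) hm0, mul_assoc,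
      mul_comm (Real.exp (1 / L))]
    exact mul_le_mul_of_nonneg_left (f2 m hm) hY0.le
  have f6 : ∀ j, N j ≤ Y := by
    intro j
    refine Nat.floor_le_of_le (div_le_self hY0.le ?_)
    rw [Real.one_le_exp_iff]
    positivity
  set S := (Icc 1 Y).filter (fun m => m * m ≤ Y ∧ a m ≠ 0) with hS
  have hSm : ∀ m ∈ S, 1 ≤ m ∧ m ≤ Y ∧ m ≤ Y / m ∧ a m ≠ 0 := by
    intro m hm
    rw [hS, Finset.mem_filter, Finset.mem_Icc] at hm
    exact ⟨hm.1.1, hm.1.2, (Nat.le_div_iff_mul_le hm.1.1).2 hm.2.1, hm.2.2⟩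
  have e1 : ∑ m ∈ Icc 1 Y with m * m ≤ Y, a m * ∑ n ∈ Icc 1 (Y / m), b n * jr n m =
      ∑ m ∈ S, a m * ∑ n ∈ Icc 1 (Y / m), b n * jr n m := by
    rw [hS, ← Finset.filter_filter]
    symm
    refine Finset.sum_filter_of_ne fun m _ h => left_ne_zero_of_mul h
  have e2 : ∑ m ∈ S, a m * ∑ n ∈ Icc 1 (Y / m), b n * jr n m =
      ∑ m ∈ S, a m * ∑ n ∈ Icc 1 (N (i m)), b n * jr n m -
        ∑ m ∈ S, ∑ n ∈ Ioc (Y / m) (N (i m)), a m * b n * jr n m := by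
    rw [← Finset.sum_sub_distrib]
    refine Finset.sum_congr rfl fun m hm => ?_
    have h1 := f3 m (hSm m hm).1
    rw [Icc_eq_union_Ioc h1, Finset.sum_union (disjoint_Icc_Ioc _ _), mul_add,
      Finset.mul_sum (s := Ioc _ _)]
    simp only [mul_assoc, add_sub_cancel_right]
  -- the blocks
  have hblock : ∀ j, |∑ m ∈ S with i m = j, a m * ∑ n ∈ Icc 1 (N j), b n * jr n m| ≤
      3 * E * ℓ ^ E * Y / w ^ 4 := by
    intro j
    rcases (S.filter (fun m => i m = j)).eq_empty_or_nonempty with h0 | ⟨m0, hm0⟩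
    · rw [h0, Finset.sum_empty, abs_zero]; positivity
    rw [Finset.mem_filter] at hm0
    obtain ⟨hm0S, rfl⟩ := hm0
    set j := i m0 with hj
    obtain ⟨g1, g2, g3, g4⟩ := hSm m0 hm0S
    have hm00 : (0 : ℝ) < m0 := by exact_mod_cast g1
    set M := ⌊Real.exp (j / L) * Real.exp (1 / L)⌋₊ with hM
    have hMm : ∀ m ∈ S, i m = j → m ≤ M := fun m hm h => Nat.le_floor (h ▸ f2 m (hSm m hm).1)
    have hMle : (M : ℝ) ≤ Real.exp (j / L) * Real.exp (1 / L) := Nat.floor_le (by positivity)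
    have hm0N : m0 ≤ N j := g3.trans (f3 m0 g1)
    have hMN : M ≤ 6 * N j := by
      have h1 : (M : ℝ) ≤ (6 * N j : ℕ) := by
        calc (M : ℝ) ≤ m0 * 3 := hMle.trans (mul_le_mul (f1 m0 g1) hexp3 (by positivity)
              (by positivity))
          _ ≤ (N j : ℝ) * 3 := by gcongr
          _ ≤ _ := by push_cast; nlinarith [(by positivity : (0 : ℝ) ≤ N j)]
      exact_mod_cast h1
    have hM0 : m0 ≤ M := hMm m0 hm0S rfl
    have hV := hE M (N j) (S.filter (fun m => i m = j)) a b (by omega) hMN (fun m hm => by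
      rw [Finset.mem_filter] at hm
      have h1 := hSm m hm.1
      exact ⟨hMm m hm.1 hm.2, (has m h1.2.2.2).1, squarefree_of_abs_le_hw (ha m) h1.2.2.2⟩) ha hb
    have hMw : w ^ 32 ≤ M := ((has m0 g4).2).trans (by exact_mod_cast hM0)
    have hMpos : (0 : ℝ) < M := lt_of_lt_of_le (by positivity) hMw
    have hMNY : (M : ℝ) * N j ≤ 3 * Y := by
      calc (M : ℝ) * N j ≤ Real.exp (j / L) * Real.exp (1 / L) * (Y / Real.exp (j / L)) := by
            gcongr
            exact f4 j
        _ = Real.exp (1 / L) * Y := by field_simp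
        _ ≤ 3 * Y := by gcongr
    have hlog : 1 + Real.log (N j) ≤ ℓ := one_add_log_mono (f6 j)
    have hlog1 := one_le_one_add_log (N j)
    have hE1' : (1 : ℝ) ≤ E := by exact_mod_cast hE1
    rw [← pow_le_pow_iff_left₀ (abs_nonneg _) (by positivity) (by norm_num : 8 ≠ 0),
      Even.pow_abs (by decide)]
    refine hV.trans ?_
    calc (E : ℝ) * (1 + Real.log (N j)) ^ E * (M ^ 7 * N j ^ 8)
        = E * (1 + Real.log (N j)) ^ E * (M * N j) ^ 8 / M := by field_simp
      _ ≤ E ^ 8 * (ℓ ^ E) ^ 8 * (3 * Y) ^ 8 / w ^ 32 := by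
          have h1 : (E : ℝ) ≤ E ^ 8 := le_self_pow₀ hE1' (by norm_num)
          have h2 : (1 + Real.log (N j)) ^ E ≤ (ℓ ^ E) ^ 8 :=
            (pow_le_pow_left₀ (by linarith) hlog E).trans
              (le_self_pow₀ (one_le_pow₀ hℓ1) (by norm_num))
          gcongr
      _ = _ := by
          rw [div_pow, ← pow_mul]
          ring
  have hmain : |∑ m ∈ S, a m * ∑ n ∈ Icc 1 (N (i m)), b n * jr n m| ≤
      3 * E * (Y * ℓ ^ (E + 1) / w) := by
    have hmaps : ∀ m ∈ S, i m ∈ Finset.range (⌊L * Real.log Y⌋₊ + 1) := by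
      intro m hm
      have h1 := hSm m hm
      have : Real.log m ≤ Real.log Y := Real.log_le_log (by exact_mod_cast h1.1)
        (by exact_mod_cast h1.2.1)
      rw [Finset.mem_range, Nat.lt_succ_iff]
      exact Nat.floor_le_floor (by gcongr)
    rw [← Finset.sum_fiberwise_of_maps_to hmaps]
    refine (Finset.abs_sum_le_sum_abs _ _).trans ?_
    calc _ ≤ ∑ j ∈ Finset.range (⌊L * Real.log Y⌋₊ + 1), 3 * E * ℓ ^ E * Y / w ^ 4 := by
          refine Finset.sum_le_sum fun j _ => ?_
          have : ∑ m ∈ S with i m = j, a m * ∑ n ∈ Icc 1 (N (i m)), b n * jr n m =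
              ∑ m ∈ S with i m = j, a m * ∑ n ∈ Icc 1 (N j), b n * jr n m :=
            Finset.sum_congr rfl fun m hm => by rw [(Finset.mem_filter.1 hm).2]
          rw [this]
          exact hblock j
      _ = ((⌊L * Real.log Y⌋₊ : ℝ) + 1) * (3 * E * ℓ ^ E * Y / w ^ 4) := by
          rw [Finset.sum_const, Finset.card_range, nsmul_eq_mul]
          push_cast
          rfl
      _ ≤ (L * ℓ) * (3 * E * ℓ ^ E * Y / w ^ 4) := by
          have h1 : (⌊L * Real.log Y⌋₊ : ℝ) ≤ L * Real.log Y :=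
            Nat.floor_le (mul_nonneg hL0.le (Real.log_natCast_nonneg Y))
          have h2 : (⌊L * Real.log Y⌋₊ : ℝ) + 1 ≤ L * ℓ := by rw [hℓ, mul_add, mul_one]; linarith
          gcongr
      _ = 3 * E * (Y * ℓ ^ (E + 1) / w ^ 2) := by
          rw [hL]; field_simp; ring
      _ ≤ _ := by
          have : w ≤ w ^ 2 := le_self_pow₀ hw1 (by norm_num)
          gcongr
  -- the boundary
  have hbd : |∑ m ∈ S, ∑ n ∈ Ioc (Y / m) (N (i m)), a m * b n * jr n m| ≤
      3 * (Y * ℓ ^ (2 * e + 1) / w) := by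
    have h1 : |∑ m ∈ S, ∑ n ∈ Ioc (Y / m) (N (i m)), a m * b n * jr n m| ≤
        ∑ x ∈ S.sigma (fun m => Ioc (Y / m) (N (i m))), 1 * (|a x.1| * |b x.2|) := by
      rw [Finset.sum_sigma']
      refine (Finset.abs_sum_le_sum_abs _ _).trans (Finset.sum_le_sum fun x _ => ?_)
      rw [abs_mul, abs_mul, one_mul]
      exact mul_le_of_le_one_right (by positivity) (abs_jr_le _ _)
    refine h1.trans ?_
    rw [← pow_le_pow_iff_left₀ (Finset.sum_nonneg fun _ _ => by positivity) (by positivity)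
      (by norm_num : 2 ≠ 0)]
    refine (Finset.sum_mul_sq_le_sq_mul_sq _ _ _).trans ?_
    have hinv : ∑ m ∈ S, (1 : ℝ) / m ≤ ℓ :=
      (Finset.sum_le_sum_of_subset_of_nonneg (Finset.filter_subset _ _)
        (fun _ _ _ => by positivity)).trans (sum_Icc_inv_le Y)
    have c1 : ∑ x ∈ S.sigma (fun m => Ioc (Y / m) (N (i m))), (1 : ℝ) ^ 2 ≤ 3 * Y * ℓ / L := by
      rw [Finset.sum_sigma]
      calc _ ≤ ∑ m ∈ S, 3 * Y / L * (1 / (m : ℝ)) := by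
            refine Finset.sum_le_sum fun m hm => ?_
            obtain ⟨g1, g2, g3, g4⟩ := hSm m hm
            have hm0 : (0 : ℝ) < m := by exact_mod_cast g1
            simp only [one_pow, Finset.sum_const, Nat.card_Ioc, nsmul_eq_mul, mul_one]
            rw [Nat.cast_sub (f3 m g1)]
            have h2 : (Y : ℝ) / m - 1 ≤ (Y / m : ℕ) := by
              have := Nat.lt_div_mul_add (a := Y) g1
              rw [sub_le_iff_le_add, div_le_iff₀ hm0]
              have h3 : Y ≤ (Y / m + 1) * m := by rw [add_mul, one_mul]; omega
              exact_mod_cast h3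
            have h4 : L ≤ (Y : ℝ) / m := by
              calc L ≤ w ^ 32 := by
                    rw [hL]; exact pow_le_pow_right₀ hw1 (by norm_num)
                _ ≤ m := (has m g4).2
                _ ≤ (Y / m : ℕ) := by exact_mod_cast g3
                _ ≤ _ := Nat.cast_div_le
            have h5 : 1 ≤ (Y : ℝ) / m / L := by rwa [le_div_iff₀ hL0, one_mul]
            have h6 : (N (i m) : ℝ) ≤ Y / m * (1 + 2 / L) := (f5 m g1).trans (by gcongr)
            have h7 : (Y : ℝ) / m * (1 + 2 / L) = Y / m + 2 * (Y / m / L) := by ring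
            have h8 : 3 * Y / L * (1 / (m : ℝ)) = 3 * (Y / m / L) := by
              field_simp
            linarith
        _ ≤ 3 * Y / L * ℓ := by
            rw [← Finset.mul_sum]
            gcongr
        _ = _ := by ring
    have c2 : ∑ x ∈ S.sigma (fun m => Ioc (Y / m) (N (i m))), (|a x.1| * |b x.2|) ^ 2 ≤
        3 * Y * ℓ ^ (2 * e) := by
      rw [Finset.sum_sigma]
      have hsq : ∀ (x : ℝ) (n : ℕ), 1 ≤ n → |x| ≤ hw c n →
          |x| ^ 2 ≤ (n.divisors.card : ℝ) ^ (2 * K) := fun x n hn hx => by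
        rw [mul_comm 2 K, pow_mul]
        exact pow_le_pow_left₀ (abs_nonneg _) (hx.trans (hK n hn)) 2
      calc _ ≤ ∑ m ∈ S, (m.divisors.card : ℝ) ^ (2 * K) / m * (3 * Y * ℓ ^ e) := by
            refine Finset.sum_le_sum fun m hm => ?_
            obtain ⟨g1, g2, g3, g4⟩ := hSm m hm
            have hm0 : (0 : ℝ) < m := by exact_mod_cast g1
            simp only [mul_pow]
            rw [← Finset.mul_sum]
            have h2 : ∑ n ∈ Ioc (Y / m) (N (i m)), |b n| ^ 2 ≤ Y / m * 3 * ℓ ^ e := by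
              calc _ ≤ ∑ n ∈ Ioc (Y / m) (N (i m)), (n.divisors.card : ℝ) ^ (2 * K) :=
                    Finset.sum_le_sum fun n hn =>
                      hsq _ n (by have := (Finset.mem_Ioc.1 hn).1; omega) (hb n)
                _ ≤ ∑ n ∈ Icc 1 (N (i m)), (n.divisors.card : ℝ) ^ (2 * K) := by
                    refine Finset.sum_le_sum_of_subset_of_nonneg (fun n hn => ?_)
                      (fun _ _ _ => by positivity)
                    rw [Finset.mem_Ioc] at hn
                    rw [Finset.mem_Icc]
                    omega
                _ ≤ N (i m) * (1 + Real.log (N (i m))) ^ e := by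
                    rw [he]; exact sum_card_divisors_pow_le _ _
                _ ≤ _ := by
                    have h3 := one_le_one_add_log (N (i m))
                    have h4 : 1 + Real.log (N (i m)) ≤ ℓ := one_add_log_mono (f6 (i m))
                    have h5 : (N (i m) : ℝ) ≤ Y / m * 3 := (f5 m g1).trans (by gcongr)
                    gcongr
            calc _ ≤ (m.divisors.card : ℝ) ^ (2 * K) * (Y / m * 3 * ℓ ^ e) :=
                  mul_le_mul (hsq _ m g1 (ha m)) h2 (Finset.sum_nonneg fun _ _ => sq_nonneg _)
                    (by positivity)
              _ = _ := by ring
        _ ≤ ℓ ^ e * (3 * Y * ℓ ^ e) := by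
            rw [← Finset.sum_mul]
            have h9 : ∑ m ∈ S, (m.divisors.card : ℝ) ^ (2 * K) / m ≤ ℓ ^ e := by
              rw [he]
              exact (Finset.sum_le_sum_of_subset_of_nonneg (Finset.filter_subset _ _)
                (fun _ _ _ => by positivity)).trans (sum_card_divisors_pow_div_le (2 * K) Y)
            gcongr
        _ = _ := by rw [two_mul, pow_add]; ring
    calc _ ≤ (3 * Y * ℓ / L) * (3 * Y * ℓ ^ (2 * e)) := by
          gcongr
      _ = 9 * Y ^ 2 * (ℓ ^ (2 * e + 1)) / w ^ 2 := by rw [hL, pow_succ]; ring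
      _ ≤ 9 * Y ^ 2 * (ℓ ^ (2 * e + 1)) ^ 2 / w ^ 2 := by
          have : ℓ ^ (2 * e + 1) ≤ (ℓ ^ (2 * e + 1)) ^ 2 :=
            le_self_pow₀ (one_le_pow₀ hℓ1) (by norm_num)
          gcongr
      _ = _ := by ring
  rw [e1, e2]
  refine (abs_sub _ _).trans ((add_le_add hmain hbd).trans ?_)
  have p1 : ℓ ^ (E + 1) ≤ ℓ ^ (3 * E + 3 + (2 * e + 1)) := pow_le_pow_right₀ hℓ1 (by omega)
  have p2 : ℓ ^ (2 * e + 1) ≤ ℓ ^ (3 * E + 3 + (2 * e + 1)) := pow_le_pow_right₀ hℓ1 (by omega)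
  calc _ ≤ 3 * E * (Y * ℓ ^ (3 * E + 3 + (2 * e + 1)) / w) +
        3 * (Y * ℓ ^ (3 * E + 3 + (2 * e + 1)) / w) := by gcongr
    _ = (3 * E + 3) * (Y * ℓ ^ (3 * E + 3 + (2 * e + 1)) / w) := by ring
    _ ≤ _ := by
        have : (3 * E + 3 : ℝ) ≤ ((3 * E + 3 + (2 * e + 1) : ℕ) : ℝ) := by
          push_cast
          have : (0 : ℝ) ≤ 2 * e + 1 := by positivity
          linarith
        gcongr

/-- Bilinear sums of Jacobi symbols over the hyperbolic region `m n ≤ Y`. -/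
lemma bilinear_sum (c : ℝ) : ∃ E : ℕ, ∀ (w : ℝ) (a b : ℕ → ℝ) (ρ₁ ρ₂ Y : ℕ), 1 ≤ w →
    Odd ρ₁ → Odd ρ₂ → (∀ m, |a m| ≤ hw c m) → (∀ n, |b n| ≤ hw c n) →
    (∀ m, a m ≠ 0 → m % 4 = ρ₁ ∧ w ^ 32 ≤ m) → (∀ n, b n ≠ 0 → n % 4 = ρ₂ ∧ w ^ 32 ≤ n) →
      |∑ m ∈ Icc 1 Y, ∑ n ∈ Icc 1 (Y / m), a m * b n * jr n m| ≤
        E * (Y * (1 + Real.log Y) ^ E / w) := by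
  obtain ⟨E, hE1, hE⟩ := bilinear_half c
  refine ⟨2 * E, fun w a b ρ₁ ρ₂ Y hw1 hρ₁ hρ₂ ha hb has hbs => ?_⟩
  have hw0 : 0 < w := by linarith
  have hodd : ∀ {m ρ : ℕ}, Odd ρ → m % 4 = ρ → Odd m := fun {m ρ} h1 h2 => by
    rw [Nat.odd_iff] at h1 ⊢
    omega
  set a' : ℕ → ℝ := fun m => if m * m ≤ Y then 0 else a m with ha'
  set σ : ℝ := (-1) ^ (ρ₁ / 2 * (ρ₂ / 2)) with hσ
  have hσ1 : |σ| = 1 := by rw [hσ, abs_pow, abs_neg, abs_one, one_pow]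
  have e1 : ∑ m ∈ Icc 1 Y, ∑ n ∈ Icc 1 (Y / m), a m * b n * jr n m =
      ∑ m ∈ Icc 1 Y with m * m ≤ Y, a m * ∑ n ∈ Icc 1 (Y / m), b n * jr n m +
      σ * ∑ n ∈ Icc 1 Y with n * n ≤ Y, b n * ∑ m ∈ Icc 1 (Y / n), a' m * jr m n := by
    have h1 : ∑ n ∈ Icc 1 Y with n * n ≤ Y, b n * ∑ m ∈ Icc 1 (Y / n), a' m * jr m n =
        ∑ n ∈ Icc 1 Y, ∑ m ∈ Icc 1 (Y / n), b n * (a' m * jr m n) := by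
      simp only [← Finset.mul_sum]
      refine Finset.sum_filter_of_ne fun n hn h => ?_
      obtain ⟨m, hm, hne⟩ := Finset.exists_ne_zero_of_sum_ne_zero (right_ne_zero_of_mul h)
      have h2 : ¬ m * m ≤ Y := by
        intro h3
        simp [ha', h3] at hne
      rw [Finset.mem_Icc] at hm hn
      have h3 := (Nat.le_div_iff_mul_le hn.1).1 hm.2
      by_contra h4
      nlinarith
    rw [h1, sum_Icc_div_comm Y (fun n m => b n * (a' m * jr m n)), Finset.mul_sum,
      Finset.sum_filter, ← Finset.sum_add_distrib]
    refine Finset.sum_congr rfl fun m _ => ?_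
    rw [Finset.mul_sum, Finset.mul_sum]
    by_cases h2 : m * m ≤ Y
    · simp [ha', h2, mul_assoc]
    · simp only [ha', h2, if_false, zero_add]
      refine Finset.sum_congr rfl fun n _ => ?_
      by_cases h3 : a m = 0
      · simp [h3]
      by_cases h4 : b n = 0
      · simp [h4]
      have hm := (has m h3).1
      have hn := (hbs n h4).1
      have h5 : jr n m = σ * jr m n := by
        rw [jr_reciprocity (hodd hρ₂ hn) (hodd hρ₁ hm)]
        congr 1
        rw [hσ]
        apply neg_one_pow_congr
        rw [Nat.even_mul, Nat.even_mul, Nat.even_iff, Nat.even_iff, Nat.even_iff, Nat.even_iff]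
        have g1 : n / 2 % 2 = ρ₂ / 2 % 2 := by omega
        have g2 : m / 2 % 2 = ρ₁ / 2 % 2 := by omega
        rw [g1, g2, or_comm]
      rw [h5]; ring
  have b1 := hE w a b Y hw1 ha hb (fun m hm => ⟨hodd hρ₁ (has m hm).1, (has m hm).2⟩)
  have b2 := hE w b a' Y hw1 hb (fun m => by
    simp only [ha']
    split_ifs
    · rw [abs_zero]; exact (abs_nonneg _).trans (ha m)
    · exact ha m) (fun m hm => ⟨hodd hρ₂ (hbs m hm).1, (hbs m hm).2⟩)
  rw [e1]
  refine (abs_add_le _ _).trans ?_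
  rw [abs_mul, hσ1, one_mul]
  refine (add_le_add b1 b2).trans ?_
  have hℓ1 := one_le_one_add_log Y
  have p1 : (1 + Real.log Y) ^ E ≤ (1 + Real.log Y) ^ (2 * E) :=
    pow_le_pow_right₀ hℓ1 (by omega)
  calc _ = (2 * E : ℕ) * (Y * (1 + Real.log Y) ^ E / w) := by push_cast; ring
    _ ≤ _ := by gcongr

/-! ### Weights on tuples -/

lemma hw_mul {c : ℝ} {m n : ℕ} :
    hw c (m * n) = if m.Coprime n then hw c m * hw c n else 0 := by
  simp only [hw, Nat.squarefree_mul_iff]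
  by_cases h : m.Coprime n
  · by_cases hm : Squarefree m <;> by_cases hn : Squarefree n <;> simp [hm, hn]
    rw [h.primeFactors_mul, Finset.card_union_of_disjoint h.disjoint_primeFactors, pow_add]
  · simp [h]

lemma hw_mul_le {c : ℝ} (hc : 0 ≤ c) (m n : ℕ) : hw c (m * n) ≤ hw c m * hw c n := by
  rw [hw_mul]
  split_ifs
  · exact le_rfl
  · exact mul_nonneg (hw_nonneg hc m) (hw_nonneg hc n)

lemma hw_prod_le {ι : Type*} {c : ℝ} (hc : 0 ≤ c) (D : ι → ℕ) (s : Finset ι) :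
    hw c (∏ u ∈ s, D u) ≤ ∏ u ∈ s, hw c (D u) := by
  induction s using Finset.induction_on with
  | empty => simp [hw_one_right]
  | insert a s ha ih =>
    rw [Finset.prod_insert ha, Finset.prod_insert ha]
    exact (hw_mul_le hc _ _).trans (mul_le_mul_of_nonneg_left ih (hw_nonneg hc _))

lemma prod_update_of_one {ι M : Type*} [Fintype ι] [DecidableEq ι] [CommMonoid M]
    (f : ι → ℕ → M) {D : ι → ℕ} {v : ι} (hf : f v 1 = 1) (hD : D v = 1) (m : ℕ) :
    ∏ x, f x (Function.update D v m x) = f v m * ∏ x, f x (D x) := by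
  rw [prod_update_eq, ← Finset.mul_prod_erase univ (fun x => f x (D x)) (Finset.mem_univ v), hD,
    hf, one_mul]

/-- The size of a variable: trivial, small or large. -/
def lev (z m : ℕ) : Fin 3 := if m ≤ 1 then 0 else if m ≤ z then 1 else 2

/-- The product of Jacobi symbols with exponents `L` attached to a tuple. -/
def charProd {ι : Type*} [Fintype ι] (L : ι → ι → ℕ) (D : ι → ℕ) : ℝ :=
  ∏ u, ∏ v, jr (D u) (D v) ^ L u v

/-- The part of `charProd` that involves a new value `m` of the variable at `v`. -/
def link {ι : Type*} [Fintype ι] (L : ι → ι → ℕ) (D : ι → ℕ) (v : ι) (m : ℕ) : ℝ :=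
  ∏ x, (jr m (D x) ^ L v x * jr (D x) m ^ L x v)

/-- The weight of a tuple. -/
def wt {ι : Type*} [Fintype ι] (c : ℝ) (L : ι → ι → ℕ) (D : ι → ℕ) : ℝ :=
  (if (∏ u, D u) % 4 = 3 then hw c (∏ u, D u) else 0) * charProd L D

/-- The sum of the weights over tuples of a given shape. -/
def patSum {ι : Type*} [Fintype ι] [DecidableEq ι] (c : ℝ) (L : ι → ι → ℕ) (N z : ℕ)
    (π : ι → Fin 3) : ℝ :=
  ∑ D ∈ Fintype.piFinset (fun _ : ι => Icc 1 N),
    if ∏ u, D u ≤ N ∧ ∀ u, lev z (D u) = π u then wt c L D else 0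

lemma abs_prod_le_one {ι : Type*} (s : Finset ι) {f : ι → ℝ} (hf : ∀ x ∈ s, |f x| ≤ 1) :
    |∏ x ∈ s, f x| ≤ 1 := by
  rw [Finset.abs_prod]
  exact Finset.prod_le_one (fun _ _ => abs_nonneg _) hf

lemma abs_jr_pow_le (a n e : ℕ) : |jr a n ^ e| ≤ 1 := by
  rw [abs_pow]
  exact pow_le_one₀ (abs_nonneg _) (abs_jr_le a n)

section Tuple

variable {ι : Type*} [Fintype ι] (L : ι → ι → ℕ) (D : ι → ℕ)

lemma abs_charProd_le : |charProd L D| ≤ 1 :=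
  abs_prod_le_one _ fun _ _ => abs_prod_le_one _ fun _ _ => abs_jr_pow_le _ _ _

lemma abs_link_le (v : ι) (m : ℕ) : |link L D v m| ≤ 1 :=
  abs_prod_le_one _ fun _ _ => by
    rw [abs_mul]
    exact mul_le_one₀ (abs_jr_pow_le _ _ _) (abs_nonneg _) (abs_jr_pow_le _ _ _)

lemma abs_wt_le {c : ℝ} (hc : 0 ≤ c) : |wt c L D| ≤ ∏ u, hw c (D u) := by
  rw [wt, abs_mul]
  refine (mul_le_of_le_one_right (abs_nonneg _) (abs_charProd_le L D)).trans ?_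
  refine le_trans ?_ (hw_prod_le hc D univ)
  split_ifs
  · rw [abs_of_nonneg (hw_nonneg hc _)]
  · rw [abs_zero]; exact hw_nonneg hc _

variable [DecidableEq ι] {L D}

lemma charProd_update {v : ι} (hL : L v v = 0) (hD : D v = 1) (m : ℕ) :
    charProd L (Function.update D v m) = charProd L D * link L D v m := by
  have h : ∀ u w, jr (Function.update D v m u) (Function.update D v m w) ^ L u w =
      jr (D u) (D w) ^ L u w * ((if u = v then jr m (D w) ^ L u w else 1) *
        (if w = v then jr (D u) m ^ L u w else 1)) := by
    intro u w
    by_cases hu : u = v <;> by_cases hw : w = v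
    · subst hu; subst hw; simp [hL]
    · subst hu; simp [hw, hD, jr_one_left]
    · subst hw; simp [hu, hD, jr_one_right]
    · simp [hu, hw]
  unfold charProd link
  simp only [h, Finset.prod_mul_distrib]
  congr 2
  · rw [Finset.prod_comm]
    simp
  · simp

lemma link_update {u : ι} (hD : D u = 1) (v : ι) (m n : ℕ) :
    link L (Function.update D u m) v n = jr n m ^ L v u * jr m n ^ L u v * link L D v n := by
  unfold link
  exact prod_update_of_one (fun x y => jr n y ^ L v x * jr y n ^ L x v)
    (by simp [jr_one_left, jr_one_right]) hD m

lemma prod_update_one {v : ι} (hD : D v = 1) (m : ℕ) :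
    ∏ x, Function.update D v m x = m * ∏ x, D x :=
  prod_update_of_one (fun _ y => y) rfl hD m

end Tuple

lemma lev_eq_two_iff {z m : ℕ} (hz : 1 ≤ z) : lev z m = 2 ↔ z < m := by
  unfold lev
  split_ifs <;> simp <;> omega

lemma le_of_lev_ne_two {z m : ℕ} (hz : 1 ≤ z) (h : lev z m ≠ 2) : m ≤ z := by
  by_contra h1
  exact h ((lev_eq_two_iff hz).2 (by omega))

/-- The majorant of the weight of one variable of a given size. -/
def levMaj {ι : Type*} (c : ℝ) (z : ℕ) (π : ι → Fin 3) (u : ι) (m : ℕ) : ℝ :=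
  if π u = 2 ∨ m ≤ z then hw c m else 0

lemma isWeight_levMaj {ι : Type*} {c C : ℝ} (hc : 0 ≤ c) (hC : c ≤ C) (z : ℕ) (π : ι → Fin 3)
    (u : ι) : IsWeight C (levMaj c z π u) := by
  have h := (isWeight_hw hc hC).ite (hc.trans hC) (P := fun m => π u = 2 ∨ m ≤ z)
    fun p m hp h _ => h.imp id fun h => (Nat.le_mul_of_pos_left m hp.pos).trans h
  convert h using 1
  ext m
  unfold levMaj
  congr

lemma levMaj_of_lev {ι : Type*} {c : ℝ} {z : ℕ} {π : ι → Fin 3} {u : ι} {m : ℕ} (hz : 1 ≤ z)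
    (h : lev z m = π u) : levMaj c z π u m = hw c m := by
  refine if_pos ?_
  by_cases h2 : π u = 2
  · exact Or.inl h2
  · exact Or.inr (le_of_lev_ne_two hz (h ▸ h2))

/-- The logarithmic sums of the majorants. -/
lemma prod_sum_levMaj_le {ι : Type*} [Fintype ι] {c : ℝ} (hc : 0 ≤ c) :
    ∃ K : ℕ, 1 ≤ K ∧ ∀ (z : ℕ) (π : ι → Fin 3) (N : ℕ) (s : Finset ι),
      ∏ u ∈ s, ∑ m ∈ Icc 1 N, levMaj c z π u m / m ≤
        K * (1 + Real.log N) ^ (c * (s.filter fun u => π u = 2).card) * (1 + Real.log z) ^ K := by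
  obtain ⟨C, hC1, hC⟩ := sum_hw_div_le c hc
  refine ⟨⌈C ^ Fintype.card ι⌉₊ + ⌈c * Fintype.card ι⌉₊, ?_, fun z π N s => ?_⟩
  · have : 0 < ⌈C ^ Fintype.card ι⌉₊ := Nat.ceil_pos.2 (by positivity)
    omega
  have hN1 := one_le_one_add_log N
  have hz1 := one_le_one_add_log z
  set x := 1 + Real.log N with hx
  set y := 1 + Real.log z with hy
  have h1 : ∀ u ∈ s, ∑ m ∈ Icc 1 N, levMaj c z π u m / m ≤
      C * ((if π u = 2 then x ^ c else 1) * (if π u = 2 then 1 else y ^ c)) := by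
    intro u _
    by_cases h : π u = 2
    · simpa [levMaj, h] using hC N
    · simp only [levMaj, h, false_or, if_false, one_mul]
      refine le_trans ?_ (hC z)
      have : ∀ m : ℕ, (if m ≤ z then hw c m else 0) / (m : ℝ) =
          if m ≤ z then hw c m / m else 0 := fun m => by split_ifs <;> simp
      simp only [this]
      rw [← Finset.sum_filter]
      refine Finset.sum_le_sum_of_subset_of_nonneg (fun m hm => ?_)
        fun m _ _ => div_nonneg (hw_nonneg hc m) (by positivity)
      rw [Finset.mem_filter, Finset.mem_Icc] at hm
      exact Finset.mem_Icc.2 ⟨hm.1.1, hm.2⟩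
  have hnn : ∀ u ∈ s, 0 ≤ ∑ m ∈ Icc 1 N, levMaj c z π u m / m := fun u _ =>
    Finset.sum_nonneg fun m _ => div_nonneg ((isWeight_levMaj hc le_rfl z π u).nonneg m)
      (by positivity)
  refine (Finset.prod_le_prod hnn h1).trans ?_
  rw [Finset.prod_mul_distrib, Finset.prod_mul_distrib, Finset.prod_const, ← Finset.prod_filter,
    Finset.prod_const, ← mul_assoc]
  have hx0 : 0 < x := by linarith
  have hy0 : 0 < y := by linarith
  have e1 : (x ^ c) ^ (s.filter fun u => π u = 2).card =
      x ^ (c * (s.filter fun u => π u = 2).card) := by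
    rw [Real.rpow_mul hx0.le, Real.rpow_natCast]
  have e2 : ∏ u ∈ s, (if π u = 2 then (1 : ℝ) else y ^ c) ≤
      y ^ (⌈C ^ Fintype.card ι⌉₊ + ⌈c * Fintype.card ι⌉₊) := by
    have hyc : 1 ≤ y ^ c := Real.one_le_rpow hz1 hc
    calc _ ≤ ∏ u ∈ s, y ^ c := by
          refine Finset.prod_le_prod (fun u _ => by split_ifs <;> positivity) fun u _ => ?_
          split_ifs
          · exact hyc
          · exact le_rfl
      _ = (y ^ c) ^ s.card := by rw [Finset.prod_const]
      _ ≤ (y ^ c) ^ Fintype.card ι := pow_le_pow_right₀ hyc (Finset.card_le_univ s)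
      _ = y ^ (c * Fintype.card ι) := by rw [Real.rpow_mul hy0.le, Real.rpow_natCast]
      _ ≤ y ^ ((⌈C ^ Fintype.card ι⌉₊ + ⌈c * Fintype.card ι⌉₊ : ℕ) : ℝ) := by
          refine Real.rpow_le_rpow_of_exponent_le hz1 ((Nat.le_ceil _).trans ?_)
          push_cast
          linarith [(Nat.cast_nonneg ⌈C ^ Fintype.card ι⌉₊ : (0 : ℝ) ≤ _)]
      _ = _ := Real.rpow_natCast _ _
  have e3 : C ^ s.card ≤ ((⌈C ^ Fintype.card ι⌉₊ + ⌈c * Fintype.card ι⌉₊ : ℕ) : ℝ) := by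
    refine (pow_le_pow_right₀ hC1 (Finset.card_le_univ s)).trans ((Nat.le_ceil _).trans ?_)
    push_cast
    linarith [(Nat.cast_nonneg ⌈c * Fintype.card ι⌉₊ : (0 : ℝ) ≤ _)]
  rw [e1]
  have e4 : 0 ≤ ∏ u ∈ s, (if π u = 2 then (1 : ℝ) else y ^ c) :=
    Finset.prod_nonneg fun u _ => by split_ifs <;> positivity
  gcongr

/-- The trivial bound for the sum over tuples of a given shape. -/
lemma abs_patSum_le {ι : Type*} [Fintype ι] [DecidableEq ι] {c : ℝ} (hc : 0 ≤ c) :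
    ∃ K : ℕ, ∀ (L : ι → ι → ℕ) (π : ι → Fin 3) (N z : ℕ), 1 ≤ N → 1 ≤ z →
      |patSum c L N z π| ≤ K * (N / (1 + Real.log N)) *
        (1 + Real.log N) ^ (c * (univ.filter fun u => π u = 2).card) * (1 + Real.log z) ^ K := by
  obtain ⟨K, hK1, hK⟩ := prod_sum_levMaj_le (ι := ι) hc
  set A := 1 + Fintype.card ι * (c * Real.log 4) with hA
  have hA0 : 0 ≤ A := by
    have : 0 ≤ Real.log 4 := Real.log_nonneg (by norm_num)
    positivity
  refine ⟨⌈A⌉₊ * K + K, fun L π N z hN hz => ?_⟩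
  have hN1 := one_le_one_add_log N
  have hz1 := one_le_one_add_log z
  calc |patSum c L N z π| ≤ ∑ D ∈ Fintype.piFinset (fun _ : ι => Icc 1 N),
        (if ∏ u, D u ≤ N then ∏ u, levMaj c z π u (D u) else 0) := by
        refine (Finset.abs_sum_le_sum_abs _ _).trans (Finset.sum_le_sum fun D _ => ?_)
        by_cases h : ∏ u, D u ≤ N ∧ ∀ u, lev z (D u) = π u
        · rw [if_pos h, if_pos h.1]
          refine (abs_wt_le L D hc).trans (le_of_eq ?_)
          exact Finset.prod_congr rfl fun u _ => (levMaj_of_lev hz (h.2 u)).symm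
        · rw [if_neg h, abs_zero]
          split_ifs
          · exact Finset.prod_nonneg fun u _ => (isWeight_levMaj hc le_rfl z π u).nonneg _
          · exact le_rfl
    _ ≤ A * (N / (1 + Real.log N)) * ∏ u, ∑ m ∈ Icc 1 N, levMaj c z π u m / m :=
        sum_tuple_le hc _ (fun u => isWeight_levMaj hc le_rfl z π u) N hN
    _ ≤ A * (N / (1 + Real.log N)) * (K * (1 + Real.log N) ^
          (c * (univ.filter fun u => π u = 2).card) * (1 + Real.log z) ^ K) := by
        gcongr
        exact hK z π N univ
    _ = A * K * (N / (1 + Real.log N)) * (1 + Real.log N) ^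
          (c * (univ.filter fun u => π u = 2).card) * (1 + Real.log z) ^ K := by ring
    _ ≤ _ := by
        have h1 : A * K ≤ ((⌈A⌉₊ * K + K : ℕ) : ℝ) := by
          push_cast
          have := Nat.le_ceil A
          have h2 : A * K ≤ ⌈A⌉₊ * (K : ℝ) := by gcongr
          linarith [(Nat.cast_nonneg K : (0 : ℝ) ≤ K)]
        have h3 : (1 + Real.log z) ^ K ≤ (1 + Real.log z) ^ (⌈A⌉₊ * K + K) :=
          pow_le_pow_right₀ hz1 (by omega)
        gcongr

/-! ### Two large linked variables -/

lemma sum_box_eq {M : ℕ} (hM : 1 ≤ M) (N : ℕ) (f : ℕ → ℕ → ℝ) :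
    ∑ m ∈ Icc 1 N, ∑ n ∈ Icc 1 N, (if n * (m * M) ≤ N then f m n else 0) =
      ∑ m ∈ Icc 1 (N / M), ∑ n ∈ Icc 1 (N / M / m), f m n := by
  have h1 : ∀ m ∈ Icc 1 N, ∑ n ∈ Icc 1 N, (if n * (m * M) ≤ N then f m n else 0) =
      ∑ n ∈ Icc 1 (N / M / m), f m n := by
    intro m hm
    rw [← Finset.sum_filter]
    have hm0 : 0 < m * M := Nat.mul_pos (Finset.mem_Icc.1 hm).1 hM
    refine Finset.sum_congr ?_ fun _ _ => rfl
    ext n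
    rw [Finset.mem_filter, Finset.mem_Icc, Finset.mem_Icc, Nat.div_div_eq_div_mul, mul_comm M m,
      Nat.le_div_iff_mul_le hm0]
    have : n ≤ n * (m * M) := Nat.le_mul_of_pos_right n hm0
    omega
  rw [Finset.sum_congr rfl h1]
  symm
  refine Finset.sum_subset (Finset.Icc_subset_Icc_right (Nat.div_le_self N M)) fun m hm hm' => ?_
  rw [Finset.mem_Icc] at hm hm'
  have : N / M / m = 0 := Nat.div_eq_of_lt (by omega)
  rw [this]
  simp

lemma jr_pow_mul_pow {m n a b : ℕ} (hm : Odd m) (hn : Odd n) (hab : Odd (a + b)) :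
    jr n m ^ a * jr m n ^ b = ((-1) ^ (m / 2 * (n / 2))) ^ b * jr n m := by
  rw [jr_reciprocity hm hn, mul_pow, mul_left_comm, ← pow_add]
  congr 1
  obtain ⟨r, hr⟩ := hab
  rw [hr]
  rcases jr_trichotomy n m with h | h | h <;> rw [h] <;> simp [pow_succ, pow_mul]

/-- The coefficient of one of two linked variables. -/
def coefOf {ι : Type*} [Fintype ι] (c : ℝ) (L : ι → ι → ℕ) (z : ℕ) (D : ι → ℕ) (u : ι)
    (ρ m : ℕ) : ℝ :=
  if m % 4 = ρ ∧ z < m ∧ m.Coprime (∏ x, D x) then hw c m * link L D u m else 0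

lemma abs_coefOf_le {ι : Type*} [Fintype ι] {c : ℝ} (hc : 0 ≤ c) (L : ι → ι → ℕ) (z : ℕ)
    (D : ι → ℕ) (u : ι) (ρ m : ℕ) : |coefOf c L z D u ρ m| ≤ hw c m := by
  unfold coefOf
  split_ifs
  · rw [abs_mul, abs_of_nonneg (hw_nonneg hc m)]
    exact mul_le_of_le_one_right (hw_nonneg hc m) (abs_link_le L D u m)
  · rw [abs_zero]; exact hw_nonneg hc m

lemma wt_two_eq {ι : Type*} [Fintype ι] [DecidableEq ι] {c : ℝ} {L : ι → ι → ℕ} {z : ℕ}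
    {D : ι → ℕ} {u v : ι} (huv : u ≠ v) (hu : D u = 1) (hv : D v = 1) (hLu : L u u = 0)
    (hLv : L v v = 0) (hL : Odd (L u v + L v u)) {m n : ℕ} (hm : z < m) (hn : z < n) :
    wt c L (Function.update (Function.update D u m) v n) =
      ∑ ρ ∈ ({1, 3} : Finset ℕ) ×ˢ ({1, 3} : Finset ℕ),
        (if (ρ.2 * (ρ.1 * ∏ x, D x)) % 4 = 3 then hw c (∏ x, D x) * charProd L D *
          ((-1) ^ (ρ.1 / 2 * (ρ.2 / 2))) ^ L u v else 0) *
        (coefOf c L z D u ρ.1 m * coefOf c L z D v ρ.2 n * jr n m) := by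
  have hv' : Function.update D u m v = 1 := by rw [Function.update_of_ne huv.symm, hv]
  set M := ∏ x, D x with hM
  have hprod : ∏ x, Function.update (Function.update D u m) v n x = n * (m * M) := by
    rw [prod_update_one hv', prod_update_one hu]
  have hmod : (n * (m * M)) % 4 = ((n % 4) * ((m % 4) * M)) % 4 :=
    ((Nat.mod_modEq n 4).mul ((Nat.mod_modEq m 4).mul_right M)).symm
  rw [wt, hprod, charProd_update hLv hv', charProd_update hLu hu, link_update hu]
  by_cases hodd : Odd m ∧ Odd n
  swap
  · have h1 : (n * (m * M)) % 4 ≠ 3 := by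
      intro h
      apply hodd
      have h2 : Odd (n * (m * M)) := Nat.odd_iff.2 (by omega)
      rw [Nat.odd_mul, Nat.odd_mul] at h2
      exact ⟨h2.2.1, h2.1⟩
    rw [if_neg h1, zero_mul]
    symm
    refine Finset.sum_eq_zero fun ρ hρ => ?_
    rw [Finset.mem_product, Finset.mem_insert, Finset.mem_insert, Finset.mem_singleton,
      Finset.mem_singleton] at hρ
    rw [not_and_or, Nat.odd_iff, Nat.odd_iff] at hodd
    rcases hodd with h | h
    · have : coefOf c L z D u ρ.1 m = 0 := if_neg fun h3 => by omega
      rw [this]; ring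
    · have : coefOf c L z D v ρ.2 n = 0 := if_neg fun h3 => by omega
      rw [this]; ring
  · obtain ⟨hmo, hno⟩ := hodd
    have hm4 : m % 4 = 1 ∨ m % 4 = 3 := by rw [Nat.odd_iff] at hmo; omega
    have hn4 : n % 4 = 1 ∨ n % 4 = 3 := by rw [Nat.odd_iff] at hno; omega
    rw [Finset.sum_eq_single (m % 4, n % 4)]
    rotate_left
    · intro ρ _ hne
      by_cases h1 : m % 4 = ρ.1
      · have h2 : n % 4 ≠ ρ.2 := fun h2 => hne (Prod.ext h1.symm h2.symm)
        have : coefOf c L z D v ρ.2 n = 0 := if_neg fun h3 => h2 h3.1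
        rw [this]; ring
      · have : coefOf c L z D u ρ.1 m = 0 := if_neg fun h3 => h1 h3.1
        rw [this]; ring
    · intro h
      exfalso
      apply h
      simp only [Finset.mem_product, Finset.mem_insert, Finset.mem_singleton]
      exact ⟨hm4, hn4⟩
    have hsgn : ((-1 : ℝ)) ^ (m / 2 * (n / 2)) = (-1) ^ (m % 4 / 2 * (n % 4 / 2)) := by
      apply neg_one_pow_congr
      rw [Nat.even_mul, Nat.even_mul, Nat.even_iff, Nat.even_iff, Nat.even_iff, Nat.even_iff]
      have g1 : n / 2 % 2 = n % 4 / 2 % 2 := by omega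
      have g2 : m / 2 % 2 = m % 4 / 2 % 2 := by omega
      rw [g1, g2]
    have hjr := jr_pow_mul_pow (a := L v u) (b := L u v) hmo hno (by rwa [add_comm])
    rw [hjr, hsgn, hmod]
    by_cases h3 : (n % 4 * (m % 4 * M)) % 4 = 3
    swap
    · rw [if_neg h3, if_neg h3]; ring
    rw [if_pos h3, if_pos h3]
    have hcop : Nat.Coprime n m ∨ jr n m = 0 := by
      by_cases h : n.Coprime m
      · exact Or.inl h
      · exact Or.inr ((jr_eq_zero_iff (by omega)).2 h)
    rcases hcop with hcop | h0
    swap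
    · rw [h0]; ring
    simp only [hw_mul, Nat.coprime_mul_iff_right]
    unfold coefOf
    rw [← hM]
    by_cases g1 : m.Coprime M
    · by_cases g2 : n.Coprime M
      · rw [if_pos ⟨hcop, g2⟩, if_pos g1, if_pos ⟨rfl, hm, g1⟩, if_pos ⟨rfl, hn, g2⟩]
        ring
      · simp [g2]
    · simp [g1]

lemma sum_piFinset_prod_hw_div_le {ι : Type*} [Fintype ι] [DecidableEq ι] {c : ℝ} (hc : 0 ≤ c) :
    ∃ K : ℕ, ∀ (N : ℕ) (t : ι → Finset ℕ), (∀ x, t x ⊆ Icc 1 N) →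
      ∑ D ∈ Fintype.piFinset t, ∏ x, (hw c (D x) / D x) ≤ K * (1 + Real.log N) ^ K := by
  obtain ⟨K, hK1, hK⟩ := sum_hw_div_le_pow c hc
  refine ⟨K ^ Fintype.card ι + K * Fintype.card ι, fun N t ht => ?_⟩
  have hN1 := one_le_one_add_log N
  rw [← Finset.prod_univ_sum t (fun _ m => hw c m / (m : ℝ))]
  calc _ ≤ ∏ _x : ι, (K * (1 + Real.log N) ^ K) := by
        refine Finset.prod_le_prod (fun x _ => Finset.sum_nonneg fun m _ =>
          div_nonneg (hw_nonneg hc m) (by positivity)) fun x _ => ?_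
        exact (Finset.sum_le_sum_of_subset_of_nonneg (ht x) fun m _ _ =>
          div_nonneg (hw_nonneg hc m) (by positivity)).trans (hK N)
    _ = (K : ℝ) ^ Fintype.card ι * (1 + Real.log N) ^ (K * Fintype.card ι) := by
        rw [Finset.prod_const, Finset.card_univ, mul_pow, pow_mul]
    _ ≤ _ := by
        have h1 : (K : ℝ) ^ Fintype.card ι ≤
            ((K ^ Fintype.card ι + K * Fintype.card ι : ℕ) : ℝ) := by
          exact_mod_cast Nat.le_add_right _ _
        have h2 : (1 + Real.log N) ^ (K * Fintype.card ι) ≤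
            (1 + Real.log N) ^ (K ^ Fintype.card ι + K * Fintype.card ι) :=
          pow_le_pow_right₀ hN1 (by omega)
        gcongr

/-- The sum over tuples with two large linked variables. -/
lemma abs_patSum_le_of_linked {ι : Type*} [Fintype ι] [DecidableEq ι] {c : ℝ} (hc : 0 ≤ c) :
    ∃ K : ℕ, ∀ (L : ι → ι → ℕ), (∀ x, L x x = 0) → ∀ (π : ι → Fin 3) (u v : ι), u ≠ v →
      π u = 2 → π v = 2 → Odd (L u v + L v u) → ∀ (N z : ℕ) (w : ℝ), 1 ≤ N → 1 ≤ w →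
        w ^ 32 ≤ z → |patSum c L N z π| ≤ K * (N * (1 + Real.log N) ^ K / w) := by
  obtain ⟨E, hE⟩ := bilinear_sum c
  obtain ⟨K, hK⟩ := sum_piFinset_prod_hw_div_le (ι := ι) hc
  refine ⟨4 * E * K + (E + K), fun L hL π u v huv hu hv hLuv N z w hN hw1 hwz => ?_⟩
  have hw0 : 0 < w := by linarith
  have hz : 1 ≤ z := by
    have : (1 : ℝ) ≤ z := (one_le_pow₀ hw1).trans hwz
    exact_mod_cast this
  have hN1 := one_le_one_add_log N
  set ℓ := 1 + Real.log N with hℓ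
  set F : (ι → ℕ) → ℝ := fun D => if ∏ u, D u ≤ N ∧ ∀ u, lev z (D u) = π u then wt c L D else 0
    with hF
  set t : ι → Finset ℕ := fun _ => Icc 1 N with ht
  set t'' := Function.update (Function.update t v {1}) u {1} with ht''
  have ht''sub : ∀ x, t'' x ⊆ Icc 1 N := by
    intro x
    have h1 : ({1} : Finset ℕ) ⊆ Icc 1 N := by
      rw [Finset.singleton_subset_iff, Finset.mem_Icc]; omega
    by_cases hx : x = u
    · rw [ht'', hx, Function.update_self]; exact h1
    · rw [ht'', Function.update_of_ne hx]
      by_cases hx' : x = v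
      · rw [hx', Function.update_self]; exact h1
      · rw [Function.update_of_ne hx']
  have hsum : patSum c L N z π = ∑ D ∈ Fintype.piFinset t'', ∑ m ∈ Icc 1 N, ∑ n ∈ Icc 1 N,
      F (Function.update (Function.update D u m) v n) := by
    unfold patSum
    rw [sum_piFinset_isolate t v F, sum_piFinset_isolate (Function.update t v {1}) u,
      Function.update_of_ne huv]
  have hinner : ∀ D ∈ Fintype.piFinset t'', |∑ m ∈ Icc 1 N, ∑ n ∈ Icc 1 N,
      F (Function.update (Function.update D u m) v n)| ≤
        4 * E * (N * ℓ ^ E / w) * ∏ x, (hw c (D x) / D x) := by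
    intro D hD
    rw [Fintype.mem_piFinset] at hD
    have hDu : D u = 1 := by simpa [ht''] using hD u
    have hDv : D v = 1 := by simpa [ht'', huv.symm] using hD v
    have hDpos : ∀ x, 1 ≤ D x := fun x => (Finset.mem_Icc.1 (ht''sub x (hD x))).1
    have hDv' : ∀ m, Function.update D u m v = 1 := fun m => by
      rw [Function.update_of_ne huv.symm, hDv]
    set M := ∏ x, D x with hM
    have hMpos : 1 ≤ M := Finset.one_le_prod' fun x _ => hDpos x
    have hM0 : (0 : ℝ) < M := by exact_mod_cast hMpos
    have hprod : ∀ m n, ∏ x, Function.update (Function.update D u m) v n x = n * (m * M) :=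
      fun m n => by rw [prod_update_one (hDv' m), prod_update_one hDu]
    have hrhs : 0 ≤ 4 * E * (N * ℓ ^ E / w) * ∏ x, (hw c (D x) / D x) :=
      mul_nonneg (by positivity) (Finset.prod_nonneg fun x _ =>
        div_nonneg (hw_nonneg hc _) (by positivity))
    have hlev : ∀ m n, (∀ x, lev z (Function.update (Function.update D u m) v n x) = π x) ↔
        (∀ x, x ≠ u → x ≠ v → lev z (D x) = π x) ∧ z < m ∧ z < n := by
      intro m n
      constructor
      · intro h
        refine ⟨fun x hxu hxv => ?_, ?_, ?_⟩
        · have := h x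
          rwa [Function.update_of_ne hxv, Function.update_of_ne hxu] at this
        · have := h u
          rwa [Function.update_of_ne huv, Function.update_self, hu, lev_eq_two_iff hz] at this
        · have := h v
          rwa [Function.update_self, hv, lev_eq_two_iff hz] at this
      · rintro ⟨h1, h2, h3⟩ x
        by_cases hxv : x = v
        · rw [hxv, Function.update_self, hv, lev_eq_two_iff hz]; exact h3
        · rw [Function.update_of_ne hxv]
          by_cases hxu : x = u
          · rw [hxu, Function.update_self, hu, lev_eq_two_iff hz]; exact h2
          · rw [Function.update_of_ne hxu]; exact h1 x hxu hxv
    by_cases hP : ∀ x, x ≠ u → x ≠ v → lev z (D x) = π x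
    swap
    · have : ∑ m ∈ Icc 1 N, ∑ n ∈ Icc 1 N,
          F (Function.update (Function.update D u m) v n) = 0 :=
        Finset.sum_eq_zero fun m _ => Finset.sum_eq_zero fun n _ =>
          if_neg fun h => hP ((hlev m n).1 h.2).1
      rw [this, abs_zero]
      exact hrhs
    set κ : ℕ × ℕ → ℝ := fun ρ => if (ρ.2 * (ρ.1 * M)) % 4 = 3 then hw c M * charProd L D *
          ((-1) ^ (ρ.1 / 2 * (ρ.2 / 2))) ^ L u v else 0 with hκ
    have hκle : ∀ ρ, |κ ρ| ≤ hw c M := by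
      intro ρ
      rw [hκ]
      dsimp only
      split_ifs
      · rw [abs_mul, abs_mul, abs_pow, abs_pow, abs_neg, abs_one, one_pow, one_pow, mul_one,
          abs_of_nonneg (hw_nonneg hc M)]
        exact mul_le_of_le_one_right (hw_nonneg hc M) (abs_charProd_le L D)
      · rw [abs_zero]; exact hw_nonneg hc M
    have hFeq : ∀ m n, F (Function.update (Function.update D u m) v n) =
        if n * (m * M) ≤ N then ∑ ρ ∈ ({1, 3} : Finset ℕ) ×ˢ ({1, 3} : Finset ℕ),
          κ ρ * (coefOf c L z D u ρ.1 m * coefOf c L z D v ρ.2 n * jr n m) else 0 := by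
      intro m n
      simp only [hF, hprod, hlev]
      by_cases h1 : n * (m * M) ≤ N
      swap
      · rw [if_neg h1, if_neg fun h => h1 h.1]
      rw [if_pos h1]
      by_cases h2 : z < m ∧ z < n
      · rw [if_pos ⟨h1, hP, h2⟩]
        exact wt_two_eq huv hDu hDv (hL u) (hL v) hLuv h2.1 h2.2
      · rw [if_neg fun h => h2 h.2.2]
        symm
        refine Finset.sum_eq_zero fun ρ _ => ?_
        rw [not_and_or] at h2
        rcases h2 with h | h
        · have : coefOf c L z D u ρ.1 m = 0 := if_neg fun h3 => h h3.2.1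
          rw [this]; ring
        · have : coefOf c L z D v ρ.2 n = 0 := if_neg fun h3 => h h3.2.1
          rw [this]; ring
    have hsum2 : ∑ m ∈ Icc 1 N, ∑ n ∈ Icc 1 N, F (Function.update (Function.update D u m) v n) =
        ∑ ρ ∈ ({1, 3} : Finset ℕ) ×ˢ ({1, 3} : Finset ℕ), κ ρ *
          ∑ m ∈ Icc 1 (N / M), ∑ n ∈ Icc 1 (N / M / m),
            coefOf c L z D u ρ.1 m * coefOf c L z D v ρ.2 n * jr n m := by
      simp only [hFeq]
      rw [sum_box_eq hMpos N (fun m n => ∑ ρ ∈ ({1, 3} : Finset ℕ) ×ˢ ({1, 3} : Finset ℕ),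
          κ ρ * (coefOf c L z D u ρ.1 m * coefOf c L z D v ρ.2 n * jr n m))]
      rw [Finset.sum_congr rfl fun m _ => Finset.sum_comm, Finset.sum_comm]
      simp only [Finset.mul_sum]
    have hY : ((N / M : ℕ) : ℝ) ≤ N / M := Nat.cast_div_le
    have hYℓ : 1 + Real.log (N / M : ℕ) ≤ ℓ := one_add_log_mono (Nat.div_le_self N M)
    have hY1 := one_le_one_add_log (N / M)
    rw [hsum2]
    calc _ ≤ ∑ ρ ∈ ({1, 3} : Finset ℕ) ×ˢ ({1, 3} : Finset ℕ),
          hw c M * (E * ((N / M) * ℓ ^ E / w)) := by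
          refine (Finset.abs_sum_le_sum_abs _ _).trans (Finset.sum_le_sum fun ρ hρ => ?_)
          rw [Finset.mem_product, Finset.mem_insert, Finset.mem_insert, Finset.mem_singleton,
            Finset.mem_singleton] at hρ
          have ho1 : Odd ρ.1 := by rw [Nat.odd_iff]; omega
          have ho2 : Odd ρ.2 := by rw [Nat.odd_iff]; omega
          have hcoef : ∀ (y : ι) (ρ m : ℕ), coefOf c L z D y ρ m ≠ 0 →
              m % 4 = ρ ∧ w ^ 32 ≤ m := by
            intro y ρ m h
            have h1 : m % 4 = ρ ∧ z < m ∧ m.Coprime (∏ x, D x) := by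
              by_contra h1
              exact h (if_neg h1)
            exact ⟨h1.1, hwz.trans (by exact_mod_cast h1.2.1.le)⟩
          rw [abs_mul]
          refine mul_le_mul (hκle ρ) ?_ (abs_nonneg _) (hw_nonneg hc M)
          refine (hE w (coefOf c L z D u ρ.1) (coefOf c L z D v ρ.2) ρ.1 ρ.2 (N / M) hw1 ho1 ho2
            (abs_coefOf_le hc L z D u ρ.1) (abs_coefOf_le hc L z D v ρ.2) (hcoef u ρ.1)
            (hcoef v ρ.2)).trans ?_
          gcongr
      _ = 4 * E * (N * ℓ ^ E / w) * (hw c M / M) := by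
          rw [Finset.sum_const, Finset.card_product]
          simp only [Finset.card_insert_of_notMem (by decide : (1 : ℕ) ∉ ({3} : Finset ℕ)),
            Finset.card_singleton, nsmul_eq_mul]
          push_cast
          field_simp
      _ ≤ _ := by
          rw [Finset.prod_div_distrib, hM]
          push_cast
          gcongr
          exact hw_prod_le hc D univ
  rw [hsum]
  refine (Finset.abs_sum_le_sum_abs _ _).trans ((Finset.sum_le_sum hinner).trans ?_)
  rw [← Finset.mul_sum]
  have h1 := hK N t'' ht''sub
  calc _ ≤ 4 * E * (N * ℓ ^ E / w) * (K * ℓ ^ K) := by gcongr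
    _ = (4 * E * K : ℕ) * (N * ℓ ^ (E + K) / w) := by push_cast; ring
    _ ≤ _ := by
        have h2 : ((4 * E * K : ℕ) : ℝ) ≤ ((4 * E * K + (E + K) : ℕ) : ℝ) := by
          exact_mod_cast Nat.le_add_right _ _
        have h3 : ℓ ^ (E + K) ≤ ℓ ^ (4 * E * K + (E + K)) := pow_le_pow_right₀ hN1 (by omega)
        gcongr

/-! ### A large variable linked to a small one -/

lemma jr_prod_right {ι : Type*} (a : ℕ) (D : ι → ℕ) (s : Finset ι) (hD : ∀ x ∈ s, D x ≠ 0) :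
    ∏ x ∈ s, jr a (D x) = jr a (∏ x ∈ s, D x) := by
  induction s using Finset.induction_on with
  | empty => simp [jr_one_right]
  | insert b s hb ih =>
    have h1 : ∏ x ∈ s, D x ≠ 0 :=
      Finset.prod_ne_zero_iff.2 fun x hx => hD x (Finset.mem_insert_of_mem hx)
    rw [Finset.prod_insert hb, Finset.prod_insert hb,
      jr_mul_right a (hD b (Finset.mem_insert_self b s)) h1,
      ih fun x hx => hD x (Finset.mem_insert_of_mem hx)]

/-- The primitive part of the character in the variable at `v`. -/
def linkMod {ι : Type*} [Fintype ι] (L : ι → ι → ℕ) (v : ι) (D : ι → ℕ) : ℕ :=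
  ∏ x with Odd (L v x + L x v), D x

lemma link_eq {ι : Type*} [Fintype ι] (L : ι → ι → ℕ) (v : ι) {D : ι → ℕ} {m : ℕ}
    (hD : Odd (∏ x, D x)) (hm : Odd m) (hc : m.Coprime (∏ x, D x)) :
    link L D v m = (∏ x, ((-1) ^ (m % 4 / 2 * (D x / 2))) ^ L x v) * jr m (linkMod L v D) := by
  have hDo : ∀ x, Odd (D x) := fun x => by
    have h1 : D x ∣ ∏ x, D x := Finset.dvd_prod_of_mem D (Finset.mem_univ x)
    exact Odd.of_dvd_nat hD h1
  have hDc : ∀ x, m.Coprime (D x) := fun x =>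
    hc.coprime_dvd_right (Finset.dvd_prod_of_mem D (Finset.mem_univ x))
  have hD0 : ∀ x, D x ≠ 0 := fun x h => by have := hDo x; rw [h] at this; exact absurd this (by decide)
  rw [linkMod, ← jr_prod_right m D _ fun x _ => hD0 x, Finset.prod_filter,
    ← Finset.prod_mul_distrib, link]
  refine Finset.prod_congr rfl fun x _ => ?_
  have hsgn : ((-1 : ℝ)) ^ (D x / 2 * (m / 2)) = (-1) ^ (m % 4 / 2 * (D x / 2)) := by
    apply neg_one_pow_congr
    rw [Nat.even_mul, Nat.even_mul, Nat.even_iff, Nat.even_iff, Nat.even_iff]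
    have g2 : m / 2 % 2 = m % 4 / 2 % 2 := by omega
    rw [g2, or_comm]
  rw [jr_reciprocity (hDo x) hm, hsgn, mul_pow, mul_left_comm, ← pow_add]
  congr 1
  split_ifs with h
  · obtain ⟨r, hr⟩ := h
    rw [hr, pow_succ, pow_mul, jr_sq (hD0 x) (hDc x), one_pow, one_mul]
  · obtain ⟨r, hr⟩ := Nat.not_odd_iff_even.1 h
    rw [hr, ← two_mul, pow_mul, jr_sq (hD0 x) (hDc x), one_pow]

lemma div_one_add_log_mono {a b : ℕ} (ha : 1 ≤ a) (hab : a ≤ b) :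
    (a : ℝ) / (1 + Real.log a) ≤ b / (1 + Real.log b) := by
  have ha0 : (0 : ℝ) < a := by exact_mod_cast ha
  have hab' : (a : ℝ) ≤ b := by exact_mod_cast hab
  have hb0 : (0 : ℝ) < b := ha0.trans_le hab'
  have h1 := one_le_one_add_log a
  have h2 := one_le_one_add_log b
  rw [div_le_div_iff₀ (by linarith) (by linarith)]
  have h3 : Real.log b = Real.log a + Real.log (b / a) := by
    rw [Real.log_div hb0.ne' ha0.ne']; ring
  have h4 := Real.log_le_sub_one_of_pos (div_pos hb0 ha0)
  have h5 : a * Real.log (b / a) ≤ b - a := by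
    calc a * Real.log (b / a) ≤ a * (b / a - 1) := by gcongr
      _ = b - a := by field_simp
  have h6 : 0 ≤ (b - a) * Real.log a :=
    mul_nonneg (by linarith) (Real.log_natCast_nonneg a)
  rw [h3]
  nlinarith

/-- Sums of a Jacobi symbol of small conductor over an arithmetic progression modulo `4`. -/
lemma prog_sum_le {c : ℝ} (hc : 0 ≤ c) : ∃ K : ℕ, ∀ (r M Q z Y ρ : ℕ), ρ = 1 ∨ ρ = 3 → M ≠ 0 →
    Squarefree Q → Odd Q → Q ≠ 1 → Q ≤ z ^ r → 1 ≤ z →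
    |∑ m ∈ Icc 1 Y, if z < m ∧ m % 4 = ρ ∧ m.Coprime M then jr m Q * hw c m else 0| ≤
      K * (Y / (1 + Real.log Y)) * (((r + 4) * (1 + Real.log z)) ^ K +
        2 ^ M.primeFactors.card / z * (1 + Real.log Y) ^ K) := by
  obtain ⟨K, hK⟩ := charSum_hw_le hc
  refine ⟨2 * K, fun r M Q z Y ρ hρ hM hQ hQo hQ1 hQz hz => ?_⟩
  have hz1 := one_le_one_add_log z
  have hY1 := one_le_one_add_log Y
  have hz0 : (0 : ℝ) < z := by exact_mod_cast hz
  obtain ⟨p, hp, q, rfl⟩ := Nat.exists_prime_and_dvd hQ1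
  have hpq : ¬ p ∣ q := fun h => by
    have := Nat.Coprime.eq_one_of_dvd (Nat.coprime_of_squarefree_mul hQ) h
    exact hp.one_lt.ne' this
  set R := (Y / (1 + Real.log Y)) * (((r + 4) * (1 + Real.log z)) ^ K +
        2 ^ M.primeFactors.card / z * (1 + Real.log Y) ^ K) with hR
  have hR0 : 0 ≤ R := by positivity
  have hKK : (2 * K : ℕ) * (Y / (1 + Real.log Y)) * (((r + 4) * (1 + Real.log z)) ^ (2 * K) +
      2 ^ M.primeFactors.card / z * (1 + Real.log Y) ^ (2 * K)) ≥ 2 * (K * R) := by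
    have h1 : ((r + 4) * (1 + Real.log z)) ^ K ≤ ((r + 4) * (1 + Real.log z)) ^ (2 * K) :=
      pow_le_pow_right₀ (by nlinarith [(Nat.cast_nonneg r : (0 : ℝ) ≤ r)]) (by omega)
    have h2 : (1 + Real.log Y) ^ K ≤ (1 + Real.log Y) ^ (2 * K) :=
      pow_le_pow_right₀ hY1 (by omega)
    calc 2 * (K * R) = (2 * K : ℕ) * (Y / (1 + Real.log Y)) *
          (((r + 4) * (1 + Real.log z)) ^ K +
            2 ^ M.primeFactors.card / z * (1 + Real.log Y) ^ K) := by
          rw [hR]; push_cast; ring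
      _ ≤ _ := by gcongr
  refine le_trans ?_ hKK
  rcases le_or_gt Y z with hYz | hYz
  · rw [Finset.sum_eq_zero fun m hm => if_neg fun h => ?_, abs_zero]
    · positivity
    · have := (Finset.mem_Icc.1 hm).2
      omega
  -- the sums twisted by characters modulo 4
  have hS : ∀ ψ, IsTwist ψ → ∀ x, 1 ≤ x → x ≤ Y →
      |∑ m ∈ Icc 1 x, (if m.Coprime M then jr m (p * q) * ψ m else 0) * hw c m| ≤ K * R := by
    intro ψ hψ x hx hxY
    have hch := (isChar_jr_mul hψ hp hQo hpq).coprime hM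
    have hT : 1 ≤ 4 * z ^ (r + 2) := by
      have := Nat.one_le_pow (r + 2) z hz
      omega
    have h := hK _ _ hch (4 * z ^ (r + 2)) x hT
    have hx1 := one_le_one_add_log x
    have hT' : 1 + Real.log (4 * z ^ (r + 2) : ℕ) ≤ (r + 4) * (1 + Real.log z) := by
      push_cast
      rw [Real.log_mul (by norm_num) (by positivity), Real.log_pow]
      have h4 : Real.log 4 ≤ 4 - 1 := Real.log_le_sub_one_of_pos (by norm_num)
      have hl : 0 ≤ Real.log z := Real.log_natCast_nonneg z
      push_cast
      nlinarith [(Nat.cast_nonneg r : (0 : ℝ) ≤ r)]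
    have hsq : √(2 ^ M.primeFactors.card * (4 * (p * q : ℕ)) / (4 * z ^ (r + 2) : ℕ)) ≤
        2 ^ M.primeFactors.card / (z : ℝ) := by
      have h1 : (1 : ℝ) ≤ 2 ^ M.primeFactors.card := one_le_pow₀ (by norm_num)
      rw [Real.sqrt_le_left (by positivity)]
      have h2 : ((p * q : ℕ) : ℝ) ≤ z ^ r := by exact_mod_cast hQz
      calc (2 : ℝ) ^ M.primeFactors.card * (4 * (p * q : ℕ)) / (4 * z ^ (r + 2) : ℕ)
          ≤ 2 ^ M.primeFactors.card * (4 * z ^ r) / (4 * z ^ (r + 2) : ℕ) := by gcongr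
        _ = 2 ^ M.primeFactors.card / z ^ 2 := by
            push_cast
            rw [pow_add]
            field_simp
        _ ≤ (2 ^ M.primeFactors.card) ^ 2 / z ^ 2 := by
            gcongr
            exact le_self_pow₀ h1 (by norm_num)
        _ = _ := by rw [div_pow]
    have hm1 := div_one_add_log_mono hx hxY
    have hm2 : 1 + Real.log x ≤ 1 + Real.log Y := one_add_log_mono hxY
    have hT1 := one_le_one_add_log (4 * z ^ (r + 2))
    calc |∑ m ∈ Icc 1 x, (if m.Coprime M then jr m (p * q) * ψ m else 0) * hw c m|
        ≤ K * (x / (1 + Real.log x)) * ((1 + Real.log (4 * z ^ (r + 2) : ℕ)) ^ K +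
          √(2 ^ M.primeFactors.card * (4 * (p * q : ℕ)) / (4 * z ^ (r + 2) : ℕ)) *
            (1 + Real.log x) ^ K) := h
      _ ≤ K * (Y / (1 + Real.log Y)) * (((r + 4) * (1 + Real.log z)) ^ K +
          2 ^ M.primeFactors.card / z * (1 + Real.log Y) ^ K) := by gcongr
      _ = K * R := by rw [hR]; ring
  have hdiff : ∀ ψ, IsTwist ψ → |∑ m ∈ Ioc z Y,
      (if m.Coprime M then jr m (p * q) * ψ m else 0) * hw c m| ≤ 2 * (K * R) := by
    intro ψ hψ
    have h1 := hS ψ hψ Y (by omega) le_rfl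
    have h2 := hS ψ hψ z hz hYz.le
    rw [Icc_eq_union_Ioc hYz.le, Finset.sum_union (disjoint_Icc_Ioc _ _)] at h1
    rw [abs_le] at *
    constructor <;> linarith
  have hρ4 : |chi4 ρ| ≤ 1 := abs_chi4_le ρ
  have heq : ∑ m ∈ Icc 1 Y,
      (if z < m ∧ m % 4 = ρ ∧ m.Coprime M then jr m (p * q) * hw c m else 0) =
      1 / 2 * ∑ m ∈ Ioc z Y, (if m.Coprime M then jr m (p * q) * chi4 m ^ 2 else 0) * hw c m +
      1 / 2 * (chi4 ρ *
        ∑ m ∈ Ioc z Y, (if m.Coprime M then jr m (p * q) * chi4 m else 0) * hw c m) := by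
    rw [Icc_eq_union_Ioc hYz.le, Finset.sum_union (disjoint_Icc_Ioc _ _),
      Finset.sum_eq_zero fun m hm => if_neg fun h => ?_, zero_add, Finset.mul_sum, Finset.mul_sum,
      Finset.mul_sum, ← Finset.sum_add_distrib]
    · refine Finset.sum_congr rfl fun m hm => ?_
      have hzm := (Finset.mem_Ioc.1 hm).1
      by_cases hcop : m.Coprime M
      swap
      · rw [if_neg fun h => hcop h.2.2, if_neg hcop, if_neg hcop]; ring
      rw [if_pos hcop, if_pos hcop]
      have h4 : m % 4 = 0 ∨ m % 4 = 1 ∨ m % 4 = 2 ∨ m % 4 = 3 := by omega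
      have h2 : m % 2 = m % 4 % 2 := by omega
      have hnum : 1 / 2 * chi4 m ^ 2 + 1 / 2 * (chi4 ρ * chi4 m) =
          if m % 4 = ρ then 1 else 0 := by
        simp only [chi4_eq, h2]
        rcases hρ with rfl | rfl <;> rcases h4 with h | h | h | h <;> simp only [h] <;> norm_num
      have hlhs : (if z < m ∧ m % 4 = ρ ∧ m.Coprime M then jr m (p * q) * hw c m else 0) =
          (if m % 4 = ρ then 1 else 0) * (jr m (p * q) * hw c m) := by
        by_cases hmρ : m % 4 = ρ
        · rw [if_pos ⟨hzm, hmρ, hcop⟩, if_pos hmρ, one_mul]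
        · rw [if_neg fun h => hmρ h.2.1, if_neg hmρ, zero_mul]
      rw [hlhs, ← hnum]
      ring
    · have := (Finset.mem_Icc.1 hm).2
      omega
  rw [heq]
  have d1 := hdiff _ isTwist_chi4_sq
  have d2 := hdiff _ isTwist_chi4
  refine (abs_add_le _ _).trans ?_
  rw [abs_mul, abs_mul, abs_mul, abs_of_pos (by norm_num : (0 : ℝ) < 1 / 2)]
  have d3 : |chi4 ρ| * |∑ m ∈ Ioc z Y,
      (if m.Coprime M then jr m (p * q) * chi4 m else 0) * hw c m| ≤ 1 * (2 * (K * R)) :=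
    mul_le_mul hρ4 d2 (abs_nonneg _) (by norm_num)
  linarith

lemma sum_mul_le_eq {M : ℕ} (hM : 1 ≤ M) (N : ℕ) (f : ℕ → ℝ) :
    ∑ m ∈ Icc 1 N, (if m * M ≤ N then f m else 0) = ∑ m ∈ Icc 1 (N / M), f m := by
  rw [← Finset.sum_filter]
  refine Finset.sum_congr ?_ fun _ _ => rfl
  ext m
  rw [Finset.mem_filter, Finset.mem_Icc, Finset.mem_Icc, Nat.le_div_iff_mul_le hM]
  constructor
  · rintro ⟨⟨h1, _⟩, h2⟩; exact ⟨h1, h2⟩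
  · rintro ⟨h1, h2⟩
    exact ⟨⟨h1, (Nat.le_mul_of_pos_right m hM).trans h2⟩, h2⟩

lemma hw_mul_two_pow_le (c : ℝ) (m : ℕ) :
    hw c m * 2 ^ m.primeFactors.card ≤ hw (2 * c) m := by
  by_cases h : Squarefree m
  · rw [hw_of_squarefree h, hw_of_squarefree h, mul_pow, mul_comm]
  · rw [hw_of_not_squarefree h, hw_of_not_squarefree h, zero_mul]

/-- The contribution of one large variable linked to a small one, the others fixed. -/
lemma abs_sum_update_le {ι : Type*} [Fintype ι] [DecidableEq ι] {c : ℝ} (hc : 0 ≤ c) :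
    ∃ K : ℕ, ∀ (L : ι → ι → ℕ), (∀ x, L x x = 0) → ∀ (π : ι → Fin 3) (u v : ι),
      π u = 1 → π v = 2 → Odd (L v u + L u v) → (∀ x, π x = 2 → Even (L v x + L x v)) →
      ∀ (N z : ℕ) (D : ι → ℕ), 1 ≤ z → (∀ x, 1 ≤ D x) → D v = 1 →
      |∑ m ∈ Icc 1 N, if ∏ x, Function.update D v m x ≤ N ∧
          ∀ x, lev z (Function.update D v m x) = π x then wt c L (Function.update D v m) else 0| ≤
        if ∀ x, x ≠ v → lev z (D x) = π x then
          hw c (∏ x, D x) * (K * (((N / ∏ x, D x : ℕ) : ℝ) /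
            (1 + Real.log (N / ∏ x, D x : ℕ))) * (((Fintype.card ι + 4) * (1 + Real.log z)) ^ K +
              2 ^ (∏ x, D x).primeFactors.card / z *
                (1 + Real.log (N / ∏ x, D x : ℕ)) ^ K)) else 0 := by
  obtain ⟨K, hK⟩ := prog_sum_le hc
  refine ⟨K, fun L hL π u v hu hv hLuv hLe N z D hz hDpos hDv => ?_⟩
  have huv : u ≠ v := fun h => by rw [h, hv] at hu; exact absurd hu (by decide)
  set M := ∏ x, D x with hM
  have hMpos : 1 ≤ M := Finset.one_le_prod' fun x _ => hDpos x
  have hz1 := one_le_one_add_log z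
  have hY1 := one_le_one_add_log (N / M)
  have hlev : ∀ m, (∀ x, lev z (Function.update D v m x) = π x) ↔
      (∀ x, x ≠ v → lev z (D x) = π x) ∧ z < m := by
    intro m
    constructor
    · intro h
      refine ⟨fun x hxv => ?_, ?_⟩
      · have := h x
        rwa [Function.update_of_ne hxv] at this
      · have := h v
        rwa [Function.update_self, hv, lev_eq_two_iff hz] at this
    · rintro ⟨h1, h2⟩ x
      by_cases hxv : x = v
      · rw [hxv, Function.update_self, hv, lev_eq_two_iff hz]; exact h2
      · rw [Function.update_of_ne hxv]; exact h1 x hxv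
  simp only [hlev, prod_update_one hDv, ← hM]
  by_cases hP : ∀ x, x ≠ v → lev z (D x) = π x
  swap
  · rw [if_neg hP, Finset.sum_eq_zero fun m _ => if_neg fun h => hP h.2.1, abs_zero]
  rw [if_pos hP]
  have hrhs : 0 ≤ hw c M * (K * (((N / M : ℕ) : ℝ) /
      (1 + Real.log (N / M : ℕ))) * (((Fintype.card ι + 4) * (1 + Real.log z)) ^ K +
        2 ^ M.primeFactors.card / z * (1 + Real.log (N / M : ℕ)) ^ K)) :=
    mul_nonneg (hw_nonneg hc M) (by positivity)
  by_cases hMo : Odd M ∧ Squarefree M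
  swap
  · rw [Finset.sum_eq_zero, abs_zero]
    · exact hrhs
    · intro m _
      have h0 : wt c L (Function.update D v m) = 0 := by
        unfold wt
        rw [prod_update_one hDv, ← hM, mul_eq_zero]
        left
        by_cases h3 : m * M % 4 = 3
        · rw [if_pos h3]
          have ho : Odd (m * M) := by rw [Nat.odd_iff]; omega
          refine hw_of_not_squarefree fun hs => hMo ⟨(Nat.odd_mul.1 ho).2, ?_⟩
          exact hs.squarefree_of_dvd (Dvd.intro_left m rfl)
        · rw [if_neg h3]
      rw [h0, ite_self]
  obtain ⟨hMo, hMs⟩ := hMo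
  set Q := linkMod L v D with hQ
  have hQM : Q ∣ M := Finset.prod_dvd_prod_of_subset _ _ _ (Finset.filter_subset _ _)
  have hQ1 : Q ≠ 1 := by
    intro h
    have h1 : D u ∣ Q := Finset.dvd_prod_of_mem D
      (Finset.mem_filter.2 ⟨Finset.mem_univ u, hLuv⟩)
    rw [h, Nat.dvd_one] at h1
    have h2 := hP u huv
    rw [h1, hu] at h2
    simp [lev] at h2
  have hQz : Q ≤ z ^ Fintype.card ι := by
    refine (Finset.prod_le_pow_card _ _ z fun x hx => ?_).trans
      (Nat.pow_le_pow_right hz (Finset.card_le_univ _))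
    have hx' := (Finset.mem_filter.1 hx).2
    have hxv : x ≠ v := by
      rintro rfl
      rw [hL] at hx'
      exact absurd hx' (by decide)
    refine le_of_lev_ne_two hz ?_
    rw [hP x hxv]
    exact fun h => (Nat.not_even_iff_odd.2 hx') (hLe x h)
  set ρ := 3 * M % 4 with hρ
  have hρ13 : ρ = 1 ∨ ρ = 3 := by rw [Nat.odd_iff] at hMo; omega
  set κ : ℝ := hw c M * charProd L D * ∏ x, ((-1) ^ (ρ / 2 * (D x / 2))) ^ L x v with hκ
  have hκle : |κ| ≤ hw c M := by
    rw [hκ, abs_mul, abs_mul, abs_of_nonneg (hw_nonneg hc M), mul_assoc]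
    refine mul_le_of_le_one_right (hw_nonneg hc M) (mul_le_one₀ (abs_charProd_le L D)
      (abs_nonneg _) ?_)
    rw [Finset.abs_prod, Finset.prod_congr rfl fun x _ => by
      rw [abs_pow, abs_pow, abs_neg, abs_one, one_pow, one_pow]]
    simp
  have hterm : ∀ m, (if m * M ≤ N ∧ (∀ x, x ≠ v → lev z (D x) = π x) ∧ z < m then
        wt c L (Function.update D v m) else 0) =
      if m * M ≤ N then κ * (if z < m ∧ m % 4 = ρ ∧ m.Coprime M then jr m Q * hw c m else 0)
        else 0 := by
    intro m
    by_cases h1 : m * M ≤ N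
    swap
    · rw [if_neg h1, if_neg fun h => h1 h.1]
    rw [if_pos h1]
    by_cases h2 : z < m
    swap
    · rw [if_neg fun h => h2 h.2.2, if_neg fun h => h2 h.1, mul_zero]
    rw [if_pos ⟨h1, hP, h2⟩]
    unfold wt
    rw [prod_update_one hDv, ← hM, charProd_update (hL v) hDv, hw_mul]
    have hmod : m * M % 4 = 3 ↔ m % 4 = ρ := by
      rw [hρ]
      rw [Nat.odd_iff] at hMo
      have h4 : M % 4 = 1 ∨ M % 4 = 3 := by omega
      rw [Nat.mul_mod, Nat.mul_mod 3 M]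
      have h5 : m % 4 = 0 ∨ m % 4 = 1 ∨ m % 4 = 2 ∨ m % 4 = 3 := by omega
      rcases h4 with h | h <;> rcases h5 with h' | h' | h' | h' <;> simp [h, h']
    by_cases h3 : m % 4 = ρ
    swap
    · rw [if_neg fun h => h3 (hmod.1 h), if_neg fun h => h3 h.2.1]; ring
    by_cases h4 : m.Coprime M
    swap
    · rw [if_neg h4, ite_self, if_neg fun h => h4 h.2.2]; ring
    rw [if_pos (hmod.2 h3), if_pos h4, if_pos ⟨h2, h3, h4⟩]
    have hmo : Odd m := by rw [Nat.odd_iff]; omega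
    rw [link_eq L v hMo hmo h4, h3, hκ]
    ring
  simp only [hterm]
  rw [sum_mul_le_eq hMpos N, ← Finset.mul_sum, abs_mul]
  refine mul_le_mul hκle ?_ (abs_nonneg _) (hw_nonneg hc M)
  exact hK (Fintype.card ι) M Q z (N / M) ρ hρ13 (by omega) (hMs.squarefree_of_dvd hQM)
    (hMo.of_dvd_nat hQM) hQ1 hQz hz

/-- Tuples with a large variable linked to a small one but to no large one. -/
lemma abs_patSum_le_of_small {ι : Type*} [Fintype ι] [DecidableEq ι] {c δ : ℝ} (hc : 0 ≤ c)
    (hδ : 0 < δ) (hδ1 : δ ≤ 1) : ∃ K : ℕ, ∀ (L : ι → ι → ℕ), (∀ x, L x x = 0) →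
      ∀ (π : ι → Fin 3) (u v : ι), π u = 1 → π v = 2 → Odd (L v u + L u v) →
      (∀ x, π x = 2 → Even (L v x + L x v)) → ∀ (N z : ℕ), 1 ≤ N → 1 ≤ z →
      |patSum c L N z π| ≤ K * (N / (1 + Real.log N)) * (1 + Real.log N) ^ δ *
          (1 + Real.log N) ^ (c * ((univ.erase v).filter fun x => π x = 2).card) *
          (1 + Real.log z) ^ K + K * (N * (1 + Real.log N) ^ K / z) := by
  obtain ⟨K₀, hK₀⟩ := abs_sum_update_le (ι := ι) hc
  obtain ⟨K₁, hK₁0, hK₁⟩ := sum_tuple_erase_le (ι := ι) δ hδ hδ1 (max 1 c) (le_max_left _ _)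
  obtain ⟨K₂, hK₂1, hK₂⟩ := prod_sum_levMaj_le (ι := ι) hc
  obtain ⟨K₃, hK₃⟩ := sum_piFinset_prod_hw_div_le (ι := ι) (by positivity : 0 ≤ 2 * c)
  set r : ℝ := Fintype.card ι + 4 with hr
  set A : ℝ := K₀ * r ^ K₀ * K₁ * K₂ with hA
  have hr0 : 0 ≤ r := by positivity
  have hA0 : 0 ≤ A := by positivity
  refine ⟨⌈A⌉₊ + K₀ * K₃ + (K₀ + K₂) + (K₀ + K₃),
    fun L hL π u v hu hv hLuv hLe N z hN hz => ?_⟩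
  set K := ⌈A⌉₊ + K₀ * K₃ + (K₀ + K₂) + (K₀ + K₃) with hK
  have hN1 := one_le_one_add_log N
  have hz1 := one_le_one_add_log z
  have hz0 : (0 : ℝ) < z := by exact_mod_cast hz
  set ℓ := 1 + Real.log N with hℓ
  set t := Function.update (fun _ : ι => Icc 1 N) v {1} with ht
  have htsub : ∀ x, t x ⊆ Icc 1 N := by
    intro x
    by_cases hx : x = v
    · rw [ht, hx, Function.update_self, Finset.singleton_subset_iff, Finset.mem_Icc]; omega
    · rw [ht, Function.update_of_ne hx]
  set Fm : (ι → ℕ) → ℝ := fun D => if ∏ x ∈ univ.erase v, D x ≤ N then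
      (∏ x ∈ univ.erase v, levMaj c z π x (D x)) *
        (((N / ∏ x ∈ univ.erase v, D x : ℕ) : ℝ) /
          (1 + Real.log (N / ∏ x ∈ univ.erase v, D x : ℕ))) else 0 with hFm
  have hinner : ∀ D ∈ Fintype.piFinset t, |∑ m ∈ Icc 1 N,
      if ∏ x, Function.update D v m x ≤ N ∧
          ∀ x, lev z (Function.update D v m x) = π x then wt c L (Function.update D v m) else 0| ≤
      K₀ * (r * (1 + Real.log z)) ^ K₀ * Fm D +
        K₀ * (N * ℓ ^ K₀ / z) * ∏ x, (hw (2 * c) (D x) / D x) := by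
    intro D hD
    rw [Fintype.mem_piFinset] at hD
    have hDv : D v = 1 := by simpa [ht] using hD v
    have hDpos : ∀ x, 1 ≤ D x := fun x => (Finset.mem_Icc.1 (htsub x (hD x))).1
    have hmaj0 : ∀ x m, 0 ≤ levMaj c z π x m := fun x m =>
      (isWeight_levMaj hc le_rfl z π x).nonneg m
    have hF0 : 0 ≤ Fm D := by
      rw [hFm]
      dsimp only
      have hY1 := one_le_one_add_log (N / ∏ x ∈ univ.erase v, D x)
      split_ifs
      · exact mul_nonneg (Finset.prod_nonneg fun x _ => hmaj0 x _) (by positivity)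
      · exact le_rfl
    have hprod0 : 0 ≤ ∏ x, (hw (2 * c) (D x) / D x) := Finset.prod_nonneg fun x _ =>
      div_nonneg (hw_nonneg (by positivity) _) (by positivity)
    refine (hK₀ L hL π u v hu hv hLuv hLe N z D hz hDpos hDv).trans ?_
    have hMe : ∏ x ∈ univ.erase v, D x = ∏ x, D x := Finset.prod_erase _ hDv
    set M := ∏ x, D x with hM
    have hMpos : 1 ≤ M := Finset.one_le_prod' fun x _ => hDpos x
    have hM0 : (0 : ℝ) < M := by exact_mod_cast hMpos
    split_ifs with hP
    swap
    · positivity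
    have hY1 := one_le_one_add_log (N / M)
    have hYℓ : 1 + Real.log (N / M : ℕ) ≤ ℓ := one_add_log_mono (Nat.div_le_self N M)
    have hwM := hw_nonneg hc M
    have hfirst : hw c M * (((N / M : ℕ) : ℝ) / (1 + Real.log (N / M : ℕ))) ≤ Fm D := by
      rw [hFm]
      dsimp only
      rw [hMe]
      by_cases hMN : M ≤ N
      · rw [if_pos hMN]
        refine mul_le_mul_of_nonneg_right ?_ (by positivity)
        rw [← hMe]
        refine (hw_prod_le hc D _).trans (Finset.prod_le_prod (fun x _ => hw_nonneg hc _)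
          fun x hx => ?_)
        rw [levMaj_of_lev hz (hP x (Finset.ne_of_mem_erase hx))]
      · rw [if_neg hMN, Nat.div_eq_of_lt (by omega)]
        simp
    have hsecond : hw c M * 2 ^ M.primeFactors.card * (((N / M : ℕ) : ℝ) /
        (1 + Real.log (N / M : ℕ))) ≤ N * ∏ x, (hw (2 * c) (D x) / D x) := by
      have h1 : ((N / M : ℕ) : ℝ) / (1 + Real.log (N / M : ℕ)) ≤ N / M :=
        (div_le_self (by positivity) hY1).trans Nat.cast_div_le
      have h2 : hw c M * 2 ^ M.primeFactors.card ≤ ∏ x, hw (2 * c) (D x) :=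
        (hw_mul_two_pow_le c M).trans (hw_prod_le (by positivity) D univ)
      calc _ ≤ (∏ x, hw (2 * c) (D x)) * (N / M) := by
            refine mul_le_mul h2 h1 (by positivity) (Finset.prod_nonneg fun x _ =>
              hw_nonneg (by positivity) _)
        _ = _ := by
            rw [Finset.prod_div_distrib, hM]
            push_cast
            ring
    calc hw c M * (K₀ * (((N / M : ℕ) : ℝ) / (1 + Real.log (N / M : ℕ))) *
          ((r * (1 + Real.log z)) ^ K₀ + 2 ^ M.primeFactors.card / z *
            (1 + Real.log (N / M : ℕ)) ^ K₀))
        = K₀ * (r * (1 + Real.log z)) ^ K₀ *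
            (hw c M * (((N / M : ℕ) : ℝ) / (1 + Real.log (N / M : ℕ)))) +
          K₀ * ((1 + Real.log (N / M : ℕ)) ^ K₀ / z) * (hw c M * 2 ^ M.primeFactors.card *
            (((N / M : ℕ) : ℝ) / (1 + Real.log (N / M : ℕ)))) := by ring
      _ ≤ K₀ * (r * (1 + Real.log z)) ^ K₀ * Fm D +
          K₀ * (ℓ ^ K₀ / z) * (N * ∏ x, (hw (2 * c) (D x) / D x)) := by gcongr
      _ = _ := by ring
  have hsum : patSum c L N z π = ∑ D ∈ Fintype.piFinset t, ∑ m ∈ Icc 1 N,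
      if ∏ x, Function.update D v m x ≤ N ∧
          ∀ x, lev z (Function.update D v m x) = π x then
        wt c L (Function.update D v m) else 0 := by
    unfold patSum
    rw [sum_piFinset_isolate _ v]
  rw [hsum]
  refine (Finset.abs_sum_le_sum_abs _ _).trans ((Finset.sum_le_sum hinner).trans ?_)
  rw [Finset.sum_add_distrib, ← Finset.mul_sum, ← Finset.mul_sum]
  have h1 := hK₁ (levMaj c z π) v
    (fun x => isWeight_levMaj hc (le_max_right _ _) z π x) N hN
  have h2 := hK₂ z π N (univ.erase v)
  have h3 := hK₃ N t htsub
  set E := c * ((univ.erase v).filter fun x => π x = 2).card with hE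
  have hAK : A ≤ K := by
    refine (Nat.le_ceil A).trans ?_
    exact_mod_cast (by omega : ⌈A⌉₊ ≤ K)
  have hBK : ((K₀ * K₃ : ℕ) : ℝ) ≤ K := by exact_mod_cast (by omega : K₀ * K₃ ≤ K)
  have hzK : (1 + Real.log z) ^ (K₀ + K₂) ≤ (1 + Real.log z) ^ K :=
    pow_le_pow_right₀ hz1 (by omega)
  have hℓK : ℓ ^ (K₀ + K₃) ≤ ℓ ^ K := pow_le_pow_right₀ hN1 (by omega)
  refine add_le_add ?_ ?_
  · calc K₀ * (r * (1 + Real.log z)) ^ K₀ * ∑ D ∈ Fintype.piFinset t, Fm D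
        ≤ K₀ * (r * (1 + Real.log z)) ^ K₀ * (K₁ * (N / ℓ) * ℓ ^ δ *
          (K₂ * ℓ ^ E * (1 + Real.log z) ^ K₂)) := by
          refine mul_le_mul_of_nonneg_left (h1.trans ?_) (by positivity)
          gcongr
      _ = A * (N / ℓ) * ℓ ^ δ * ℓ ^ E * (1 + Real.log z) ^ (K₀ + K₂) := by
          rw [hA, mul_pow]; ring
      _ ≤ _ := by gcongr
  · calc _ ≤ K₀ * (N * ℓ ^ K₀ / z) * (K₃ * ℓ ^ K₃) := by gcongr
      _ = (K₀ * K₃ : ℕ) * (N * ℓ ^ (K₀ + K₃) / z) := by push_cast; ring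
      _ ≤ _ := by gcongr

/-! ### Colourings of the primes of a squarefree integer -/

section Colouring

variable {ι : Type*} [Fintype ι] [DecidableEq ι]

/-- The product of the primes of a given colour. -/
def fib {n : ℕ} (φ : n.primeFactors → ι) (u : ι) : ℕ := ∏ p with φ p = u, (p : ℕ)

lemma prod_fib {n : ℕ} (hn : Squarefree n) (φ : n.primeFactors → ι) : ∏ u, fib φ u = n := by
  unfold fib
  rw [Finset.prod_fiberwise (s := univ) (g := φ) (f := fun p => (p : ℕ)),
    Finset.prod_coe_sort n.primeFactors fun p => p, Nat.prod_primeFactors_of_squarefree hn]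

lemma fib_pos {n : ℕ} (φ : n.primeFactors → ι) (u : ι) : 0 < fib φ u :=
  Finset.prod_pos fun p _ => (Nat.prime_of_mem_primeFactors p.2).pos

lemma dvd_fib_iff {n : ℕ} (φ : n.primeFactors → ι) (u : ι) (p : n.primeFactors) :
    (p : ℕ) ∣ fib φ u ↔ φ p = u := by
  have hp := Nat.prime_of_mem_primeFactors p.2
  unfold fib
  constructor
  · intro h
    obtain ⟨q, hq, hpq⟩ := (Nat.Prime.prime hp).exists_mem_finset_dvd h
    have h1 := (Nat.prime_dvd_prime_iff_eq hp (Nat.prime_of_mem_primeFactors q.2)).1 hpq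
    rw [Subtype.ext h1]
    exact (Finset.mem_filter.1 hq).2
  · intro h
    exact Finset.dvd_prod_of_mem (fun p : n.primeFactors => (p : ℕ))
      (Finset.mem_filter.2 ⟨Finset.mem_univ p, h⟩)

lemma fib_ne_one_iff {n : ℕ} (φ : n.primeFactors → ι) (u : ι) :
    fib φ u ≠ 1 ↔ u ∈ Set.range φ := by
  constructor
  · intro h
    by_contra h1
    refine h (Finset.prod_eq_one fun p hp => ?_)
    exact absurd ⟨p, (Finset.mem_filter.1 hp).2⟩ h1
  · rintro ⟨p, hp⟩ h
    have := (dvd_fib_iff φ u p).2 hp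
    rw [h, Nat.dvd_one] at this
    exact (Nat.prime_of_mem_primeFactors p.2).one_lt.ne' this

lemma primeFactors_fib {n : ℕ} (hn : Squarefree n) (φ : n.primeFactors → ι) (u : ι) :
    (fib φ u).primeFactors = (univ.filter fun p => φ p = u).map (Function.Embedding.subtype _) := by
  ext q
  rw [Nat.mem_primeFactors, Finset.mem_map]
  constructor
  · rintro ⟨hq, hqd, _⟩
    have hqn : q ∈ n.primeFactors := by
      rw [Nat.mem_primeFactors]
      refine ⟨hq, ?_, hn.ne_zero⟩
      rw [← prod_fib hn φ]
      exact hqd.trans (Finset.dvd_prod_of_mem _ (Finset.mem_univ u))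
    exact ⟨⟨q, hqn⟩, Finset.mem_filter.2 ⟨Finset.mem_univ _, (dvd_fib_iff φ u ⟨q, hqn⟩).1 hqd⟩, rfl⟩
  · rintro ⟨p, hp, rfl⟩
    exact ⟨Nat.prime_of_mem_primeFactors p.2,
      (dvd_fib_iff φ u p).2 (Finset.mem_filter.1 hp).2, (fib_pos φ u).ne'⟩

lemma coprime_of_prod_squarefree {D : ι → ℕ} (hD : Squarefree (∏ u, D u)) {u v : ι} (huv : u ≠ v) :
    (D u).Coprime (D v) := by
  have h : D u * D v ∣ ∏ x, D x := by
    rw [← Finset.prod_pair huv]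
    exact Finset.prod_dvd_prod_of_subset _ _ _ (Finset.subset_univ _)
  exact Nat.coprime_of_squarefree_mul (hD.squarefree_of_dvd h)

lemma fib_injective {n : ℕ} : Function.Injective (fib : (n.primeFactors → ι) → ι → ℕ) := by
  intro φ ψ h
  ext p
  have h1 := (dvd_fib_iff φ (φ p) p).2 rfl
  rw [h] at h1
  exact ((dvd_fib_iff ψ (φ p) p).1 h1).symm

lemma exists_fib_eq {n : ℕ} (hn : Squarefree n) {D : ι → ℕ} (hD : ∏ u, D u = n) :
    ∃ φ : n.primeFactors → ι, fib φ = D := by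
  have hex : ∀ p : n.primeFactors, ∃ u, (p : ℕ) ∣ D u := by
    intro p
    have h1 : (p : ℕ) ∣ ∏ u, D u := by
      rw [hD]
      exact Nat.dvd_of_mem_primeFactors p.2
    obtain ⟨u, _, hu⟩ := (Nat.prime_of_mem_primeFactors p.2).prime.exists_mem_finset_dvd h1
    exact ⟨u, hu⟩
  choose φ hφ using hex
  refine ⟨φ, funext fun u => ?_⟩
  have hDn : D u ∣ n := hD ▸ Finset.dvd_prod_of_mem D (Finset.mem_univ u)
  have hDs : Squarefree (D u) := hn.squarefree_of_dvd hDn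
  have hfs : Squarefree (fib φ u) := hn.squarefree_of_dvd <| by
    conv_rhs => rw [← prod_fib hn φ]
    exact Finset.dvd_prod_of_mem _ (Finset.mem_univ u)
  rw [← Nat.prod_primeFactors_of_squarefree hDs, ← Nat.prod_primeFactors_of_squarefree hfs]
  refine Finset.prod_congr ?_ fun _ _ => rfl
  rw [primeFactors_fib hn]
  ext q
  rw [Finset.mem_map, Nat.mem_primeFactors]
  constructor
  · rintro ⟨p, hp, rfl⟩
    refine ⟨Nat.prime_of_mem_primeFactors p.2, ?_, hDs.ne_zero⟩
    rw [← (Finset.mem_filter.1 hp).2]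
    exact hφ p
  · rintro ⟨hq, hqd, _⟩
    have hqn : q ∈ n.primeFactors := Nat.mem_primeFactors.2 ⟨hq, hqd.trans hDn, hn.ne_zero⟩
    refine ⟨⟨q, hqn⟩, Finset.mem_filter.2 ⟨Finset.mem_univ _, ?_⟩, rfl⟩
    by_contra h
    have h1 := coprime_of_prod_squarefree (hD ▸ hn) h
    have h2 := Nat.dvd_gcd (hφ ⟨q, hqn⟩) hqd
    rw [h1] at h2
    exact hq.one_lt.ne' (Nat.dvd_one.1 h2)

/-- Colourings of the primes of `n` correspond to factorizations of `n`. -/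
lemma sum_fib {n N : ℕ} (hn : Squarefree n) (hN : n ≤ N) (F : (ι → ℕ) → ℝ) :
    ∑ φ : n.primeFactors → ι, F (fib φ) =
      ∑ D ∈ Fintype.piFinset fun _ : ι => Icc 1 N, if ∏ u, D u = n then F D else 0 := by
  rw [← Finset.sum_filter]
  refine Finset.sum_bij (fun φ _ => fib φ) ?_ (fun φ _ ψ _ h => fib_injective h) ?_ fun _ _ => rfl
  · intro φ _
    rw [Finset.mem_filter, Fintype.mem_piFinset]
    refine ⟨fun u => Finset.mem_Icc.2 ⟨fib_pos φ u, ?_⟩, prod_fib hn φ⟩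
    refine (Nat.le_of_dvd hn.ne_zero.bot_lt ?_).trans hN
    conv_rhs => rw [← prod_fib hn φ]
    exact Finset.dvd_prod_of_mem _ (Finset.mem_univ u)
  · intro D hD
    obtain ⟨φ, hφ⟩ := exists_fib_eq hn (Finset.mem_filter.1 hD).2
    exact ⟨φ, Finset.mem_univ _, hφ⟩

lemma jr_prod_left {κ : Type*} (f : κ → ℕ) (s : Finset κ) (n : ℕ) :
    ∏ x ∈ s, jr (f x) n = jr (∏ x ∈ s, f x) n := by
  induction s using Finset.induction_on with
  | empty => simp [jr_one_left]
  | insert b s hb ih => rw [Finset.prod_insert hb, Finset.prod_insert hb, jr_mul_left, ih]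

lemma jr_fib {n : ℕ} (φ : n.primeFactors → ι) (u v : ι) :
    jr (fib φ u) (fib φ v) = ∏ p with φ p = u, ∏ q with φ q = v, jr (p : ℕ) (q : ℕ) := by
  unfold fib
  rw [← jr_prod_left]
  refine Finset.prod_congr rfl fun p _ => ?_
  rw [jr_prod_right]
  exact fun q _ => (Nat.prime_of_mem_primeFactors q.2).ne_zero

lemma charProd_fib {n : ℕ} (L : ι → ι → ℕ) (φ : n.primeFactors → ι) :
    charProd L (fib φ) = ∏ p, ∏ q, jr (p : n.primeFactors) (q : n.primeFactors) ^ L (φ p) (φ q) := by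
  unfold charProd
  rw [← Finset.prod_fiberwise (s := univ) (g := φ)
    (f := fun p => ∏ q, jr (p : ℕ) ((q : n.primeFactors) : ℕ) ^ L (φ p) (φ q))]
  refine Finset.prod_congr rfl fun u _ => ?_
  rw [Finset.prod_congr rfl fun v _ => by rw [jr_fib, ← Finset.prod_pow], Finset.prod_comm]
  refine Finset.prod_congr rfl fun p hp => ?_
  rw [← Finset.prod_fiberwise (s := univ) (g := φ)
    (f := fun q => jr (p : ℕ) ((q : n.primeFactors) : ℕ) ^ L (φ p) (φ q))]
  refine Finset.prod_congr rfl fun v _ => ?_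
  rw [← Finset.prod_pow]
  refine Finset.prod_congr rfl fun q hq => ?_
  rw [(Finset.mem_filter.1 hp).2, (Finset.mem_filter.1 hq).2]

end Colouring

/-- The exponent of the symbol `(p/q)` attached to the colours of `p` and `q`. -/
def linkExp (x y : Fin 3 × Bool) : ℕ := if x.2 = true ∧ x.1 ≠ y.1 then 1 else 0

/-- The exponents attached to tuples of colours. -/
def linkExpSum {k : ℕ} (u v : Idx k) : ℕ := ∑ s, linkExp (u s) (v s)

lemma linkExpSum_self {k : ℕ} (u : Idx k) : linkExpSum u u = 0 :=
  Finset.sum_eq_zero fun s _ => if_neg fun h => h.2 rfl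

lemma linkParity_eq {k : ℕ} (u v : Idx k) :
    linkParity u v = ((linkExpSum u v + linkExpSum v u : ℕ) : ZMod 2) := by
  unfold linkParity linkExpSum
  push_cast
  rw [← Finset.sum_add_distrib]
  refine Finset.sum_congr rfl fun s _ => ?_
  generalize u s = x
  generalize v s = y
  revert x y
  unfold linkOne linkExp
  rintro ⟨i, a⟩ ⟨j, b⟩
  by_cases h : i = j
  · simp [h]
  · cases a <;> cases b <;> simp [h, Ne.symm h]
    decide

/-- The sum over the colourings whose range satisfies a given condition. -/
def colSum (Q : Set (Fin 3 × Bool) → Prop) (n : ℕ) : ℝ :=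
  ∑ φ : n.primeFactors → Fin 3 × Bool, if Q (Set.range φ) then
    ∏ p, ∏ q, jr (p : n.primeFactors) (q : n.primeFactors) ^ linkExp (φ p) (φ q) else 0

/-- The condition imposed on the support of a tuple. -/
def supCond {k : ℕ} (Q : Set (Fin 3 × Bool) → Prop) (S : Set (Idx k)) : Prop :=
  ∀ s, Q ((fun u : Idx k => u s) '' S)

lemma colSum_pow (k : ℕ) (Q : Set (Fin 3 × Bool) → Prop) (n : ℕ) :
    colSum Q n ^ k = ∑ φ : n.primeFactors → Idx k, if supCond Q {u | fib φ u ≠ 1} then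
      charProd linkExpSum (fib φ) else 0 := by
  unfold colSum
  rw [Fintype.sum_pow, ← (Equiv.piComm fun (_ : n.primeFactors) (_ : Fin k) => Fin 3 × Bool).sum_comp]
  refine Finset.sum_congr rfl fun φ _ => ?_
  have hset : {u | fib φ u ≠ 1} = Set.range φ := by
    ext u; exact fib_ne_one_iff φ u
  have hran : ∀ s, Set.range (fun p => φ p s) = (fun u : Idx k => u s) '' Set.range φ := by
    intro s
    rw [← Set.range_comp]
    rfl
  rw [hset, charProd_fib]
  simp only [Equiv.piComm_apply]
  by_cases h : supCond Q (Set.range φ)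
  · rw [if_pos h, Finset.prod_congr rfl fun s _ => if_pos ((hran s).symm ▸ h s)]
    rw [Finset.prod_comm]
    refine Finset.prod_congr rfl fun p _ => ?_
    rw [Finset.prod_comm]
    refine Finset.prod_congr rfl fun q _ => ?_
    rw [Finset.prod_pow_eq_pow_sum]
    rfl
  · rw [if_neg h]
    unfold supCond at h
    push Not at h
    obtain ⟨s, hs⟩ := h
    refine Finset.prod_eq_zero (Finset.mem_univ s) (if_neg ?_)
    exact fun h1 => hs ((hran s) ▸ h1)

lemma sum_hw_mul_colSum_pow (k : ℕ) (Q : Set (Fin 3 × Bool) → Prop) (c : ℝ) (N : ℕ) :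
    ∑ n ∈ Icc 1 N, (if n % 4 = 3 then hw c n else 0) * colSum Q n ^ k =
      ∑ D ∈ Fintype.piFinset fun _ : Idx k => Icc 1 N, if ∏ u, D u ≤ N then
        (if supCond Q {u | D u ≠ 1} then wt c linkExpSum D else 0) else 0 := by
  have h1 : ∀ n ∈ Icc 1 N, (if n % 4 = 3 then hw c n else 0) * colSum Q n ^ k =
      ∑ D ∈ Fintype.piFinset fun _ : Idx k => Icc 1 N, if ∏ u, D u = n then
        (if supCond Q {u | D u ≠ 1} then wt c linkExpSum D else 0) else 0 := by
    intro n hn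
    have hnN := (Finset.mem_Icc.1 hn).2
    by_cases hs : Squarefree n
    · rw [colSum_pow, sum_fib hs hnN fun D =>
        if supCond Q {u | D u ≠ 1} then charProd linkExpSum D else 0, Finset.mul_sum]
      refine Finset.sum_congr rfl fun D _ => ?_
      by_cases h2 : ∏ u, D u = n
      swap
      · rw [if_neg h2, if_neg h2, mul_zero]
      rw [if_pos h2, if_pos h2]
      have h3 : wt c linkExpSum D = (if n % 4 = 3 then hw c n else 0) * charProd linkExpSum D := by
        unfold wt
        simp only [h2]
      by_cases h4 : supCond Q {u | D u ≠ 1}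
      · rw [if_pos h4, if_pos h4, h3]
      · rw [if_neg h4, if_neg h4, mul_zero]
    · rw [hw_of_not_squarefree hs, ite_self, zero_mul]
      symm
      refine Finset.sum_eq_zero fun D _ => ?_
      by_cases h2 : ∏ u, D u = n
      swap
      · rw [if_neg h2]
      have h3 : wt c linkExpSum D = 0 := by
        unfold wt
        rw [h2, hw_of_not_squarefree hs, ite_self, zero_mul]
      rw [if_pos h2, h3, ite_self]
  rw [Finset.sum_congr rfl h1, Finset.sum_comm]
  refine Finset.sum_congr rfl fun D hD => ?_
  rw [Fintype.mem_piFinset] at hD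
  have hpos : 1 ≤ ∏ u, D u := Finset.one_le_prod' fun u _ => (Finset.mem_Icc.1 (hD u)).1
  rw [Finset.sum_ite_eq]
  simp only [Finset.mem_Icc, hpos, true_and]

/-! ### The moments in terms of colourings -/

/-- The fundamental discriminant `±m` attached to an odd squarefree `m`. -/
def oddDisc (m : ℕ) : ℤ := if m % 4 = 1 then m else -m

lemma natAbs_oddDisc (m : ℕ) : (oddDisc m).natAbs = m := by
  unfold oddDisc; split_ifs <;> simp

lemma oddDisc_mod {m : ℕ} (hm : Odd m) : oddDisc m % 4 = 1 := by
  rw [Nat.odd_iff] at hm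
  unfold oddDisc; split_ifs <;> omega

lemma oddDisc_eq_one_iff (m : ℕ) : oddDisc m = 1 ↔ m = 1 := by
  unfold oddDisc; split_ifs <;> omega

lemma oddDisc_natAbs {d : ℤ} (hd : d % 4 = 1) : oddDisc d.natAbs = d := by
  unfold oddDisc; split_ifs <;> omega

lemma oddDisc_mul {a b : ℕ} (ha : Odd a) (hb : Odd b) :
    oddDisc (a * b) = oddDisc a * oddDisc b := by
  rw [Nat.odd_iff] at ha hb
  have ha' : a % 4 = 1 ∨ a % 4 = 3 := by omega
  have hb' : b % 4 = 1 ∨ b % 4 = 3 := by omega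
  unfold oddDisc
  rw [Nat.mul_mod]
  rcases ha' with h | h <;> rcases hb' with h' | h' <;> simp [h, h']

lemma kron_oddDisc {m p : ℕ} (hm : Odd m) (hp : Odd p) : ((kron (oddDisc m) p : ℤ) : ℝ) = jr p m := by
  have hm' := Nat.odd_iff.1 hm
  have hp' := Nat.odd_iff.1 hp
  rw [kron, if_neg (by rintro rfl; omega)]
  have hrec : (jacobiSym m p : ℝ) = (-1) ^ (m / 2 * (p / 2)) * jr p m := jr_reciprocity hm hp
  by_cases h : m % 4 = 1
  · rw [oddDisc, if_pos h, hrec, Even.neg_one_pow, one_mul]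
    rw [Nat.even_mul, Nat.even_iff]
    left; omega
  · rw [oddDisc, if_neg h, jacobiSym.neg _ hp, ZMod.χ₄_eq_neg_one_pow hp']
    push_cast
    rw [hrec, ← mul_assoc, ← pow_add, Even.neg_one_pow, one_mul]
    rw [Nat.even_add, Nat.even_mul, Nat.even_iff, Nat.even_iff]
    have : m / 2 % 2 = 1 := by omega
    simp [this]

lemma isFundDisc_oddDisc {m : ℕ} (hm : Odd m) (hs : Squarefree m) : IsFundDisc (oddDisc m) :=
  Or.inl ⟨oddDisc_mod hm, by rw [← Int.squarefree_natAbs, natAbs_oddDisc]; exact hs⟩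

/-- Membership in the set of triples, for products of discriminants of factors. -/
lemma mem_fdTriples_oddDisc {n : ℕ} (hn : Squarefree n) (h4 : n % 4 = 3) {D : Fin 3 → ℕ}
    (hD : ∏ i, D i = n) (h1 : ∀ i, D i ≠ 1) :
    (oddDisc (D 0), oddDisc (D 1), oddDisc (D 2)) ∈ fdTriples (-(n : ℤ)) := by
  have hno : Odd n := by rw [Nat.odd_iff]; omega
  have hdvd : ∀ i, D i ∣ n := fun i => hD ▸ Finset.dvd_prod_of_mem D (Finset.mem_univ i)
  have hodd : ∀ i, Odd (D i) := fun i => hno.of_dvd_nat (hdvd i)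
  have hsq : ∀ i, Squarefree (D i) := fun i => hn.squarefree_of_dvd (hdvd i)
  have hcop : ∀ i j, i ≠ j → IsCoprime (oddDisc (D i)) (oddDisc (D j)) := fun i j hij => by
    rw [Int.isCoprime_iff_nat_coprime, natAbs_oddDisc, natAbs_oddDisc]
    exact coprime_of_prod_squarefree (hD.symm ▸ hn) hij
  have hmem : ∀ i, oddDisc (D i) ∈ Icc (-((-(n : ℤ)).natAbs : ℤ)) ((-(n : ℤ)).natAbs : ℤ) := by
    intro i
    have h2 := Nat.le_of_dvd hn.ne_zero.bot_lt (hdvd i)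
    have h3 := natAbs_oddDisc (D i)
    rw [Finset.mem_Icc]
    constructor <;> omega
  unfold fdTriples
  rw [Finset.mem_filter, Finset.mem_product, Finset.mem_product]
  refine ⟨⟨hmem 0, hmem 1, hmem 2⟩, isFundDisc_oddDisc (hodd 0) (hsq 0),
    isFundDisc_oddDisc (hodd 1) (hsq 1), isFundDisc_oddDisc (hodd 2) (hsq 2),
    (oddDisc_eq_one_iff _).not.2 (h1 0), (oddDisc_eq_one_iff _).not.2 (h1 1),
    (oddDisc_eq_one_iff _).not.2 (h1 2), hcop 0 1 (by decide), hcop 0 2 (by decide),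
    hcop 1 2 (by decide), ?_⟩
  dsimp only
  rw [← oddDisc_mul (hodd 0) (hodd 1), ← oddDisc_mul ((hodd 0).mul (hodd 1)) (hodd 2),
    ← Fin.prod_univ_three, hD, oddDisc, if_neg (by omega)]

lemma eq_of_mem_fdTriples {n : ℕ} (h4 : n % 4 = 3) {t : ℤ × ℤ × ℤ}
    (ht : t ∈ fdTriples (-(n : ℤ))) : ∃ D : Fin 3 → ℕ, ∏ i, D i = n ∧ (∀ i, D i ≠ 1) ∧
      (oddDisc (D 0), oddDisc (D 1), oddDisc (D 2)) = t := by
  unfold fdTriples at ht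
  obtain ⟨d₀, d₁, d₂⟩ := t
  rw [Finset.mem_filter] at ht
  obtain ⟨-, f0, f1, f2, n0, n1, n2, -, -, -, hp⟩ := ht
  dsimp only at f0 f1 f2 n0 n1 n2 hp
  have hodd : Odd (d₀ * d₁ * d₂) := by
    rw [hp, Int.odd_iff]; omega
  rw [Int.odd_mul, Int.odd_mul] at hodd
  have hmod : ∀ d : ℤ, Odd d → IsFundDisc d → d % 4 = 1 := by
    rintro d hd (h | ⟨m, hm, -⟩)
    · exact h.1
    · rw [Int.odd_iff] at hd; omega
  have m0 := oddDisc_natAbs (hmod d₀ hodd.1.1 f0)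
  have m1 := oddDisc_natAbs (hmod d₁ hodd.1.2 f1)
  have m2 := oddDisc_natAbs (hmod d₂ hodd.2 f2)
  refine ⟨![d₀.natAbs, d₁.natAbs, d₂.natAbs], ?_, ?_, ?_⟩
  · rw [Fin.prod_univ_three]
    have := congrArg Int.natAbs hp
    rw [Int.natAbs_mul, Int.natAbs_mul] at this
    simpa using this
  · intro i
    fin_cases i
    · show d₀.natAbs ≠ 1
      rw [← (oddDisc_eq_one_iff _).ne, m0]; exact n0
    · show d₁.natAbs ≠ 1
      rw [← (oddDisc_eq_one_iff _).ne, m1]; exact n1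
    · show d₂.natAbs ≠ 1
      rw [← (oddDisc_eq_one_iff _).ne, m2]; exact n2
  · simp [m0, m1, m2]

lemma tripleTerm_fib {n : ℕ} (hn : Squarefree n) (h4 : n % 4 = 3) (φ : n.primeFactors → Fin 3) :
    (tripleTerm (oddDisc (fib φ 0), oddDisc (fib φ 1), oddDisc (fib φ 2)) : ℝ) =
      ∏ p, (1 + ∏ q, jr (p : n.primeFactors) (q : n.primeFactors) ^
        (if φ p ≠ φ q then 1 else 0)) := by
  have hno : Odd n := by rw [Nat.odd_iff]; omega
  have hdvd : ∀ i, fib φ i ∣ n := fun i => by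
    conv_rhs => rw [← prod_fib hn φ]
    exact Finset.dvd_prod_of_mem _ (Finset.mem_univ i)
  have hodd : ∀ i, Odd (fib φ i) := fun i => hno.of_dvd_nat (hdvd i)
  have hpo : ∀ p : n.primeFactors, Odd (p : ℕ) := fun p =>
    hno.of_dvd_nat (Nat.dvd_of_mem_primeFactors p.2)
  have hterm : ∀ i j l : Fin 3, (∀ x, x ≠ i ↔ x = j ∨ x = l) → j ≠ l →
      ((∏ p ∈ (fib φ i).primeFactors, (1 + kron (oddDisc (fib φ j) * oddDisc (fib φ l)) p) : ℤ) : ℝ)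
        = ∏ p with φ p = i, (1 + ∏ q, jr (p : n.primeFactors) (q : n.primeFactors) ^
        (if φ p ≠ φ q then 1 else 0)) := by
    intro i j l h hjl
    rw [primeFactors_fib hn, Finset.prod_map]
    push_cast
    refine Finset.prod_congr rfl fun p hp => ?_
    have hpi := (Finset.mem_filter.1 hp).2
    congr 1
    rw [← oddDisc_mul (hodd j) (hodd l)]
    refine (kron_oddDisc ((hodd j).mul (hodd l)) (hpo p)).trans ?_
    rw [jr_mul_right _ (fib_pos φ j).ne' (fib_pos φ l).ne']
    have hfib : ∀ i, jr (p : ℕ) (fib φ i) = ∏ q with φ q = i, jr (p : ℕ) (q : n.primeFactors) := by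
      intro i
      rw [jr_prod_right]
      · rfl
      · exact fun q _ => (Nat.prime_of_mem_primeFactors q.2).ne_zero
    show jr (p : ℕ) (fib φ j) * jr (p : ℕ) (fib φ l) = _
    rw [hfib, hfib, ← Finset.prod_union]
    · rw [← Finset.filter_or, Finset.prod_filter]
      refine Finset.prod_congr rfl fun q _ => ?_
      have h2 : (φ q = j ∨ φ q = l) ↔ φ p ≠ φ q := by rw [← h, hpi, ne_comm]
      by_cases h3 : φ p ≠ φ q
      · rw [if_pos (h2.2 h3), if_pos h3, pow_one]
      · rw [if_neg fun h4 => h3 (h2.1 h4), if_neg h3, pow_zero]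
    · rw [Finset.disjoint_filter]
      exact fun q _ h1 h2 => hjl (h1.symm.trans h2)
  unfold tripleTerm
  dsimp only
  rw [natAbs_oddDisc, natAbs_oddDisc, natAbs_oddDisc, Int.cast_mul, Int.cast_mul,
    hterm 2 0 1 (by decide) (by decide), hterm 1 0 2 (by decide) (by decide),
    hterm 0 1 2 (by decide) (by decide), ← Finset.prod_fiberwise (s := univ) (g := φ),
    Fin.prod_univ_three]
  ring

lemma sum_tripleTerm {n : ℕ} (hn : Squarefree n) (h4 : n % 4 = 3) :
    ∑ t ∈ fdTriples (-(n : ℤ)), (tripleTerm t : ℝ) =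
      ∑ φ : n.primeFactors → Fin 3, if ∀ i, i ∈ Set.range φ then
        ∏ p, (1 + ∏ q, jr (p : n.primeFactors) (q : n.primeFactors) ^
          (if φ p ≠ φ q then 1 else 0)) else 0 := by
  rw [← Finset.sum_filter]
  symm
  refine Finset.sum_bij (fun φ _ => (oddDisc (fib φ 0), oddDisc (fib φ 1), oddDisc (fib φ 2)))
    ?_ ?_ ?_ fun φ _ => (tripleTerm_fib hn h4 φ).symm
  · intro φ hφ
    exact mem_fdTriples_oddDisc hn h4 (prod_fib hn φ) fun i =>
      (fib_ne_one_iff φ i).2 ((Finset.mem_filter.1 hφ).2 i)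
  · intro φ _ ψ _ h
    refine fib_injective (funext fun i => ?_)
    rw [Prod.mk.injEq, Prod.mk.injEq] at h
    fin_cases i
    · have := congrArg Int.natAbs h.1
      rwa [natAbs_oddDisc, natAbs_oddDisc] at this
    · have := congrArg Int.natAbs h.2.1
      rwa [natAbs_oddDisc, natAbs_oddDisc] at this
    · have := congrArg Int.natAbs h.2.2
      rwa [natAbs_oddDisc, natAbs_oddDisc] at this
  · intro t ht
    obtain ⟨D, hD, h1, rfl⟩ := eq_of_mem_fdTriples h4 ht
    obtain ⟨φ, rfl⟩ := exists_fib_eq hn hD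
    exact ⟨φ, Finset.mem_filter.2 ⟨Finset.mem_univ _, fun i => (fib_ne_one_iff φ i).1 (h1 i)⟩, rfl⟩

/-- Every first coordinate occurs. -/
def OntoFst (R : Set (Fin 3 × Bool)) : Prop := ∀ i, ∃ b, (i, b) ∈ R

/-- The second coordinate is constant. -/
def ConstSnd (R : Set (Fin 3 × Bool)) : Prop := ∃ b, ∀ x ∈ R, x.2 = b

lemma prod_linkExp_eq {n : ℕ} (φ : n.primeFactors → Fin 3) (b : n.primeFactors → Bool) :
    ∏ p, ∏ q, jr (p : n.primeFactors) (q : n.primeFactors) ^ linkExp (φ p, b p) (φ q, b q) =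
      ∏ p, if b p = true then ∏ q, jr (p : n.primeFactors) (q : n.primeFactors) ^
          (if φ p ≠ φ q then 1 else 0) else 1 := by
  refine Finset.prod_congr rfl fun p _ => ?_
  unfold linkExp
  cases h : b p <;> simp

lemma colSum_onto {n : ℕ} (hn : Squarefree n) (h4 : n % 4 = 3) :
    ftilde (-(n : ℤ)) = 1 / 48 * colSum OntoFst n := by
  have hα : alphaFD (-(n : ℤ)) = 0 := if_neg (by omega)
  unfold ftilde
  rw [hα, sum_tripleTerm hn h4]
  unfold colSum
  rw [← (Equiv.arrowProdEquivProdArrow n.primeFactors (fun _ => Fin 3)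
    (fun _ => Bool)).symm.sum_comp, Fintype.sum_prod_type]
  simp only [Equiv.arrowProdEquivProdArrow_symm_apply]
  norm_num only
  congr 1
  refine Finset.sum_congr rfl fun φ _ => ?_
  have hiff : ∀ b : n.primeFactors → Bool,
      OntoFst (Set.range fun p => (φ p, b p)) ↔ ∀ i, i ∈ Set.range φ := by
    intro b
    refine forall_congr' fun i => ?_
    constructor
    · rintro ⟨_, p, hp⟩
      exact ⟨p, congrArg Prod.fst hp⟩
    · rintro ⟨p, hp⟩
      exact ⟨b p, p, by rw [← hp]⟩
  have hiff' : ∀ b : n.primeFactors → Bool, OntoFst (Set.range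
      ((Equiv.arrowProdEquivProdArrow n.primeFactors (fun _ => Fin 3) (fun _ => Bool)).symm (φ, b)))
        ↔ ∀ i, i ∈ Set.range φ := hiff
  simp only [hiff', prod_linkExp_eq]
  by_cases h : ∀ i, i ∈ Set.range φ
  · rw [if_pos h]
    simp only [if_pos h]
    rw [← Fintype.piFinset_univ, ← Finset.prod_univ_sum (fun _ => univ) (fun p b => if b = true then
      ∏ q, jr (p : n.primeFactors) (q : n.primeFactors) ^ (if φ p ≠ φ q then 1 else 0) else 1)]
    refine Finset.prod_congr rfl fun p _ => ?_
    rw [Fintype.sum_bool, if_pos rfl, if_neg (by decide), add_comm]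
  · rw [if_neg h]
    simp only [if_neg h, Finset.sum_const_zero]

/-- The secondary term. -/
def secTerm (n : ℕ) : ℝ := ∏ p ∈ n.primeFactors, (2 + chi4 p)

lemma jr_mul_swap {a b : ℕ} (ha : Odd a) (hb : Odd b) (h : a.Coprime b) :
    jr a b * jr b a = if a % 4 = 3 ∧ b % 4 = 3 then -1 else 1 := by
  have ha0 : a ≠ 0 := by rintro rfl; exact absurd ha (by decide)
  rw [jr_reciprocity ha hb, mul_assoc, ← sq, jr_sq ha0 h.symm, mul_one]
  rw [Nat.odd_iff] at ha hb
  split_ifs with h3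
  · refine Odd.neg_one_pow ?_
    rw [Nat.odd_mul, Nat.odd_iff, Nat.odd_iff]
    omega
  · refine Even.neg_one_pow ?_
    rw [Nat.even_mul, Nat.even_iff, Nat.even_iff]
    omega

lemma charProd_three {D : Fin 3 → ℕ} (hs : Squarefree (∏ i, D i)) (h4 : (∏ i, D i) % 4 = 3) :
    charProd (fun i j => if i ≠ j then 1 else 0) D =
      (1 + chi4 (D 0) + chi4 (D 1) + chi4 (D 2)) / 2 := by
  have hno : Odd (∏ i, D i) := by rw [Nat.odd_iff]; omega
  have hodd : ∀ i, Odd (D i) := fun i =>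
    hno.of_dvd_nat (Finset.dvd_prod_of_mem D (Finset.mem_univ i))
  have h01 := jr_mul_swap (hodd 0) (hodd 1) (coprime_of_prod_squarefree hs (by decide))
  have h02 := jr_mul_swap (hodd 0) (hodd 2) (coprime_of_prod_squarefree hs (by decide))
  have h12 := jr_mul_swap (hodd 1) (hodd 2) (coprime_of_prod_squarefree hs (by decide))
  have hprod : charProd (fun i j => if i ≠ j then 1 else 0) D =
      (jr (D 0) (D 1) * jr (D 1) (D 0)) * (jr (D 0) (D 2) * jr (D 2) (D 0)) *
        (jr (D 1) (D 2) * jr (D 2) (D 1)) := by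
    unfold charProd
    simp only [Fin.prod_univ_three]
    simp
    ring
  rw [hprod, h01, h02, h12]
  rw [Fin.prod_univ_three] at h4
  have hm : ∀ i, D i % 4 = 1 ∨ D i % 4 = 3 := fun i => by
    have := Nat.odd_iff.1 (hodd i)
    omega
  have h2 : ∀ i, D i % 2 ≠ 0 := fun i => by
    have := Nat.odd_iff.1 (hodd i)
    omega
  simp only [chi4_eq, h2, if_false]
  rw [Nat.mul_mod, Nat.mul_mod (D 0)] at h4
  rcases hm 0 with h | h <;> rcases hm 1 with h' | h' <;> rcases hm 2 with h'' | h'' <;>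
    rw [h, h', h''] at h4 <;> first
      | (simp only [h, h', h'']; norm_num; done)
      | exact absurd h4 (by norm_num)

lemma chi4_prod {κ : Type*} (f : κ → ℕ) (s : Finset κ) :
    chi4 (∏ x ∈ s, f x) = ∏ x ∈ s, chi4 (f x) := by
  induction s using Finset.induction_on with
  | empty => simp [chi4_eq]
  | insert b s hb ih => rw [Finset.prod_insert hb, Finset.prod_insert hb, chi4_mul, ih]

lemma sum_chi4_fib (n : ℕ) (j : Fin 3) :
    ∑ φ : n.primeFactors → Fin 3, chi4 (fib φ j) = secTerm n := by
  unfold secTerm fib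
  simp only [chi4_prod, Finset.prod_filter]
  rw [← Fintype.piFinset_univ, ← Finset.prod_univ_sum (fun _ => univ)
    (fun (p : n.primeFactors) i => chi4 (if i = j then (p : ℕ) else 1)),
    ← Finset.prod_coe_sort n.primeFactors fun p => 2 + chi4 p]
  refine Finset.prod_congr rfl fun p _ => ?_
  rw [Fin.sum_univ_three]
  have h1 : chi4 1 = 1 := by simp [chi4_eq]
  fin_cases j <;> simp [h1] <;> ring

lemma colSum_const {n : ℕ} (hn : Squarefree n) (h4 : n % 4 = 3) :
    colSum ConstSnd n = 3 / 2 * (3 ^ n.primeFactors.card + secTerm n) := by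
  have hne : Nonempty n.primeFactors := by
    obtain ⟨p, hp⟩ := Nat.nonempty_primeFactors.2 (by omega : 1 < n)
    exact ⟨⟨p, hp⟩⟩
  obtain ⟨p₀⟩ := hne
  unfold colSum
  rw [← (Equiv.arrowProdEquivProdArrow n.primeFactors (fun _ => Fin 3)
    (fun _ => Bool)).symm.sum_comp, Fintype.sum_prod_type]
  simp only [Equiv.arrowProdEquivProdArrow_symm_apply, prod_linkExp_eq]
  have hiff : ∀ (φ : n.primeFactors → Fin 3) (b : n.primeFactors → Bool), ConstSnd (Set.range
      ((Equiv.arrowProdEquivProdArrow n.primeFactors (fun _ => Fin 3) (fun _ => Bool)).symm (φ, b)))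
        ↔ b = (fun _ => false) ∨ b = fun _ => true := by
    intro φ b
    constructor
    · rintro ⟨c, hc⟩
      have h1 : b = fun _ => c := funext fun p => hc (φ p, b p) ⟨p, rfl⟩
      cases c
      · exact Or.inl h1
      · exact Or.inr h1
    · rintro (rfl | rfl)
      · exact ⟨false, by rintro _ ⟨p, rfl⟩; rfl⟩
      · exact ⟨true, by rintro _ ⟨p, rfl⟩; rfl⟩
  have hsplit : ∀ (φ : n.primeFactors → Fin 3) (b : n.primeFactors → Bool) (g : ℝ),
      (if b = (fun _ => false) ∨ b = (fun _ => true) then g else 0) =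
        (if b = (fun _ => false) then g else 0) + (if b = (fun _ => true) then g else 0) := by
    intro φ b g
    by_cases h1 : b = fun _ => false
    · have h2 : b ≠ fun _ => true := fun h2 => by
        have := congrFun (h1.symm.trans h2) p₀
        exact absurd this (by decide)
      rw [if_pos (Or.inl h1), if_pos h1, if_neg h2, add_zero]
    · by_cases h2 : b = fun _ => true
      · rw [if_pos (Or.inr h2), if_neg h1, if_pos h2, zero_add]
      · rw [if_neg (not_or.2 ⟨h1, h2⟩), if_neg h1, if_neg h2, add_zero]
  have hφ : ∀ φ : n.primeFactors → Fin 3, ∑ b : n.primeFactors → Bool,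
      (if b = (fun _ => false) ∨ b = (fun _ => true) then
        ∏ p, (if b p = true then ∏ q, jr (p : n.primeFactors) (q : n.primeFactors) ^
          (if φ p ≠ φ q then 1 else 0) else 1) else 0) =
      1 + (1 + chi4 (fib φ 0) + chi4 (fib φ 1) + chi4 (fib φ 2)) / 2 := by
    intro φ
    have hp := prod_fib hn φ
    rw [← charProd_three (hp.symm ▸ hn) (hp.symm ▸ h4), charProd_fib]
    simp only [hsplit φ]
    rw [Finset.sum_add_distrib, Finset.sum_ite_eq', Finset.sum_ite_eq', if_pos (Finset.mem_univ _),
      if_pos (Finset.mem_univ _)]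
    simp
  simp only [hiff, hφ]
  rw [Finset.sum_add_distrib, ← Finset.sum_div, Finset.sum_add_distrib, Finset.sum_add_distrib,
    Finset.sum_add_distrib, sum_chi4_fib, sum_chi4_fib, sum_chi4_fib, Finset.sum_const,
    Finset.card_univ, Fintype.card_fun, Fintype.card_coe, Fintype.card_fin, nsmul_eq_mul]
  push_cast
  ring

lemma secTerm_nonneg (n : ℕ) : 0 ≤ secTerm n :=
  Finset.prod_nonneg fun p _ => by
    have := (abs_le.1 (abs_chi4_le p)).1
    linarith

lemma secTerm_le (n : ℕ) : secTerm n ≤ 3 ^ n.primeFactors.card := by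
  unfold secTerm
  rw [← Finset.prod_const]
  refine Finset.prod_le_prod (fun p _ => ?_) fun p _ => ?_
  · have := (abs_le.1 (abs_chi4_le p)).1
    linarith
  · have := (abs_le.1 (abs_chi4_le p)).2
    linarith

/-- The main term dominates the moment of the constant patterns. -/
lemma abs_colSum_const_pow_sub_le (k : ℕ) {n : ℕ} (hn : Squarefree n) (h4 : n % 4 = 3) :
    |(1 / 48 * colSum ConstSnd n) ^ k - 1 / 2 ^ (5 * k) * (3 ^ n.primeFactors.card) ^ k| ≤
      k * (3 ^ n.primeFactors.card) ^ (k - 1) * secTerm n := by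
  set T : ℝ := 3 ^ n.primeFactors.card with hT
  have hT0 : 0 ≤ T := by positivity
  have hH0 := secTerm_nonneg n
  have hHT : secTerm n ≤ T := secTerm_le n
  have h1 : (1 / 48 * colSum ConstSnd n) ^ k - 1 / 2 ^ (5 * k) * T ^ k =
      ((T + secTerm n) / 32) ^ k - (T / 32) ^ k := by
    rw [colSum_const hn h4, ← hT, pow_mul, div_pow T]
    norm_num
    ring_nf
  rw [h1, abs_of_nonneg (sub_nonneg.2 (pow_le_pow_left₀ (by positivity) (by linarith) k))]
  have h2 : ∀ j : ℕ, ((T + secTerm n) / 32) ^ j - (T / 32) ^ j ≤ j * T ^ (j - 1) * secTerm n := by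
    intro j
    induction j with
    | zero => simp
    | succ j ih =>
      have h3 : ((T + secTerm n) / 32) ^ j ≤ T ^ j :=
        pow_le_pow_left₀ (by positivity) (by linarith) j
      rcases Nat.eq_zero_or_pos j with rfl | hj
      · simp; linarith
      have h5 : T ^ j = T * T ^ (j - 1) := by rw [← pow_succ']; congr 1; omega
      calc ((T + secTerm n) / 32) ^ (j + 1) - (T / 32) ^ (j + 1)
          = (T / 32) * (((T + secTerm n) / 32) ^ j - (T / 32) ^ j) +
            secTerm n / 32 * ((T + secTerm n) / 32) ^ j := by ring
        _ ≤ T * (j * T ^ (j - 1) * secTerm n) + secTerm n * T ^ j := by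
            refine add_le_add ?_ ?_
            · refine (mul_le_mul_of_nonneg_left ih (by positivity)).trans ?_
              exact mul_le_mul_of_nonneg_right (by linarith) (by positivity)
            · exact mul_le_mul (by linarith) h3 (by positivity) hH0
        _ = _ := by
            rw [Nat.add_sub_cancel, h5]; push_cast; ring
  exact h2 k

/-- The sign with which a pattern enters the difference of the two moments. -/
def patCoef {k : ℕ} (π : Idx k → Fin 3) : ℝ :=
  (if supCond OntoFst {u | π u ≠ 0} then 1 else 0) -
    (if supCond ConstSnd {u | π u ≠ 0} then 1 else 0)

lemma abs_patCoef_le {k : ℕ} (π : Idx k → Fin 3) : |patCoef π| ≤ 1 := by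
  unfold patCoef
  split_ifs <;> norm_num

lemma lev_eq_zero_iff {z m : ℕ} (hm : 1 ≤ m) : lev z m = 0 ↔ m = 1 := by
  unfold lev
  by_cases h : m ≤ 1
  · simp [le_antisymm h hm]
  · have h1 : m ≠ 1 := fun h1 => h h1.le
    by_cases h2 : m ≤ z <;> simp [h, h1, h2]

lemma sum_hw_mul_colSum_sub (k : ℕ) (c : ℝ) (N z : ℕ) :
    ∑ n ∈ Icc 1 N, (if n % 4 = 3 then hw c n else 0) *
        (colSum OntoFst n ^ k - colSum ConstSnd n ^ k) =
      ∑ π : Idx k → Fin 3, patCoef π * patSum c linkExpSum N z π := by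
  have h1 : ∀ n, (if n % 4 = 3 then hw c n else 0) *
        (colSum OntoFst n ^ k - colSum ConstSnd n ^ k) =
      (if n % 4 = 3 then hw c n else 0) * colSum OntoFst n ^ k -
        (if n % 4 = 3 then hw c n else 0) * colSum ConstSnd n ^ k := fun n => mul_sub _ _ _
  rw [Finset.sum_congr rfl fun n _ => h1 n, Finset.sum_sub_distrib, sum_hw_mul_colSum_pow,
    sum_hw_mul_colSum_pow, ← Finset.sum_sub_distrib]
  unfold patSum
  simp only [Finset.mul_sum]
  rw [Finset.sum_comm]
  refine Finset.sum_congr rfl fun D hD => ?_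
  have hD1 : ∀ u, 1 ≤ D u := fun u => (Finset.mem_Icc.1 (Fintype.mem_piFinset.1 hD u)).1
  by_cases hN : ∏ u, D u ≤ N
  · rw [Finset.sum_eq_single fun u => lev z (D u)]
    · have hset : {u | lev z (D u) ≠ 0} = {u | D u ≠ 1} := by
        ext u
        exact not_congr (lev_eq_zero_iff (hD1 u))
      have hif : (if ∏ u, D u ≤ N ∧ ∀ u, lev z (D u) = (fun u => lev z (D u)) u then
          wt c linkExpSum D else 0) = wt c linkExpSum D := if_pos ⟨hN, fun _ => rfl⟩
      rw [if_pos hN, if_pos hN, hif, patCoef, hset, sub_mul, ite_mul, ite_mul, one_mul, zero_mul]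
    · intro π _ hπ
      rw [if_neg, mul_zero]
      exact fun h => hπ (funext fun u => (h.2 u).symm)
    · intro h
      exact absurd (Finset.mem_univ _) h
  · rw [if_neg hN, if_neg hN, sub_zero]
    refine (Finset.sum_eq_zero fun π _ => ?_).symm
    rw [if_neg fun h => hN h.1, mul_zero]

/-- The size of the error terms. -/
def errBound (c δ : ℝ) (k K N z : ℕ) (w : ℝ) : ℝ :=
  K * (N / (1 + Real.log N)) * (1 + Real.log N) ^ δ * (1 + Real.log N) ^ (c * (3 ^ k - 1)) *
    (1 + Real.log z) ^ K + K * (N * (1 + Real.log N) ^ K / w)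

lemma errBound_mono {c δ : ℝ} {k K K' N z : ℕ} {w : ℝ} (hw : 0 ≤ w) (h : K ≤ K') :
    errBound c δ k K N z w ≤ errBound c δ k K' N z w := by
  have hN := one_le_one_add_log N
  have hz := one_le_one_add_log z
  unfold errBound
  gcongr

lemma errBound_nonneg {c δ : ℝ} {k K N z : ℕ} {w : ℝ} (hw : 0 ≤ w) :
    0 ≤ errBound c δ k K N z w := by
  have hN := one_le_one_add_log N
  have hz := one_le_one_add_log z
  unfold errBound
  positivity

lemma mul_errBound_le {c δ : ℝ} {k K N z : ℕ} {w : ℝ} (hw : 0 ≤ w) (M : ℕ) :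
    M * errBound c δ k K N z w ≤ errBound c δ k (M * K + K) N z w := by
  have hN := one_le_one_add_log N
  have hz := one_le_one_add_log z
  calc M * errBound c δ k K N z w = (M * K : ℕ) * (N / (1 + Real.log N)) * (1 + Real.log N) ^ δ *
        (1 + Real.log N) ^ (c * (3 ^ k - 1)) * (1 + Real.log z) ^ K +
          (M * K : ℕ) * (N * (1 + Real.log N) ^ K / w) := by
        unfold errBound; push_cast; ring
    _ ≤ _ := by
        unfold errBound
        gcongr <;> first | assumption | omega

lemma odd_of_linkParity_ne_zero {k : ℕ} {u v : Idx k} (h : linkParity u v ≠ 0) :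
    Odd (linkExpSum u v + linkExpSum v u) := by
  rw [linkParity_eq, Ne, ZMod.natCast_eq_zero_iff_even] at h
  exact Nat.not_even_iff_odd.1 h

lemma even_of_linkParity_eq_zero {k : ℕ} {u v : Idx k} (h : linkParity u v = 0) :
    Even (linkExpSum u v + linkExpSum v u) := by
  rwa [linkParity_eq, ZMod.natCast_eq_zero_iff_even] at h

lemma linkParity_comm {k : ℕ} (u v : Idx k) : linkParity u v = linkParity v u := by
  rw [linkParity_eq, linkParity_eq, add_comm]

lemma linkParity_self {k : ℕ} (u : Idx k) : linkParity u u = 0 := by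
  rw [linkParity_eq, linkExpSum_self]; simp

lemma Unlinked.exists_linked {k : ℕ} {B : Finset (Idx k)} (hB : Unlinked B) (h : B.card = 3 ^ k)
    {u : Idx k} (hu : u ∉ B) : ∃ v ∈ B, linkParity v u ≠ 0 := by
  by_contra! hcon
  have hU : Unlinked (insert u B) := by
    intro x hx y hy
    rcases Finset.mem_insert.1 hx with hx' | hx' <;> rcases Finset.mem_insert.1 hy with hy' | hy'
    · rw [hx', hy', linkParity_self]
    · rw [hx', linkParity_comm, hcon y hy']
    · rw [hy', hcon x hx']
    · exact hB x hx' y hy'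
  have := hU.card_le
  rw [Finset.card_insert_of_notMem hu] at this
  omega

lemma patCoef_eq_zero {k : ℕ} {π : Idx k → Fin 3} {τ : Fin k → Bool}
    (hτ : ∀ u, π u ≠ 0 ↔ ∀ s, (u s).2 = τ s) : patCoef π = 0 := by
  have h1 : supCond OntoFst {u | π u ≠ 0} := fun s i =>
    ⟨τ s, fun t => (i, τ t), (hτ _).2 fun _ => rfl, rfl⟩
  have h2 : supCond ConstSnd {u | π u ≠ 0} := fun s =>
    ⟨τ s, by rintro _ ⟨u, hu, rfl⟩; exact (hτ u).1 hu s⟩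
  rw [patCoef, if_pos h1, if_pos h2, sub_self]

lemma abs_patCoef_mul_patSum_le (k : ℕ) {c δ : ℝ} (hc : 0 ≤ c) (hδ : 0 < δ) (hδ1 : δ ≤ 1) :
    ∃ K : ℕ, ∀ (π : Idx k → Fin 3) (N z : ℕ) (w : ℝ), 1 ≤ N → 1 ≤ w → w ^ 32 ≤ z →
      |patCoef π * patSum c linkExpSum N z π| ≤ errBound c δ k K N z w := by
  obtain ⟨K₁, hK₁⟩ := abs_patSum_le (ι := Idx k) hc
  obtain ⟨K₂, hK₂⟩ := abs_patSum_le_of_linked (ι := Idx k) hc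
  obtain ⟨K₃, hK₃⟩ := abs_patSum_le_of_small (ι := Idx k) hc hδ hδ1
  refine ⟨K₁ + K₂ + K₃, fun π N z w hN hw hwz => ?_⟩
  have hw0 : 0 ≤ w := by linarith
  have hwz' : w ≤ z := (le_self_pow₀ hw (by norm_num)).trans hwz
  have hz : 1 ≤ z := by exact_mod_cast hw.trans hwz'
  have hN1 := one_le_one_add_log N
  have hz1 := one_le_one_add_log z
  have hle : |patCoef π * patSum c linkExpSum N z π| ≤ |patSum c linkExpSum N z π| := by
    rw [abs_mul]
    exact mul_le_of_le_one_left (abs_nonneg _) (abs_patCoef_le π)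
  have hexp : ∀ j : ℕ, j + 1 ≤ 3 ^ k → (1 + Real.log N) ^ (c * j) ≤
      (1 + Real.log N) ^ (c * (3 ^ k - 1)) := fun j hj => by
    refine Real.rpow_le_rpow_of_exponent_le hN1 (mul_le_mul_of_nonneg_left ?_ hc)
    have : ((j + 1 : ℕ) : ℝ) ≤ (3 ^ k : ℕ) := by exact_mod_cast hj
    push_cast at this
    linarith
  have hδN : 1 ≤ (1 + Real.log N) ^ δ := Real.one_le_rpow hN1 hδ.le
  set B : Finset (Idx k) := univ.filter fun u => π u = 2 with hB
  have hmem : ∀ u, u ∈ B ↔ π u = 2 := fun u => by rw [hB, Finset.mem_filter]; simp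
  by_cases hU : Unlinked B
  swap
  · unfold Unlinked at hU
    push Not at hU
    obtain ⟨u, hu, v, hv, huv⟩ := hU
    refine hle.trans ((hK₂ linkExpSum linkExpSum_self π u v ?_ ((hmem u).1 hu) ((hmem v).1 hv)
      (odd_of_linkParity_ne_zero huv) N z w hN hw hwz).trans ?_)
    · rintro rfl
      exact huv (linkParity_self _)
    · refine le_trans ?_ (errBound_mono hw0 (by omega : K₂ ≤ K₁ + K₂ + K₃))
      exact le_add_of_nonneg_left (by positivity)
  rcases hU.card_le.lt_or_eq with hlt | heq
  · refine hle.trans ((hK₁ linkExpSum π N z hN hz).trans ?_)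
    refine le_trans ?_ (errBound_mono hw0 (by omega : K₁ ≤ K₁ + K₂ + K₃))
    refine le_add_of_le_of_nonneg ?_ (by positivity)
    have := hexp B.card hlt
    rw [← hB]
    calc K₁ * (N / (1 + Real.log N)) * (1 + Real.log N) ^ (c * B.card) * (1 + Real.log z) ^ K₁
        ≤ K₁ * (N / (1 + Real.log N)) * (1 + Real.log N) ^ (c * (3 ^ k - 1)) *
          (1 + Real.log z) ^ K₁ := by gcongr
      _ = K₁ * (N / (1 + Real.log N)) * 1 * (1 + Real.log N) ^ (c * (3 ^ k - 1)) *
          (1 + Real.log z) ^ K₁ := by ring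
      _ ≤ _ := by gcongr
  · by_cases hsmall : ∃ u, π u = 1
    · obtain ⟨u, hu⟩ := hsmall
      have huB : u ∉ B := fun h => by
        rw [hmem, hu] at h
        exact absurd h (by decide)
      obtain ⟨v, hv, hvu⟩ := hU.exists_linked heq huB
      refine hle.trans ((hK₃ linkExpSum linkExpSum_self π u v hu ((hmem v).1 hv)
        (odd_of_linkParity_ne_zero hvu)
        (fun x hx => even_of_linkParity_eq_zero (hU v hv x ((hmem x).2 hx))) N z hN hz).trans ?_)
      refine le_trans ?_ (errBound_mono hw0 (by omega : K₃ ≤ K₁ + K₂ + K₃))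
      have hcard : ((univ.erase v).filter fun x => π x = 2).card + 1 ≤ 3 ^ k := by
        have : ((univ.erase v).filter fun x => π x = 2) = B.erase v := by
          ext x
          simp [hB, and_comm]
        rw [this, Finset.card_erase_of_mem hv]
        have := Finset.card_pos.2 ⟨v, hv⟩
        omega
      have := hexp _ hcard
      unfold errBound
      gcongr
    · obtain ⟨τ, hτ⟩ := hU.exists_type heq
      push Not at hsmall
      have h0 : patCoef π = 0 := patCoef_eq_zero (τ := τ) fun u => by
        rw [← hτ u, hmem]
        have := hsmall u
        generalize π u = i at *
        revert this
        fin_cases i <;> simp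
      rw [h0, zero_mul, abs_zero]
      exact errBound_nonneg hw0

/-- The moments over surjective and over constant patterns agree up to an error. -/
lemma abs_sum_colSum_sub_le (k : ℕ) {c δ : ℝ} (hc : 0 ≤ c) (hδ : 0 < δ) (hδ1 : δ ≤ 1) :
    ∃ K : ℕ, ∀ (N z : ℕ) (w : ℝ), 1 ≤ N → 1 ≤ w → w ^ 32 ≤ z →
      |∑ n ∈ Icc 1 N, (if n % 4 = 3 then hw c n else 0) *
        (colSum OntoFst n ^ k - colSum ConstSnd n ^ k)| ≤ errBound c δ k K N z w := by
  obtain ⟨K, hK⟩ := abs_patCoef_mul_patSum_le k hc hδ hδ1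
  refine ⟨Fintype.card (Idx k → Fin 3) * K + K, fun N z w hN hw hwz => ?_⟩
  rw [sum_hw_mul_colSum_sub k c N z]
  refine (Finset.abs_sum_le_sum_abs _ _).trans ((Finset.sum_le_card_nsmul _ _ _ fun π _ =>
    hK π N z w hN hw hwz).trans ?_)
  rw [nsmul_eq_mul, Finset.card_univ]
  exact mul_errBound_le (by linarith) _

lemma sum_hw_mul_secTerm (c : ℝ) (N : ℕ) :
    ∑ n ∈ Icc 1 N, hw c n * secTerm n =
      ∑ D ∈ Fintype.piFinset fun _ : Fin 3 => Icc 1 N, if ∏ u, D u ≤ N then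
        hw c (∏ u, D u) * chi4 (D 0) else 0 := by
  have h1 : ∀ n ∈ Icc 1 N, hw c n * secTerm n =
      ∑ D ∈ Fintype.piFinset fun _ : Fin 3 => Icc 1 N, if ∏ u, D u = n then
        hw c (∏ u, D u) * chi4 (D 0) else 0 := by
    intro n hn
    have hnN := (Finset.mem_Icc.1 hn).2
    by_cases hs : Squarefree n
    · rw [← sum_chi4_fib n 0, sum_fib hs hnN fun D => chi4 (D 0), Finset.mul_sum]
      refine Finset.sum_congr rfl fun D _ => ?_
      by_cases h2 : ∏ u, D u = n
      · rw [if_pos h2, if_pos h2, h2]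
      · rw [if_neg h2, if_neg h2, mul_zero]
    · rw [hw_of_not_squarefree hs, zero_mul]
      symm
      refine Finset.sum_eq_zero fun D _ => ?_
      by_cases h2 : ∏ u, D u = n
      · rw [if_pos h2, h2, hw_of_not_squarefree hs, zero_mul]
      · rw [if_neg h2]
  rw [Finset.sum_congr rfl h1, Finset.sum_comm]
  refine Finset.sum_congr rfl fun D hD => ?_
  rw [Fintype.mem_piFinset] at hD
  have hpos : 1 ≤ ∏ u, D u := Finset.one_le_prod' fun u _ => (Finset.mem_Icc.1 (hD u)).1
  rw [Finset.sum_ite_eq]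
  simp only [Finset.mem_Icc, hpos, true_and]

lemma abs_sum_mul_chi4_le {c : ℝ} (hc : 0 ≤ c) :
    ∃ K : ℕ, ∀ (M N z : ℕ) (w : ℝ), 1 ≤ M → 1 ≤ w → w ^ 2 ≤ z →
      |∑ m ∈ Icc 1 N, if m * M ≤ N then hw c (m * M) * chi4 m else 0| ≤
        hw c M * (K * (((N / M : ℕ) : ℝ) / (1 + Real.log (N / M : ℕ))) *
          ((1 + Real.log z) ^ K + 2 * 2 ^ M.primeFactors.card / w *
            (1 + Real.log (N / M : ℕ)) ^ K)) := by
  obtain ⟨K, hK⟩ := charSum_hw_le hc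
  refine ⟨K, fun M N z w hM hw1 hwz => ?_⟩
  have hw0 : 0 < w := by linarith
  have hz : 1 ≤ z := by exact_mod_cast (one_le_pow₀ hw1).trans hwz
  have hY1 := one_le_one_add_log (N / M)
  rw [sum_mul_le_eq hM N fun m => hw c (m * M) * chi4 m]
  have hterm : ∀ m, hw c (m * M) * chi4 m =
      hw c M * ((if m.Coprime M then chi4 m else 0) * hw c m) := by
    intro m
    rw [hw_mul]
    by_cases h : m.Coprime M
    · rw [if_pos h, if_pos h]; ring
    · rw [if_neg h, if_neg h]; ring
  simp only [hterm]
  rw [← Finset.mul_sum, abs_mul, abs_of_nonneg (hw_nonneg hc M)]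
  refine mul_le_mul_of_nonneg_left ?_ (hw_nonneg hc M)
  refine (hK _ _ (isChar_chi4.coprime (by omega : M ≠ 0)) z (N / M) hz).trans ?_
  have hsqrt : √(2 ^ M.primeFactors.card * 4 / z) ≤ 2 * 2 ^ M.primeFactors.card / w := by
    rw [Real.sqrt_le_left (by positivity)]
    have h2 : (1 : ℝ) ≤ 2 ^ M.primeFactors.card := one_le_pow₀ (by norm_num)
    calc (2 : ℝ) ^ M.primeFactors.card * 4 / z ≤ 2 ^ M.primeFactors.card * 4 / w ^ 2 := by gcongr
      _ = 1 * 2 ^ M.primeFactors.card * 4 / w ^ 2 := by ring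
      _ ≤ 2 ^ M.primeFactors.card * 2 ^ M.primeFactors.card * 4 / w ^ 2 := by gcongr
      _ = _ := by ring
  gcongr

/-- The secondary term is small on average. -/
lemma sum_hw_mul_secTerm_le {c δ : ℝ} (hc : 0 ≤ c) (hδ : 0 < δ) (hδ1 : δ ≤ 1) :
    ∃ K : ℕ, ∀ (N z : ℕ) (w : ℝ), 1 ≤ N → 1 ≤ w → w ^ 2 ≤ z →
      ∑ n ∈ Icc 1 N, hw c n * secTerm n ≤
        K * (N / (1 + Real.log N)) * (1 + Real.log N) ^ δ * (1 + Real.log N) ^ (2 * c) *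
          (1 + Real.log z) ^ K + K * (N * (1 + Real.log N) ^ K / w) := by
  obtain ⟨K₀, hK₀⟩ := abs_sum_mul_chi4_le hc
  obtain ⟨K₁, hK₁0, hK₁⟩ := sum_tuple_erase_le (ι := Fin 3) δ hδ hδ1 (max 1 c) (le_max_left _ _)
  obtain ⟨K₂, hK₂1, hK₂⟩ := sum_hw_div_le c hc
  obtain ⟨K₃, hK₃⟩ := sum_piFinset_prod_hw_div_le (ι := Fin 3) (by positivity : 0 ≤ 2 * c)
  set A : ℝ := K₀ * K₁ * K₂ ^ 2 with hA
  refine ⟨⌈A⌉₊ + 2 * K₀ * K₃ + (K₀ + K₃), fun N z w hN hw1 hwz => ?_⟩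
  set K := ⌈A⌉₊ + 2 * K₀ * K₃ + (K₀ + K₃) with hK
  have hw0 : 0 < w := by linarith
  have hN1 := one_le_one_add_log N
  have hz1 := one_le_one_add_log z
  set ℓ := 1 + Real.log N with hℓ
  set v : Fin 3 := 0
  set t := Function.update (fun _ : Fin 3 => Icc 1 N) v {1} with ht
  have htsub : ∀ x, t x ⊆ Icc 1 N := by
    intro x
    by_cases hx : x = v
    · rw [ht, hx, Function.update_self, Finset.singleton_subset_iff, Finset.mem_Icc]; omega
    · rw [ht, Function.update_of_ne hx]
  set Fm : (Fin 3 → ℕ) → ℝ := fun D => if ∏ x ∈ univ.erase v, D x ≤ N then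
      (∏ x ∈ univ.erase v, hw c (D x)) *
        (((N / ∏ x ∈ univ.erase v, D x : ℕ) : ℝ) /
          (1 + Real.log (N / ∏ x ∈ univ.erase v, D x : ℕ))) else 0 with hFm
  have hinner : ∀ D ∈ Fintype.piFinset t, ∑ m ∈ Icc 1 N,
      (if ∏ x, Function.update D v m x ≤ N then
        hw c (∏ x, Function.update D v m x) * chi4 (Function.update D v m 0) else 0) ≤
      K₀ * (1 + Real.log z) ^ K₀ * Fm D +
        2 * K₀ * (N * ℓ ^ K₀ / w) * ∏ x, (hw (2 * c) (D x) / D x) := by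
    intro D hD
    rw [Fintype.mem_piFinset] at hD
    have hDv : D v = 1 := by simpa [ht] using hD v
    have hDpos : ∀ x, 1 ≤ D x := fun x => (Finset.mem_Icc.1 (htsub x (hD x))).1
    simp only [prod_update_one hDv]
    rw [Finset.sum_congr rfl fun m _ => by rw [show Function.update D v m 0 = m from
      Function.update_self v m D]]
    have hMe : ∏ x ∈ univ.erase v, D x = ∏ x, D x := Finset.prod_erase _ hDv
    set M := ∏ x, D x with hM
    have hMpos : 1 ≤ M := Finset.one_le_prod' fun x _ => hDpos x
    have hM0 : (0 : ℝ) < M := by exact_mod_cast hMpos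
    refine (le_abs_self _).trans ((hK₀ M N z w hMpos hw1 hwz).trans ?_)
    have hY1 := one_le_one_add_log (N / M)
    have hYℓ : 1 + Real.log (N / M : ℕ) ≤ ℓ := one_add_log_mono (Nat.div_le_self N M)
    have hwM := hw_nonneg hc M
    have hfirst : hw c M * (((N / M : ℕ) : ℝ) / (1 + Real.log (N / M : ℕ))) ≤ Fm D := by
      rw [hFm]
      dsimp only
      rw [hMe]
      by_cases hMN : M ≤ N
      · rw [if_pos hMN]
        refine mul_le_mul_of_nonneg_right ?_ (by positivity)
        rw [← hMe]
        exact hw_prod_le hc D _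
      · rw [if_neg hMN, Nat.div_eq_of_lt (by omega)]
        simp
    have hsecond : hw c M * 2 ^ M.primeFactors.card * (((N / M : ℕ) : ℝ) /
        (1 + Real.log (N / M : ℕ))) ≤ N * ∏ x, (hw (2 * c) (D x) / D x) := by
      have h1 : ((N / M : ℕ) : ℝ) / (1 + Real.log (N / M : ℕ)) ≤ N / M :=
        (div_le_self (by positivity) hY1).trans Nat.cast_div_le
      have h2 : hw c M * 2 ^ M.primeFactors.card ≤ ∏ x, hw (2 * c) (D x) :=
        (hw_mul_two_pow_le c M).trans (hw_prod_le (by positivity) D univ)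
      calc _ ≤ (∏ x, hw (2 * c) (D x)) * (N / M) := by
            refine mul_le_mul h2 h1 (by positivity) (Finset.prod_nonneg fun x _ =>
              hw_nonneg (by positivity) _)
        _ = _ := by
            rw [Finset.prod_div_distrib, hM]
            push_cast
            ring
    calc hw c M * (K₀ * (((N / M : ℕ) : ℝ) / (1 + Real.log (N / M : ℕ))) *
          ((1 + Real.log z) ^ K₀ + 2 * 2 ^ M.primeFactors.card / w *
            (1 + Real.log (N / M : ℕ)) ^ K₀))
        = K₀ * (1 + Real.log z) ^ K₀ *
            (hw c M * (((N / M : ℕ) : ℝ) / (1 + Real.log (N / M : ℕ)))) +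
          2 * K₀ * ((1 + Real.log (N / M : ℕ)) ^ K₀ / w) * (hw c M * 2 ^ M.primeFactors.card *
            (((N / M : ℕ) : ℝ) / (1 + Real.log (N / M : ℕ)))) := by ring
      _ ≤ K₀ * (1 + Real.log z) ^ K₀ * Fm D +
          2 * K₀ * (ℓ ^ K₀ / w) * (N * ∏ x, (hw (2 * c) (D x) / D x)) := by gcongr
      _ = _ := by ring
  rw [sum_hw_mul_secTerm, sum_piFinset_isolate _ v]
  refine (Finset.sum_le_sum hinner).trans ?_
  rw [Finset.sum_add_distrib, ← Finset.mul_sum, ← Finset.mul_sum]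
  have h1 := hK₁ (fun _ => hw c) v (fun _ => isWeight_hw hc (le_max_right _ _)) N hN
  have h2 : ∏ x ∈ univ.erase v, ∑ m ∈ Icc 1 N, hw c m / m ≤ K₂ ^ 2 * ℓ ^ (2 * c) := by
    rw [Finset.prod_const, Finset.card_erase_of_mem (Finset.mem_univ _), Finset.card_univ,
      Fintype.card_fin]
    refine (pow_le_pow_left₀ (Finset.sum_nonneg fun m _ => div_nonneg (hw_nonneg hc m)
      (by positivity)) (hK₂ N) 2).trans ?_
    rw [mul_pow, ← Real.rpow_natCast (ℓ ^ c), ← Real.rpow_mul (by positivity), mul_comm c]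
    norm_num
  have h3 := hK₃ N t htsub
  have hAK : A ≤ K := by
    refine (Nat.le_ceil A).trans ?_
    exact_mod_cast (by omega : ⌈A⌉₊ ≤ K)
  have hBK : ((2 * K₀ * K₃ : ℕ) : ℝ) ≤ K := by exact_mod_cast (by omega : 2 * K₀ * K₃ ≤ K)
  have hzK : (1 + Real.log z) ^ K₀ ≤ (1 + Real.log z) ^ K :=
    pow_le_pow_right₀ hz1 (by omega)
  have hℓK : ℓ ^ (K₀ + K₃) ≤ ℓ ^ K := pow_le_pow_right₀ hN1 (by omega)
  refine add_le_add ?_ ?_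
  · calc K₀ * (1 + Real.log z) ^ K₀ * ∑ D ∈ Fintype.piFinset t, Fm D
        ≤ K₀ * (1 + Real.log z) ^ K₀ * (K₁ * (N / ℓ) * ℓ ^ δ * (K₂ ^ 2 * ℓ ^ (2 * c))) := by
          refine mul_le_mul_of_nonneg_left (h1.trans ?_) (by positivity)
          gcongr
      _ = A * (N / ℓ) * ℓ ^ δ * ℓ ^ (2 * c) * (1 + Real.log z) ^ K₀ := by
          rw [hA]; ring
      _ ≤ _ := by gcongr
  · calc _ ≤ 2 * K₀ * (N * ℓ ^ K₀ / w) * (K₃ * ℓ ^ K₃) := by gcongr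
      _ = (2 * K₀ * K₃ : ℕ) * (N * ℓ ^ (K₀ + K₃) / w) := by push_cast; ring
      _ ≤ _ := by gcongr

/-- The moment and its main term agree up to an error. -/
lemma abs_moment_sub_le {k : ℕ} (hk : 1 ≤ k) {c δ : ℝ} (hc : 0 ≤ c) (hδ : 0 < δ) (hδ1 : δ ≤ 1) :
    ∃ K : ℕ, ∀ (N z : ℕ) (w : ℝ), 1 ≤ N → 1 ≤ w → w ^ 32 ≤ z →
      |∑ n ∈ Icc 1 N, (if n % 4 = 3 then hw c n else 0) *
        ((1 / 48 * colSum OntoFst n) ^ k - 1 / 2 ^ (5 * k) * (3 ^ n.primeFactors.card) ^ k)| ≤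
          errBound c δ k K N z w := by
  obtain ⟨K₁, hK₁⟩ := abs_sum_colSum_sub_le k hc hδ hδ1
  have hc' : 0 ≤ c * 3 ^ (k - 1) := by positivity
  obtain ⟨K₂, hK₂⟩ := sum_hw_mul_secTerm_le hc' hδ hδ1
  refine ⟨2 * (K₁ + (k * K₂ + K₂)) + (K₁ + (k * K₂ + K₂)), fun N z w hN hw1 hwz => ?_⟩
  have hw0 : 0 ≤ w := by linarith
  have hN1 := one_le_one_add_log N
  have hz1 := one_le_one_add_log z
  have hsplit : ∀ n, (if n % 4 = 3 then hw c n else 0) *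
        ((1 / 48 * colSum OntoFst n) ^ k - 1 / 2 ^ (5 * k) * (3 ^ n.primeFactors.card) ^ k) =
      (1 / 48) ^ k * ((if n % 4 = 3 then hw c n else 0) *
        (colSum OntoFst n ^ k - colSum ConstSnd n ^ k)) +
      (if n % 4 = 3 then hw c n else 0) * ((1 / 48 * colSum ConstSnd n) ^ k -
        1 / 2 ^ (5 * k) * (3 ^ n.primeFactors.card) ^ k) := by
    intro n
    rw [mul_pow, mul_pow]
    ring
  rw [Finset.sum_congr rfl fun n _ => hsplit n, Finset.sum_add_distrib, ← Finset.mul_sum]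
  have h1 : |(1 / 48 : ℝ) ^ k * ∑ n ∈ Icc 1 N, (if n % 4 = 3 then hw c n else 0) *
        (colSum OntoFst n ^ k - colSum ConstSnd n ^ k)| ≤ errBound c δ k K₁ N z w := by
    rw [abs_mul]
    refine (mul_le_of_le_one_left (abs_nonneg _) ?_).trans (hK₁ N z w hN hw1 hwz)
    rw [abs_of_nonneg (by positivity)]
    exact pow_le_one₀ (by norm_num) (by norm_num)
  have h2 : |∑ n ∈ Icc 1 N, (if n % 4 = 3 then hw c n else 0) *
      ((1 / 48 * colSum ConstSnd n) ^ k - 1 / 2 ^ (5 * k) * (3 ^ n.primeFactors.card) ^ k)| ≤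
        errBound c δ k (k * K₂ + K₂) N z w := by
    have hterm : ∀ n, |(if n % 4 = 3 then hw c n else 0) * ((1 / 48 * colSum ConstSnd n) ^ k -
        1 / 2 ^ (5 * k) * (3 ^ n.primeFactors.card) ^ k)| ≤
          k * (hw (c * 3 ^ (k - 1)) n * secTerm n) := by
      intro n
      have hr : 0 ≤ (k : ℝ) * (hw (c * 3 ^ (k - 1)) n * secTerm n) :=
        mul_nonneg (by positivity) (mul_nonneg (hw_nonneg hc' n) (secTerm_nonneg n))
      by_cases h4 : n % 4 = 3
      swap
      · rw [if_neg h4, zero_mul, abs_zero]; exact hr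
      by_cases hn : Squarefree n
      swap
      · rw [hw_of_not_squarefree hn, ite_self, zero_mul, abs_zero]; exact hr
      rw [if_pos h4, abs_mul, abs_of_nonneg (hw_nonneg hc n)]
      refine (mul_le_mul_of_nonneg_left (abs_colSum_const_pow_sub_le k hn h4)
        (hw_nonneg hc n)).trans (le_of_eq ?_)
      rw [hw_of_squarefree hn, hw_of_squarefree hn, mul_pow, ← pow_mul, ← pow_mul,
        mul_comm (k - 1)]
      ring
    refine (Finset.abs_sum_le_sum_abs _ _).trans ((Finset.sum_le_sum fun n _ => hterm n).trans ?_)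
    rw [← Finset.mul_sum]
    have hwz2 : w ^ 2 ≤ z := (pow_le_pow_right₀ hw1 (by norm_num)).trans hwz
    refine (mul_le_mul_of_nonneg_left ((hK₂ N z w hN hw1 hwz2).trans ?_)
      (by positivity)).trans (mul_errBound_le hw0 k)
    have hexp : 2 * (c * 3 ^ (k - 1)) ≤ c * (3 ^ k - 1) := by
      obtain ⟨j, rfl⟩ : ∃ j, k = j + 1 := ⟨k - 1, by omega⟩
      have h3 : (1 : ℝ) ≤ 3 ^ j := one_le_pow₀ (by norm_num)
      rw [Nat.add_sub_cancel, pow_succ]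
      nlinarith
    have := Real.rpow_le_rpow_of_exponent_le hN1 hexp
    unfold errBound
    gcongr
  refine (abs_add_le _ _).trans ((add_le_add h1 h2).trans ?_)
  refine (add_le_add (errBound_mono hw0 (by omega : K₁ ≤ K₁ + (k * K₂ + K₂)))
    (errBound_mono hw0 (by omega : k * K₂ + K₂ ≤ K₁ + (k * K₂ + K₂)))).trans ?_
  rw [← two_mul]
  exact_mod_cast mul_errBound_le hw0 2

/-- A choice of parameters that makes the error small. -/
lemma exists_errBound_le {c ε : ℝ} (hc : 0 ≤ c) (hε : 0 < ε) (k K : ℕ) :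
    ∃ C : ℝ, 0 ≤ C ∧ ∀ N : ℕ, 1 ≤ N → ∃ (z : ℕ) (w : ℝ), 1 ≤ w ∧ w ^ 32 ≤ z ∧
      errBound c (min 1 (ε / 2)) k K N z w ≤
        C * (N / (1 + Real.log N) * (1 + Real.log N) ^ (c * (3 ^ k - 1) + ε)) := by
  set η : ℝ := ε / (2 * (K + 1)) with hη
  have hη0 : 0 < η := by positivity
  set m : ℕ := ⌈(K + 1) / η⌉₊ with hm
  have hmη : K + 1 ≤ η * m := by
    have := Nat.le_ceil ((K + 1) / η)
    rw [div_le_iff₀ hη0] at this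
    rw [mul_comm]
    exact this
  refine ⟨K * 34 ^ K + K * m.factorial, by positivity, fun N hN => ?_⟩
  have hN1 := one_le_one_add_log N
  set ℓ := 1 + Real.log N with hℓ
  have hℓ0 : 0 < ℓ := by linarith
  have hx1 : 1 ≤ ℓ ^ η := Real.one_le_rpow hN1 hη0.le
  have hw1 : 1 ≤ Real.exp (ℓ ^ η) := Real.one_le_exp (by positivity)
  refine ⟨⌈Real.exp (ℓ ^ η) ^ 32⌉₊, Real.exp (ℓ ^ η), hw1, Nat.le_ceil _, ?_⟩
  set z := ⌈Real.exp (ℓ ^ η) ^ 32⌉₊ with hz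
  have hz0 : (1 : ℝ) ≤ z := (one_le_pow₀ hw1).trans (Nat.le_ceil _)
  have hlogz : 1 + Real.log z ≤ 34 * ℓ ^ η := by
    have h1 : (z : ℝ) ≤ 2 * Real.exp (ℓ ^ η) ^ 32 := by
      have h2 := (Nat.ceil_lt_add_one (by positivity : 0 ≤ Real.exp (ℓ ^ η) ^ 32)).le
      have h3 : 1 ≤ Real.exp (ℓ ^ η) ^ 32 := one_le_pow₀ hw1
      linarith
    have h4 := Real.log_le_log (by linarith) h1
    rw [Real.log_mul (by norm_num) (by positivity), Real.log_pow, Real.log_exp] at h4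
    have h5 : Real.log 2 ≤ 1 := by linarith [Real.log_le_sub_one_of_pos (by norm_num : (0:ℝ) < 2)]
    push_cast at h4
    linarith
  have hlogz0 : 0 ≤ 1 + Real.log z := by linarith [Real.log_nonneg hz0]
  have hzK : (1 + Real.log z) ^ K ≤ 34 ^ K * ℓ ^ (ε / 2) := by
    refine (pow_le_pow_left₀ hlogz0 hlogz K).trans ?_
    rw [mul_pow, ← Real.rpow_natCast (ℓ ^ η), ← Real.rpow_mul hℓ0.le]
    refine mul_le_mul_of_nonneg_left (Real.rpow_le_rpow_of_exponent_le hN1 ?_) (by positivity)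
    rw [hη, div_mul_eq_mul_div, div_le_div_iff₀ (by positivity) (by positivity)]
    nlinarith
  have hδ : ℓ ^ (min 1 (ε / 2)) ≤ ℓ ^ (ε / 2) :=
    Real.rpow_le_rpow_of_exponent_le hN1 (min_le_right _ _)
  have hexp : ℓ ^ K / Real.exp (ℓ ^ η) ≤ m.factorial / ℓ := by
    have h1 : (ℓ ^ η) ^ m / m.factorial ≤ Real.exp (ℓ ^ η) :=
      Real.pow_div_factorial_le_exp _ (by positivity) m
    have h2 : ℓ ^ (K + 1) ≤ (ℓ ^ η) ^ m := by
      rw [← Real.rpow_natCast (ℓ ^ η), ← Real.rpow_mul hℓ0.le, ← Real.rpow_natCast ℓ]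
      refine Real.rpow_le_rpow_of_exponent_le hN1 ?_
      push_cast
      exact hmη
    rw [div_le_iff₀ (by positivity)] at h1
    rw [div_le_div_iff₀ (by positivity) hℓ0, ← pow_succ]
    linarith
  have hE : 1 ≤ ℓ ^ (c * (3 ^ k - 1) + ε) := by
    refine Real.one_le_rpow hN1 (add_nonneg (mul_nonneg hc ?_) hε.le)
    exact sub_nonneg.2 (one_le_pow₀ (by norm_num))
  unfold errBound
  rw [add_mul]
  refine add_le_add ?_ ?_
  · calc K * (N / ℓ) * ℓ ^ (min 1 (ε / 2)) * ℓ ^ (c * (3 ^ k - 1)) * (1 + Real.log z) ^ K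
        ≤ K * (N / ℓ) * ℓ ^ (ε / 2) * ℓ ^ (c * (3 ^ k - 1)) * (34 ^ K * ℓ ^ (ε / 2)) := by
          gcongr
      _ = K * 34 ^ K * (N / ℓ * (ℓ ^ (c * (3 ^ k - 1)) * (ℓ ^ (ε / 2) * ℓ ^ (ε / 2)))) := by ring
      _ = _ := by
          rw [← Real.rpow_add hℓ0, ← Real.rpow_add hℓ0, add_halves]
  · calc (K : ℝ) * (N * ℓ ^ K / Real.exp (ℓ ^ η)) = K * (N * (ℓ ^ K / Real.exp (ℓ ^ η))) := by
          ring
      _ ≤ K * (N * (m.factorial / ℓ)) := by gcongr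
      _ = K * m.factorial * (N / ℓ * 1) := by ring
      _ ≤ _ := by gcongr

lemma natCast_lt_iff_le_ceil_sub {X : ℝ} (n : ℕ) (hn : 1 ≤ n) :
    (n : ℝ) < X ↔ n ≤ ⌈X⌉₊ - 1 := by
  rw [← Nat.lt_ceil]
  omega

lemma isFundDisc_neg_iff {n : ℕ} (h4 : n % 4 = 3) : IsFundDisc (-(n : ℤ)) ↔ Squarefree n := by
  unfold IsFundDisc
  rw [← Int.squarefree_natAbs, Int.natAbs_neg, Int.natAbs_natCast]
  constructor
  · rintro (h | ⟨m, hm, _⟩)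
    · exact h.2
    · omega
  · exact fun h => Or.inl ⟨by omega, h⟩

lemma sum_Dminus (X : ℝ) (F : ℤ → ℝ) :
    ∑ d ∈ Dminus X 1 4, F d = ∑ n ∈ Icc 1 (⌈X⌉₊ - 1),
      if n % 4 = 3 ∧ Squarefree n then F (-(n : ℤ)) else 0 := by
  rw [← Finset.sum_filter]
  refine Finset.sum_bij' (fun d _ => d.natAbs) (fun n _ => -(n : ℤ)) ?_ ?_ ?_ ?_ ?_
  · intro d hd
    obtain ⟨_, hf, h0, hX, h4⟩ := Finset.mem_filter.1 hd
    obtain ⟨n, rfl⟩ : ∃ n : ℕ, d = -n := ⟨d.natAbs, by omega⟩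
    have hn1 : 1 ≤ n := by omega
    have hn4 : n % 4 = 3 := by omega
    rw [Int.natAbs_neg, Int.natAbs_natCast, Finset.mem_filter, Finset.mem_Icc]
    refine ⟨⟨hn1, (natCast_lt_iff_le_ceil_sub n hn1).1 ?_⟩, hn4, (isFundDisc_neg_iff hn4).1 hf⟩
    push_cast at hX
    linarith
  · intro n hn
    obtain ⟨hI, hn4, hs⟩ := Finset.mem_filter.1 hn
    obtain ⟨hn1, hnX⟩ := Finset.mem_Icc.1 hI
    have hX := (natCast_lt_iff_le_ceil_sub n hn1).2 hnX
    have hc : (n : ℤ) ≤ ⌈X⌉ := by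
      have : ((n : ℤ) : ℝ) ≤ ⌈X⌉ := by
        push_cast
        exact hX.le.trans (Int.le_ceil X)
      exact_mod_cast this
    refine Finset.mem_filter.2 ⟨Finset.mem_Icc.2 ⟨by omega, by omega⟩,
      (isFundDisc_neg_iff hn4).2 hs, by omega, ?_, by omega⟩
    push_cast
    linarith
  · intro d hd
    have := (Finset.mem_filter.1 hd).2.2.1
    omega
  · intro n _
    simp
  · intro d hd
    have := (Finset.mem_filter.1 hd).2.2.1
    congr 1
    omega

lemma moment_eq (k : ℕ) (a X : ℝ) :
    (∑ d ∈ Dminus X 1 4, (a ^ omegaZ d * ftilde d) ^ k) -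
        (1 / 2 ^ (5 * k)) * ∑ d ∈ Dminus X 1 4, (3 * a) ^ (k * omegaZ d) =
      ∑ n ∈ Icc 1 (⌈X⌉₊ - 1), (if n % 4 = 3 then hw (a ^ k) n else 0) *
        ((1 / 48 * colSum OntoFst n) ^ k - 1 / 2 ^ (5 * k) * (3 ^ n.primeFactors.card) ^ k) := by
  rw [Finset.mul_sum, ← Finset.sum_sub_distrib, sum_Dminus]
  refine Finset.sum_congr rfl fun n _ => ?_
  by_cases h4 : n % 4 = 3
  swap
  · rw [if_neg h4, if_neg fun h => h4 h.1, zero_mul]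
  by_cases hn : Squarefree n
  swap
  · rw [if_pos h4, if_neg fun h => hn h.2, hw_of_not_squarefree hn, zero_mul]
  have hω : omegaZ (-(n : ℤ)) = n.primeFactors.card := by
    rw [omegaZ, Int.natAbs_neg, Int.natAbs_natCast]
  rw [if_pos h4, if_pos ⟨h4, hn⟩, colSum_onto hn h4, hω, hw_of_squarefree hn, mul_pow, mul_pow,
    mul_comm k, ← pow_mul, ← pow_mul, ← pow_mul, mul_comm k]
  ring

theorem moments_neg_1_mod_4 (k : ℕ) (hk : 1 ≤ k) (a : ℝ) (ha : 1 / 3 ≤ a)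
    (ε : ℝ) (hε : 0 < ε) :
    (fun X : ℝ =>
        (∑ d ∈ Dminus X 1 4, (a ^ omegaZ d * ftilde d) ^ k) -
          (1 / 2 ^ (5 * k)) * ∑ d ∈ Dminus X 1 4, (3 * a) ^ (k * omegaZ d))
      =O[atTop] fun X : ℝ => X * Real.log X ^ ((3 * a) ^ k - a ^ k - 1 + ε) := by
  have ha0 : 0 ≤ a := by linarith
  have hc : 0 ≤ a ^ k := by positivity
  obtain ⟨K, hK⟩ := abs_moment_sub_le hk hc (lt_min one_pos (half_pos hε)) (min_le_left _ _)
  obtain ⟨C, hC0, hC⟩ := exists_errBound_le hc hε k K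
  set E : ℝ := a ^ k * (3 ^ k - 1) + ε with hE
  have hE0 : 0 ≤ E :=
    add_nonneg (mul_nonneg hc (sub_nonneg.2 (one_le_pow₀ (by norm_num)))) hε.le
  have hexp : (3 * a) ^ k - a ^ k - 1 + ε = E - 1 := by
    rw [hE, mul_pow]; ring
  refine IsBigO.of_bound (C * 2 ^ E) ?_
  filter_upwards [eventually_ge_atTop (3 : ℝ)] with X hX
  have hlogX : 1 ≤ Real.log X := by
    rw [Real.le_log_iff_exp_le (by linarith)]
    linarith [Real.exp_one_lt_d9]
  set N := ⌈X⌉₊ - 1 with hN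
  have hceil : X ≤ ⌈X⌉₊ := Nat.le_ceil X
  have hceil3 : 3 ≤ ⌈X⌉₊ := by exact_mod_cast hX.trans hceil
  have hN1 : 1 ≤ N := by omega
  have hNX : (N : ℝ) < X := (natCast_lt_iff_le_ceil_sub N hN1).2 le_rfl
  have hXN : X ≤ 2 * N := by
    have h1 : ((⌈X⌉₊ : ℕ) : ℝ) = N + 1 := by
      have : ⌈X⌉₊ = N + 1 := by omega
      exact_mod_cast this
    linarith
  have hN0 : (0 : ℝ) < N := by exact_mod_cast hN1
  have hl1 : Real.log X ≤ 1 + Real.log N := by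
    have h1 := Real.log_le_log (by linarith) hXN
    rw [Real.log_mul (by norm_num) hN0.ne'] at h1
    linarith [Real.log_le_sub_one_of_pos (by norm_num : (0 : ℝ) < 2)]
  have hl2 : 1 + Real.log N ≤ 2 * Real.log X := by
    linarith [Real.log_le_log hN0 hNX.le]
  obtain ⟨z, w, hw1, hwz, hle⟩ := hC N hN1
  have hlX0 : 0 < Real.log X := by linarith
  rw [moment_eq, Real.norm_eq_abs, Real.norm_eq_abs,
    abs_of_nonneg (by positivity : 0 ≤ X * Real.log X ^ ((3 * a) ^ k - a ^ k - 1 + ε)), hexp,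
    Real.rpow_sub_one hlX0.ne']
  refine (hK N z w hN1 hw1 hwz).trans (hle.trans ?_)
  calc C * (N / (1 + Real.log N) * (1 + Real.log N) ^ E)
      ≤ C * (X / Real.log X * (2 * Real.log X) ^ E) := by
        gcongr
    _ = _ := by
        rw [Real.mul_rpow (by norm_num) hlX0.le]
        ring
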